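/- Let finite alphabets 𝒳₁, 𝒳₂, 𝒲, 𝒳̃₁, 𝒳̃₂, 𝒴 be given, with the MAC composed of deterministic links: Ỹ = (f₁(X̃₁), f₂(X̃₂)) =: (Ỹ₁,Ỹ₂) for deterministic maps f₁, f₂. Let q_{X₁X₂WY} be a target pmf with I(X₁;X₂|W) = 0. Suppose the rate pair (R₀₁,R₀₂) is achievable for q_{X₁X₂WY} without cribbing for some R₀₂ ≥ 0, i.e., there exists a sequence of (2^{nR₀₁},2^{nR₀₂},n) non-cribbing codes whose induced marginal on (X₁ⁿ,X₂ⁿ,Wⁿ,Yⁿ) converges to q^{(n)}_{X₁X₂WY} in total variation (ℓ₁) distance. Then there exist finite sets 𝒯 with |𝒯| ≤ 3, 𝒰₁ with |𝒰₁| ≤ |𝒳₁||𝒳₂||𝒲||𝒳̃₁||𝒳̃₂||𝒴̃||𝒴|, 𝒰₂ with |𝒰₂| ≤ |𝒰₁||𝒳₁||𝒳₂||𝒲||𝒳̃₁||𝒳̃₂||𝒴̃||𝒴|, and a pmf of the form p(x₁,x₂,w,t,u₁,u₂,x̃₁,x̃₂,ỹ,y) = q(w)q(x₁|w)q(x₂|w)·p(t)·∏_{j=1,2}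 p(u_j|x_j,t)p(x̃_j|u_j,x_j,t) · 𝟙{ỹ=(f₁(x̃₁),f₂(x̃₂))} · p(y|u₁,u₂,w,ỹ,t), whose conditional (X₁,X₂,W,Y)-marginal given T=t equals q(x₁,x₂,w,y) for every t, such that H(Ỹ₁|W,T) ≥ I(U₁,Ỹ₁;X₁|W,T), H(Ỹ₂|W,T) ≥ I(U₂,Ỹ₂;X₂|W,T), and R₀₁ ≥ I(U₁,Ỹ₁;X₁,Y|X₂,W,T) − H(Ỹ₁|W,T). -/

import Mathlib

open scoped BigOperators

noncomputable section

/-- `p` is a probability mass function on the finite type `α`. -/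
def IsPMF {α : Type*} [Fintype α] (p : α → ℝ) : Prop :=
  (∀ a, 0 ≤ p a) ∧ ∑ a, p a = 1

/-- `k` is a stochastic kernel from `α` to the finite type `β`. -/
def IsKernel {α β : Type*} [Fintype β] (k : α → β → ℝ) : Prop :=
  ∀ a, (∀ b, 0 ≤ k a b) ∧ ∑ b, k a b = 1

/-- Distribution (pushforward pmf) of the random variable `X` under the pmf `μ`. -/
def rvDist {Ω α : Type*} [Fintype Ω] [DecidableEq α] (μ : Ω → ℝ) (X : Ω → α) : α → ℝ :=
  fun a => ∑ ω, if X ω = a then μ ω else 0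

/-- Shannon entropy in bits of a pmf on a finite type. -/
def entBits {α : Type*} [Fintype α] (p : α → ℝ) : ℝ :=
  (∑ a, Real.negMulLog (p a)) / Real.log 2

/-- Entropy (in bits) of a random variable `X` under the pmf `μ`. -/
def Hb {Ω α : Type*} [Fintype Ω] [Fintype α] [DecidableEq α] (μ : Ω → ℝ) (X : Ω → α) : ℝ :=
  entBits (rvDist μ X)

/-- Conditional entropy (in bits) `H(X | Z)`. -/
def condHb {Ω α γ : Type*} [Fintype Ω] [Fintype α] [Fintype γ] [DecidableEq α] [DecidableEq γ]
    (μ : Ω → ℝ) (X : Ω → α) (Z : Ω → γ) : ℝ :=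
  Hb μ (fun ω => (X ω, Z ω)) - Hb μ Z

/-- Mutual information (in bits) `I(X; Y)`. -/
def Ib {Ω α β : Type*} [Fintype Ω] [Fintype α] [Fintype β] [DecidableEq α] [DecidableEq β]
    (μ : Ω → ℝ) (X : Ω → α) (Y : Ω → β) : ℝ :=
  Hb μ X + Hb μ Y - Hb μ (fun ω => (X ω, Y ω))

/-- Conditional mutual information (in bits) `I(X; Y | Z)`. -/
def condIb {Ω α β γ : Type*} [Fintype Ω] [Fintype α] [Fintype β] [Fintype γ]
    [DecidableEq α] [DecidableEq β] [DecidableEq γ]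
    (μ : Ω → ℝ) (X : Ω → α) (Y : Ω → β) (Z : Ω → γ) : ℝ :=
  Hb μ (fun ω => (X ω, Z ω)) + Hb μ (fun ω => (Y ω, Z ω))
    - Hb μ (fun ω => (X ω, Y ω, Z ω)) - Hb μ Z

/- Projections of a 10-tuple sample space
   `Ω = 𝒳₁ × 𝒳₂ × 𝒲 × 𝒯 × 𝒰₁ × 𝒰₂ × 𝒳̃₁ × 𝒳̃₂ × 𝒴̃ × 𝒴`. -/
section Proj
variable {A B C D E F G H I J : Type*}
def pr1 (ω : A × B × C × D × E × F × G × H × I × J) : A := ω.1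
def pr2 (ω : A × B × C × D × E × F × G × H × I × J) : B := ω.2.1
def pr3 (ω : A × B × C × D × E × F × G × H × I × J) : C := ω.2.2.1
def pr4 (ω : A × B × C × D × E × F × G × H × I × J) : D := ω.2.2.2.1
def pr5 (ω : A × B × C × D × E × F × G × H × I × J) : E := ω.2.2.2.2.1
def pr6 (ω : A × B × C × D × E × F × G × H × I × J) : F := ω.2.2.2.2.2.1
def pr7 (ω : A × B × C × D × E × F × G × H × I × J) : G := ω.2.2.2.2.2.2.1
def pr8 (ω : A × B × C × D × E × F × G × H × I × J) : H := ω.2.2.2.2.2.2.2.1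
def pr9 (ω : A × B × C × D × E × F × G × H × I × J) : I := ω.2.2.2.2.2.2.2.2.1
def pr10 (ω : A × B × C × D × E × F × G × H × I × J) : J := ω.2.2.2.2.2.2.2.2.2
end Proj

/-- The induced marginal distribution on `(X₁ⁿ, X₂ⁿ, Wⁿ, Yⁿ)` of a
`(κ₁, κ₂, n)` non-cribbing code `(E2, E1, D)` used over the memoryless MAC `ch`
with i.i.d. sources `q3` and independent uniform shared randomness `K₁, K₂`. -/
def inducedNoCrib {X1 X2 Wa Xt1 Xt2 Yt Ya : Type*}
    [Fintype X1] [Fintype X2] [Fintype Wa] [Fintype Xt1] [Fintype Xt2] [Fintype Yt] [Fintype Ya]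
    (q3 : X1 × X2 × Wa → ℝ) (ch : Xt1 × Xt2 → Yt → ℝ) {n κ1 κ2 : ℕ}
    (E2 : (Fin n → X2) × Fin κ2 → (Fin n → Xt2) → ℝ)
    (E1 : (Fin n → X1) × Fin κ1 → (Fin n → Xt1) → ℝ)
    (D : Fin κ1 × Fin κ2 × (Fin n → Wa) × (Fin n → Yt) → (Fin n → Ya) → ℝ) :
    (Fin n → X1) × (Fin n → X2) × (Fin n → Wa) × (Fin n → Ya) → ℝ :=
  fun z =>
    ∑ k1 : Fin κ1, ∑ k2 : Fin κ2, ∑ xt1 : Fin n → Xt1, ∑ xt2 : Fin n → Xt2,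
      ∑ yt : Fin n → Yt,
        ((κ1 : ℝ) * (κ2 : ℝ))⁻¹ * (∏ i, q3 (z.1 i, z.2.1 i, z.2.2.1 i)) *
          E2 (z.2.1, k2) xt2 * E1 (z.1, k1) xt1 *
          (∏ i, ch (xt1 i, xt2 i) (yt i)) * D (k1, k2, z.2.2.1, yt) z.2.2.2

/-- Total variation (ℓ₁) distance between a pmf on `n`-sequences and the
`n`-fold i.i.d. product of the target pmf `q4`. -/
def tvIID {X1 X2 Wa Ya : Type*} [Fintype X1] [Fintype X2] [Fintype Wa] [Fintype Ya]
    (q4 : X1 × X2 × Wa × Ya → ℝ) {n : ℕ}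
    (p : (Fin n → X1) × (Fin n → X2) × (Fin n → Wa) × (Fin n → Ya) → ℝ) : ℝ :=
  ∑ z, |p z - ∏ i, q4 (z.1 i, z.2.1 i, z.2.2.1 i, z.2.2.2 i)|

/-- `(R01, R02)` is achievable for the target `q4` without cribbing: there is a sequence of
`(2^{nR₀₁}, 2^{nR₀₂}, n)` non-cribbing codes whose induced marginal on
`(X₁ⁿ, X₂ⁿ, Wⁿ, Yⁿ)` converges to the i.i.d. product of `q4` in total variation. -/
def AchievableNoCrib {X1 X2 Wa Xt1 Xt2 Yt Ya : Type*}
    [Fintype X1] [Fintype X2] [Fintype Wa] [Fintype Xt1] [Fintype Xt2] [Fintype Yt] [Fintype Ya]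
    (q3 : X1 × X2 × Wa → ℝ) (ch : Xt1 × Xt2 → Yt → ℝ)
    (q4 : X1 × X2 × Wa × Ya → ℝ) (R01 R02 : ℝ) : Prop :=
  ∃ κ1 κ2 : ℕ → ℕ,
    (∀ n, 0 < κ1 n) ∧ (∀ n, 0 < κ2 n) ∧
    (∀ n, (κ1 n : ℝ) ≤ (2 : ℝ) ^ ((n : ℝ) * R01)) ∧
    (∀ n, (κ2 n : ℝ) ≤ (2 : ℝ) ^ ((n : ℝ) * R02)) ∧
    ∃ E2 : (n : ℕ) → ((Fin n → X2) × Fin (κ2 n) → (Fin n → Xt2) → ℝ),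
      ∃ E1 : (n : ℕ) → ((Fin n → X1) × Fin (κ1 n) → (Fin n → Xt1) → ℝ),
        ∃ D : (n : ℕ) → (Fin (κ1 n) × Fin (κ2 n) × (Fin n → Wa) × (Fin n → Yt) →
            (Fin n → Ya) → ℝ),
          (∀ n, IsKernel (E2 n)) ∧ (∀ n, IsKernel (E1 n)) ∧ (∀ n, IsKernel (D n)) ∧
          Filter.Tendsto (fun n => tvIID q4 (inducedNoCrib q3 ch (E2 n) (E1 n) (D n)))
            Filter.atTop (nhds 0)

/-- The deterministic MAC `Ỹ = (f₁(X̃₁), f₂(X̃₂))` as a stochastic kernel. -/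
def detCh {Xt1 Xt2 Yt1 Yt2 : Type*} [DecidableEq Yt1] [DecidableEq Yt2]
    (f1 : Xt1 → Yt1) (f2 : Xt2 → Yt2) : Xt1 × Xt2 → Yt1 × Yt2 → ℝ :=
  fun x y => if y = (f1 x.1, f2 x.2) then 1 else 0


noncomputable section

/-! ### A Carathéodory / basic feasible solution lemma -/

lemma carath_step {ι J : Type*} [Fintype ι] [Fintype J] (g : ι → J → ℝ) (c : ι → ℝ)
    (hbd : ∀ v : ι → ℝ, (∀ i, 0 ≤ v i) → (∀ j, ∑ i, v i * g i j = 0) → ∑ i, v i * c i = 0)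
    (w : ι → ℝ) (hw : ∀ i, 0 ≤ w i)
    (hcard : Fintype.card J < (Finset.univ.filter (fun i => w i ≠ 0)).card) :
    ∃ w' : ι → ℝ, (∀ i, 0 ≤ w' i) ∧ (∀ i, w i = 0 → w' i = 0) ∧
      (∀ j, ∑ i, w' i * g i j = ∑ i, w i * g i j) ∧ ∑ i, w i * c i ≤ ∑ i, w' i * c i ∧
      (Finset.univ.filter (fun i => w' i ≠ 0)).card <
        (Finset.univ.filter (fun i => w i ≠ 0)).card := by
  classical
  set S := Finset.univ.filter (fun i => w i ≠ 0) with hS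
  -- a nontrivial relation
  have hrel : ∃ v : ι → ℝ, (∀ i, w i = 0 → v i = 0) ∧ (∃ i, v i ≠ 0) ∧
      ∀ j, ∑ i, v i * g i j = 0 := by
    have hnl : ¬ LinearIndependent ℝ (fun i : S => g i.1) := by
      intro h
      have := h.fintype_card_le_finrank
      simp only [Fintype.card_coe, Module.finrank_fintype_fun_eq_card] at this
      omega
    rw [Fintype.not_linearIndependent_iff] at hnl
    obtain ⟨r, hr, i0, hi0⟩ := hnl
    refine ⟨fun i => if h : i ∈ S then r ⟨i, h⟩ else 0, ?_, ⟨i0.1, ?_⟩, ?_⟩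
    · intro i hi
      have : i ∉ S := by simp [hS, hi]
      simp [this]
    · simpa using hi0
    · intro j
      have h1 := congrFun hr j
      simp only [Finset.sum_apply, Pi.smul_apply, smul_eq_mul, Pi.zero_apply] at h1
      refine Eq.trans ?_ h1
      rw [← Finset.sum_subset (Finset.subset_univ S), ← Finset.sum_coe_sort S]
      · apply Finset.sum_congr rfl
        intro x _
        simp
      · intro x _ hx
        simp [hx]
  -- choose the sign
  have hsgn : ∃ v : ι → ℝ, (∀ i, w i = 0 → v i = 0) ∧ (∃ i, v i < 0) ∧
      (∀ j, ∑ i, v i * g i j = 0) ∧ 0 ≤ ∑ i, v i * c i := by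
    obtain ⟨v, hv0, ⟨i0, hi0⟩, hv⟩ := hrel
    have hneg : ∀ j, ∑ i, (-v i) * g i j = 0 := by
      intro j; simp [neg_mul, hv j]
    have hnegc : ∑ i, (-v i) * c i = -∑ i, v i * c i := by
      simp [neg_mul]
    rcases lt_trichotomy (∑ i, v i * c i) 0 with h | h | h
    · refine ⟨fun i => - v i, fun i hi => by simp [hv0 i hi], ?_, hneg, by rw [hnegc]; linarith⟩
      by_contra hcon
      push Not at hcon
      have := hbd _ hcon hneg
      rw [hnegc] at this
      linarith
    · rcases lt_or_gt_of_ne hi0 with h' | h'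
      · exact ⟨v, hv0, ⟨i0, h'⟩, hv, h.ge⟩
      · exact ⟨fun i => - v i, fun i hi => by simp [hv0 i hi], ⟨i0, by simpa using h'⟩, hneg,
          by rw [hnegc, h]; simp⟩
    · refine ⟨v, hv0, ?_, hv, h.le⟩
      by_contra hcon
      push Not at hcon
      have := hbd _ hcon hv
      linarith
  obtain ⟨v, hv0, ⟨i1, hi1⟩, hv, hvc⟩ := hsgn
  obtain ⟨i0, hi0, hmin⟩ := Finset.exists_min_image (Finset.univ.filter (fun i => v i < 0))
    (fun i => w i / (- v i)) ⟨i1, by simp [hi1]⟩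
  simp only [Finset.mem_filter, Finset.mem_univ, true_and] at hi0 hmin
  set θ := w i0 / (- v i0) with hθ
  have hθ0 : 0 ≤ θ := div_nonneg (hw _) (by linarith)
  refine ⟨fun i => w i + θ * v i, ?_, ?_, ?_, ?_, ?_⟩
  · intro i
    rcases lt_or_ge (v i) 0 with h | h
    · have := hmin i h
      rw [le_div_iff₀ (by linarith)] at this
      linarith
    · have := hw i
      positivity
  · intro i hi
    simp [hi, hv0 i hi]
  · intro j
    simp only [add_mul, Finset.sum_add_distrib, mul_assoc, ← Finset.mul_sum, hv j]
    simp
  · simp only [add_mul, Finset.sum_add_distrib, mul_assoc, ← Finset.mul_sum]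
    have := mul_nonneg hθ0 hvc
    linarith
  · apply Finset.card_lt_card
    rw [Finset.ssubset_iff_of_subset]
    · refine ⟨i0, ?_, ?_⟩
      · simp only [hS, Finset.mem_filter, Finset.mem_univ, true_and]
        intro h
        have := hv0 _ h
        linarith
      · simp only [Finset.mem_filter, Finset.mem_univ, true_and, not_not, hθ]
        have : v i0 ≠ 0 := by linarith
        field_simp
        ring
    · intro i
      simp only [hS, Finset.mem_filter, Finset.mem_univ, true_and]
      intro h h'
      exact h (by simp [h', hv0 i h'])

lemma carath {ι J : Type*} [Fintype ι] [Fintype J] (g : ι → J → ℝ) (c : ι → ℝ)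
    (hbd : ∀ v : ι → ℝ, (∀ i, 0 ≤ v i) → (∀ j, ∑ i, v i * g i j = 0) → ∑ i, v i * c i = 0)
    (w : ι → ℝ) (hw : ∀ i, 0 ≤ w i) :
    ∃ w' : ι → ℝ, (∀ i, 0 ≤ w' i) ∧ (∀ i, w i = 0 → w' i = 0) ∧
      (∀ j, ∑ i, w' i * g i j = ∑ i, w i * g i j) ∧ ∑ i, w i * c i ≤ ∑ i, w' i * c i ∧
      (Finset.univ.filter (fun i => w' i ≠ 0)).card ≤ Fintype.card J := by
  classical
  induction hk : (Finset.univ.filter (fun i => w i ≠ 0)).card using Nat.strong_induction_on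
    generalizing w with
  | _ k ih =>
    by_cases h : k ≤ Fintype.card J
    · exact ⟨w, hw, fun _ h => h, fun _ => rfl, le_rfl, by omega⟩
    · obtain ⟨w1, h1, h2, h3, h4, h5⟩ := carath_step g c hbd w hw (by omega)
      obtain ⟨w2, k1, k2, k3, k4, k5⟩ := ih _ (by omega) w1 h1 rfl
      exact ⟨w2, k1, fun i hi => k2 i (h2 i hi), fun j => (k3 j).trans (h3 j), h4.trans k4, k5⟩

lemma carath_fin {ι J : Type*} [Fintype ι] [Fintype J] (g : ι → J → ℝ) (c : ι → ℝ)
    (hbd : ∀ v : ι → ℝ, (∀ i, 0 ≤ v i) → (∀ j, ∑ i, v i * g i j = 0) → ∑ i, v i * c i = 0)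
    (w : ι → ℝ) (hw : ∀ i, 0 ≤ w i) (hne : ∃ i, w i ≠ 0) (N : ℕ) (hN : Fintype.card J ≤ N) :
    ∃ (e : Fin N → ι) (l : Fin N → ℝ), (∀ j, 0 ≤ l j) ∧ (∀ j, w (e j) ≠ 0) ∧
      (∀ j, ∑ s, l s * g (e s) j = ∑ i, w i * g i j) ∧
      ∑ i, w i * c i ≤ ∑ s, l s * c (e s) := by
  classical
  obtain ⟨w', h1, h2, h3, h4, h5⟩ := carath g c hbd w hw
  obtain ⟨i0, hi0⟩ := hne
  set S := Finset.univ.filter (fun i => w' i ≠ 0) with hS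
  have hSN : S.card ≤ N := h5.trans hN
  set k := S.card with hk
  let σ : Fin k ≃ S := S.equivFin.symm
  let e : Fin N → ι := fun s => if h : s.1 < k then (σ ⟨s.1, h⟩).1 else i0
  let l : Fin N → ℝ := fun s => if h : s.1 < k then w' (σ ⟨s.1, h⟩).1 else 0
  have key : ∀ F : ι → ℝ, ∑ s, l s * F (e s) = ∑ i, w' i * F i := by
    intro F
    have hA : ∑ i, w' i * F i = ∑ s : Fin k, w' (σ s).1 * F (σ s).1 := by
      rw [Equiv.sum_comp σ (fun i : S => w' i.1 * F i.1), Finset.sum_coe_sort S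
        (fun i => w' i * F i)]
      symm
      apply Finset.sum_subset (Finset.subset_univ S)
      intro x _ hx
      have : w' x = 0 := by simpa [hS] using hx
      simp [this]
    rw [hA]
    have hB : ∀ s : Fin k, w' (σ s).1 * F (σ s).1 =
        l (Fin.castLE hSN s) * F (e (Fin.castLE hSN s)) := by
      intro s
      simp [l, e]
    simp_rw [hB]
    rw [← Finset.sum_image (s := Finset.univ) (g := Fin.castLE hSN)
      (f := fun s => l s * F (e s))]
    · symm
      apply Finset.sum_subset (Finset.subset_univ _)
      intro x _ hx
      have : ¬ x.1 < k := by
        intro h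
        apply hx
        simp only [Finset.mem_image, Finset.mem_univ, true_and]
        exact ⟨⟨x.1, h⟩, by ext; simp⟩
      simp [l, this]
    · intro a _ b _ hab
      simpa using hab
  refine ⟨e, l, ?_, ?_, ?_, ?_⟩
  · intro s
    simp only [l]
    split_ifs
    · exact h1 _
    · exact le_rfl
  · intro s
    simp only [e]
    split_ifs with h
    · intro h'
      have := (σ ⟨s.1, h⟩).2
      simp only [hS, Finset.mem_filter, Finset.mem_univ, true_and] at this
      exact this (h2 _ h')
    · exact hi0
  · intro j
    rw [key (fun i => g i j), h3]
  · rw [key c]; exact h4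

end

noncomputable section

/-! ### Entropy in nats -/

set_option linter.unusedSectionVars false
set_option linter.unusedSimpArgs false

/-- Conditional entropy functional (nats) of a nonnegative function. -/
def CEf {α β : Type*} [Fintype α] [Fintype β] (f : α → β → ℝ) : ℝ :=
  ∑ b, ((∑ a, Real.negMulLog (f a b)) - Real.negMulLog (∑ a, f a b))

lemma CEf_smul {α β : Type*} [Fintype α] [Fintype β] (c : ℝ) (f : α → β → ℝ) :
    CEf (fun a b => c * f a b) = c * CEf f := by
  unfold CEf
  rw [Finset.mul_sum]
  apply Finset.sum_congr rfl
  intro b _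
  simp only [← Finset.mul_sum, Real.negMulLog_mul, Finset.sum_add_distrib, ← Finset.sum_mul]
  ring

lemma CEf_smul_right {α β : Type*} [Fintype α] [Fintype β] (c : ℝ) (f : α → β → ℝ) :
    CEf (fun a b => f a b * c) = c * CEf f := by
  rw [← CEf_smul]
  simp only [mul_comm]

lemma CEf_zero {α β : Type*} [Fintype α] [Fintype β] :
    CEf (fun (_ : α) (_ : β) => (0 : ℝ)) = 0 := by
  simp [CEf]

lemma CEf_prod {α β γ : Type*} [Fintype α] [Fintype β] [Fintype γ] (f : α → β → γ → ℝ) :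
    CEf (fun a (p : β × γ) => f a p.1 p.2) = ∑ c, CEf (fun a b => f a b c) := by
  unfold CEf
  rw [Fintype.sum_prod_type_right]

lemma CEf_equiv {α β β' : Type*} [Fintype α] [Fintype β] [Fintype β'] (e : β' ≃ β)
    (f : α → β → ℝ) : CEf (fun a b => f a (e b)) = CEf f := by
  unfold CEf
  exact Equiv.sum_comp e (fun b => (∑ a, Real.negMulLog (f a b)) - Real.negMulLog (∑ a, f a b))

lemma CEf_eq {α β : Type*} [Fintype α] [Fintype β] (f : α → β → ℝ) :
    CEf f = (∑ p : α × β, Real.negMulLog (f p.1 p.2)) - ∑ b, Real.negMulLog (∑ a, f a b) := by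
  unfold CEf
  rw [Finset.sum_sub_distrib, Fintype.sum_prod_type_right]

/-- Entropy in nats of a random variable. -/
def Hn {Ω α : Type*} [Fintype Ω] [Fintype α] [DecidableEq α] (μ : Ω → ℝ) (X : Ω → α) : ℝ :=
  ∑ a, Real.negMulLog (rvDist μ X a)

/-- Conditional entropy in nats. -/
def Hc {Ω α γ : Type*} [Fintype Ω] [Fintype α] [Fintype γ] [DecidableEq α] [DecidableEq γ]
    (μ : Ω → ℝ) (X : Ω → α) (Z : Ω → γ) : ℝ :=
  Hn μ (fun ω => (X ω, Z ω)) - Hn μ Z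

section
variable {Ω α β γ δ : Type*} [Fintype Ω] [Fintype α] [Fintype β] [Fintype γ] [Fintype δ]
  [DecidableEq α] [DecidableEq β] [DecidableEq γ] [DecidableEq δ]

lemma Hb_eq_Hn (μ : Ω → ℝ) (X : Ω → α) : Hb μ X = Hn μ X / Real.log 2 := rfl

lemma rvDist_nonneg {μ : Ω → ℝ} (hμ : ∀ ω, 0 ≤ μ ω) (X : Ω → α) (a : α) : 0 ≤ rvDist μ X a := by
  unfold rvDist
  apply Finset.sum_nonneg
  intro i _
  split_ifs
  · exact hμ i
  · exact le_rfl

lemma rvDist_fst (μ : Ω → ℝ) (X : Ω → α) (Z : Ω → γ) (c : γ) :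
    ∑ a, rvDist μ (fun ω => (X ω, Z ω)) (a, c) = rvDist μ Z c := by
  unfold rvDist
  rw [Finset.sum_comm]
  apply Finset.sum_congr rfl
  intro ω _
  simp only [Prod.mk.injEq]
  by_cases h : Z ω = c <;> simp [h]

lemma rvDist_snd (μ : Ω → ℝ) (X : Ω → α) (Z : Ω → γ) (a : α) :
    ∑ c, rvDist μ (fun ω => (X ω, Z ω)) (a, c) = rvDist μ X a := by
  unfold rvDist
  rw [Finset.sum_comm]
  apply Finset.sum_congr rfl
  intro ω _
  simp only [Prod.mk.injEq]
  by_cases h : X ω = a <;> simp [h]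

lemma rvDist_sum (μ : Ω → ℝ) (X : Ω → α) : ∑ a, rvDist μ X a = ∑ ω, μ ω := by
  unfold rvDist
  rw [Finset.sum_comm]
  simp

lemma rvDist_comp (μ : Ω → ℝ) (X : Ω → α) (f : α → β) (b : β) :
    rvDist μ (fun ω => f (X ω)) b = ∑ a, if f a = b then rvDist μ X a else 0 := by
  unfold rvDist
  have h : ∀ a, (if f a = b then ∑ ω, (if X ω = a then μ ω else 0) else 0) =
      ∑ ω, if X ω = a then (if f a = b then μ ω else 0) else 0 := by
    intro a
    by_cases h : f a = b <;> simp [h]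
  simp_rw [h]
  rw [Finset.sum_comm]
  simp

lemma Hn_comp_inj (μ : Ω → ℝ) (X : Ω → α) (f : α → β) (hf : Function.Injective f) :
    Hn μ (fun ω => f (X ω)) = Hn μ X := by
  unfold Hn
  have h1 : ∀ a, rvDist μ (fun ω => f (X ω)) (f a) = rvDist μ X a := by
    intro a
    unfold rvDist
    simp only [hf.eq_iff]
  simp_rw [← h1]
  rw [← Finset.sum_image (s := Finset.univ) (g := f)
    (f := fun b => Real.negMulLog (rvDist μ (fun ω => f (X ω)) b))]
  · symm
    apply Finset.sum_subset (Finset.subset_univ _)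
    intro b _ hb
    have : rvDist μ (fun ω => f (X ω)) b = 0 := by
      unfold rvDist
      apply Finset.sum_eq_zero
      intro ω _
      rw [if_neg]
      rintro rfl
      apply hb
      simp
    simp [this]
  · intro a _ b _ h
    exact hf h

lemma Hc_eq_CEf (μ : Ω → ℝ) (X : Ω → α) (Z : Ω → γ) :
    Hc μ X Z = CEf (fun a c => rvDist μ (fun ω => (X ω, Z ω)) (a, c)) := by
  rw [CEf_eq]
  simp only [rvDist_fst]
  rfl

lemma submod_fun (p : α → β → γ → ℝ) (hp : ∀ a b c, 0 ≤ p a b c) :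
    (∑ a, ∑ b, ∑ c, Real.negMulLog (p a b c)) + ∑ c, Real.negMulLog (∑ a, ∑ b, p a b c) ≤
      (∑ a, ∑ c, Real.negMulLog (∑ b, p a b c)) + ∑ b, ∑ c, Real.negMulLog (∑ a, p a b c) := by
  set pac : α → γ → ℝ := fun a c => ∑ b, p a b c with hpac
  set pbc : β → γ → ℝ := fun b c => ∑ a, p a b c with hpbc
  set pc : γ → ℝ := fun c => ∑ a, ∑ b, p a b c with hpc
  have hac0 : ∀ a c, 0 ≤ pac a c := fun a c => Finset.sum_nonneg fun b _ => hp a b c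
  have hbc0 : ∀ b c, 0 ≤ pbc b c := fun b c => Finset.sum_nonneg fun a _ => hp a b c
  have hc0 : ∀ c, 0 ≤ pc c := fun c => Finset.sum_nonneg fun a _ => hac0 a c
  have key : ∀ a b c, Real.negMulLog (p a b c) ≤ - (p a b c * Real.log (pac a c))
      - p a b c * Real.log (pbc b c) + p a b c * Real.log (pc c)
      + (pac a c * pbc b c / pc c - p a b c) := by
    intro a b c
    rcases (hp a b c).eq_or_lt with h | h
    · rw [← h]
      simp only [Real.negMulLog_zero, zero_mul]
      have := div_nonneg (mul_nonneg (hac0 a c) (hbc0 b c)) (hc0 c)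
      linarith
    · have h1 : 0 < pac a c := lt_of_lt_of_le h
        (Finset.single_le_sum (f := fun b => p a b c) (fun b _ => hp a b c) (Finset.mem_univ b))
      have h2 : 0 < pbc b c := lt_of_lt_of_le h
        (Finset.single_le_sum (f := fun a => p a b c) (fun a _ => hp a b c) (Finset.mem_univ a))
      have h3 : 0 < pc c := lt_of_lt_of_le h1
        (Finset.single_le_sum (f := fun a => pac a c) (fun a _ => hac0 a c) (Finset.mem_univ a))
      have h4 := Real.log_le_sub_one_of_pos (x := pac a c * pbc b c / pc c / p a b c)
        (by positivity)
      rw [Real.log_div (by positivity) (by positivity), Real.log_div (by positivity)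
        (by positivity), Real.log_mul (by positivity) (by positivity)] at h4
      have h5 := mul_le_mul_of_nonneg_left h4 h.le
      have h6 : p a b c * (pac a c * pbc b c / pc c / p a b c - 1) =
        pac a c * pbc b c / pc c - p a b c := by field_simp
      rw [h6] at h5
      unfold Real.negMulLog
      linarith
  have hsum : (∑ a, ∑ b, ∑ c, Real.negMulLog (p a b c)) ≤
      ∑ a, ∑ b, ∑ c, (- (p a b c * Real.log (pac a c))
      - p a b c * Real.log (pbc b c) + p a b c * Real.log (pc c)
      + (pac a c * pbc b c / pc c - p a b c)) :=
    Finset.sum_le_sum fun a _ => Finset.sum_le_sum fun b _ => Finset.sum_le_sum fun c _ => key a b c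
  simp only [Finset.sum_add_distrib, Finset.sum_sub_distrib, Finset.sum_neg_distrib] at hsum
  have e1 : ∑ a, ∑ b, ∑ c, p a b c * Real.log (pac a c) = -∑ a, ∑ c, Real.negMulLog (pac a c) := by
    rw [← Finset.sum_neg_distrib]
    refine Finset.sum_congr rfl fun a _ => ?_
    rw [Finset.sum_comm, ← Finset.sum_neg_distrib]
    refine Finset.sum_congr rfl fun c _ => ?_
    rw [← Finset.sum_mul]
    simp [Real.negMulLog, hpac]
  have e2 : ∑ a, ∑ b, ∑ c, p a b c * Real.log (pbc b c) = -∑ b, ∑ c, Real.negMulLog (pbc b c) := by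
    rw [← Finset.sum_neg_distrib, Finset.sum_comm]
    refine Finset.sum_congr rfl fun b _ => ?_
    rw [Finset.sum_comm, ← Finset.sum_neg_distrib]
    refine Finset.sum_congr rfl fun c _ => ?_
    rw [← Finset.sum_mul]
    simp [Real.negMulLog, hpbc]
  have e3' : ∀ F : α → β → γ → ℝ, ∑ a, ∑ b, ∑ c, F a b c = ∑ c, ∑ a, ∑ b, F a b c := by
    intro F
    simp_rw [Finset.sum_comm (s := (Finset.univ : Finset β)) (t := (Finset.univ : Finset γ))]
    rw [Finset.sum_comm]
  have e3 : ∑ a, ∑ b, ∑ c, p a b c * Real.log (pc c) = -∑ c, Real.negMulLog (pc c) := by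
    rw [e3', ← Finset.sum_neg_distrib]
    refine Finset.sum_congr rfl fun c _ => ?_
    simp_rw [← Finset.sum_mul]
    simp [Real.negMulLog, hpc]
  have e4 : ∑ a, ∑ b, ∑ c, pac a c * pbc b c / pc c = ∑ a, ∑ b, ∑ c, p a b c := by
    rw [e3', e3' p]
    refine Finset.sum_congr rfl fun c _ => ?_
    have h1 : ∑ a, ∑ b, pac a c * pbc b c / pc c = pc c * pc c / pc c := by
      simp_rw [← Finset.sum_div, ← Finset.mul_sum, ← Finset.sum_mul]
      congr 2
      simp only [hpbc, hpc]
      rw [Finset.sum_comm]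
    rw [h1, mul_self_div_self]
  rw [e1, e2, e3, e4] at hsum
  linarith

lemma Hc_cond_le {μ : Ω → ℝ} (hμ : ∀ ω, 0 ≤ μ ω) (X : Ω → α) (Y : Ω → β) (Z : Ω → γ) :
    Hc μ X (fun ω => (Y ω, Z ω)) ≤ Hc μ X Z := by
  have h := submod_fun (fun a b c => rvDist μ (fun ω => (X ω, Y ω, Z ω)) (a, b, c))
    (fun a b c => rvDist_nonneg hμ _ _)
  have h1 : ∀ c, ∑ a, ∑ b, rvDist μ (fun ω => (X ω, Y ω, Z ω)) (a, b, c) = rvDist μ Z c := by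
    intro c
    rw [Finset.sum_comm]
    simp_rw [rvDist_fst μ X (fun ω => (Y ω, Z ω))]
    exact rvDist_fst μ Y Z c
  have h2 : ∀ b c, ∑ a, rvDist μ (fun ω => (X ω, Y ω, Z ω)) (a, b, c) =
      rvDist μ (fun ω => (Y ω, Z ω)) (b, c) := by
    intro b c
    exact rvDist_fst μ X (fun ω => (Y ω, Z ω)) (b, c)
  have h3 : ∀ a c, ∑ b, rvDist μ (fun ω => (X ω, Y ω, Z ω)) (a, b, c) =
      rvDist μ (fun ω => (X ω, Z ω)) (a, c) := by
    intro a c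
    rw [← rvDist_fst μ Y (fun ω => (X ω, Z ω)) (a, c)]
    refine Finset.sum_congr rfl fun b _ => ?_
    unfold rvDist
    refine Finset.sum_congr rfl fun ω _ => ?_
    simp only [Prod.mk.injEq]
    congr 1
    apply propext
    tauto
  simp only [h1] at h
  simp only [h2, h3] at h
  unfold Hc Hn
  simp only [Fintype.sum_prod_type]
  linarith

lemma Hc_comp_le {μ : Ω → ℝ} (hμ : ∀ ω, 0 ≤ μ ω) (X : Ω → α) (Z : Ω → γ) (g : γ → δ) :
    Hc μ X Z ≤ Hc μ X (fun ω => g (Z ω)) := by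
  refine le_trans (le_of_eq ?_) (Hc_cond_le hμ X Z (fun ω => g (Z ω)))
  unfold Hc
  congr 1
  · exact (Hn_comp_inj μ (fun ω => (X ω, Z ω)) (fun p : α × γ => (p.1, p.2, g p.2))
      (fun p q h => by simp only [Prod.mk.injEq] at h; exact Prod.ext h.1 h.2.1)).symm
  · exact (Hn_comp_inj μ Z (fun p : γ => (p, g p))
      (fun p q h => by simp only [Prod.mk.injEq] at h; exact h.1)).symm

lemma negMulLog_add_le {a b : ℝ} (ha : 0 ≤ a) (hb : 0 ≤ b) :
    Real.negMulLog (a + b) ≤ Real.negMulLog a + Real.negMulLog b := by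
  rcases ha.eq_or_lt with rfl | ha'
  · simp
  rcases hb.eq_or_lt with rfl | hb'
  · simp
  unfold Real.negMulLog
  have h1 : Real.log a ≤ Real.log (a + b) := Real.log_le_log ha' (by linarith)
  have h2 : Real.log b ≤ Real.log (a + b) := Real.log_le_log hb' (by linarith)
  nlinarith

lemma negMulLog_sum_le {ι : Type*} (s : Finset ι) (f : ι → ℝ) (hf : ∀ i, 0 ≤ f i) :
    Real.negMulLog (∑ i ∈ s, f i) ≤ ∑ i ∈ s, Real.negMulLog (f i) := by
  classical
  induction s using Finset.induction_on with
  | empty => simp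
  | insert a s ha ih =>
    rw [Finset.sum_insert ha, Finset.sum_insert ha]
    have := negMulLog_add_le (hf a) (Finset.sum_nonneg (s := s) fun i _ => hf i)
    linarith

lemma Hc_nonneg {μ : Ω → ℝ} (hμ : ∀ ω, 0 ≤ μ ω) (X : Ω → α) (Z : Ω → γ) : 0 ≤ Hc μ X Z := by
  rw [Hc_eq_CEf]
  unfold CEf
  refine Finset.sum_nonneg fun b _ => ?_
  have := negMulLog_sum_le Finset.univ (fun a => rvDist μ (fun ω => (X ω, Z ω)) (a, b))
    (fun a => rvDist_nonneg hμ _ _)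
  linarith

/-- Invariance of conditional entropy. -/
lemma Hc_inj_left (μ : Ω → ℝ) (X : Ω → α) (Z : Ω → γ) (f : α → β) (hf : Function.Injective f) :
    Hc μ (fun ω => f (X ω)) Z = Hc μ X Z := by
  unfold Hc
  congr 1
  exact Hn_comp_inj μ (fun ω => (X ω, Z ω)) (fun p : α × γ => (f p.1, p.2))
      (fun p q h => by simp only [Prod.mk.injEq] at h; exact Prod.ext (hf h.1) h.2)

lemma Hc_chain (μ : Ω → ℝ) (X : Ω → α) (Y : Ω → β) (Z : Ω → γ) :
    Hc μ (fun ω => (X ω, Y ω)) Z = Hc μ X (fun ω => (Y ω, Z ω)) + Hc μ Y Z := by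
  unfold Hc
  have := Hn_comp_inj μ (fun ω => ((X ω, Y ω), Z ω))
    (fun p : (α × β) × γ => (p.1.1, p.1.2, p.2))
    (fun p q h => by
      simp only [Prod.mk.injEq] at h; exact Prod.ext (Prod.ext h.1 h.2.1) h.2.2)
  simp only at this
  rw [this]
  ring

lemma Hc_le_Hn {μ : Ω → ℝ} (hμ : IsPMF μ) (X : Ω → α) (Z : Ω → γ) : Hc μ X Z ≤ Hn μ X := by
  refine le_trans (Hc_comp_le hμ.1 X Z (fun _ => ())) (le_of_eq ?_)
  unfold Hc
  have h1 : Hn μ (fun ω => (X ω, ())) = Hn μ X :=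
    Hn_comp_inj μ X (fun a => (a, ())) (fun p q h => by simpa using h)
  have h2 : Hn μ (fun _ : Ω => ()) = 0 := by
    simp [Hn, rvDist, hμ.2]
  rw [h1, h2, sub_zero]

lemma Hc_pi_le {μ : Ω → ℝ} (hμ : IsPMF μ) (Z : Ω → γ) :
    ∀ {n : ℕ} (X : Ω → Fin n → α), Hc μ X Z ≤ ∑ i, Hc μ (fun ω => X ω i) Z := by
  intro n
  induction n with
  | zero =>
    intro X
    simp only [Finset.univ_eq_empty, Finset.sum_empty]
    refine (Hc_le_Hn hμ X Z).trans (le_of_eq ?_)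
    have h0 : X = fun _ => default := by
      funext ω
      exact Subsingleton.elim _ _
    rw [h0]
    simp [Hn, rvDist, hμ.2]
  | succ n ih =>
    intro X
    rw [Fin.sum_univ_succ]
    have h1 : Hc μ X Z = Hc μ (fun ω => (X ω 0, Fin.tail (X ω))) Z :=
      (Hc_inj_left μ X Z (fun x => (x 0, Fin.tail x)) (fun p q h => by
        simp only [Prod.mk.injEq] at h
        rw [← Fin.cons_self_tail p, ← Fin.cons_self_tail q, h.1, h.2])).symm
    rw [h1, Hc_chain]
    exact add_le_add (Hc_cond_le hμ.1 _ _ _) (ih (fun ω => Fin.tail (X ω)))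

lemma Hc_unit {μ : Ω → ℝ} (hμ : IsPMF μ) (Y : Ω → β) : Hc μ Y (fun _ => ()) = Hn μ Y := by
  unfold Hc
  have h1 : Hn μ (fun ω => (Y ω, ())) = Hn μ Y :=
    Hn_comp_inj μ Y (fun a => (a, ())) (fun p q h => by simpa using h)
  have h2 : Hn μ (fun _ : Ω => ()) = 0 := by
    simp [Hn, rvDist, hμ.2]
  rw [h1, h2, sub_zero]

lemma Hn_pi_le {μ : Ω → ℝ} (hμ : IsPMF μ) {n : ℕ} (X : Ω → Fin n → α) :
    Hn μ X ≤ ∑ i, Hn μ (fun ω => X ω i) := by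
  have := Hc_pi_le hμ (fun _ => ()) X
  simpa only [Hc_unit hμ] using this

/-- A Gibbs-type bound. -/
lemma negMulLog_le_gibbs {a b : ℝ} (ha : 0 ≤ a) (hb : 0 < b) :
    Real.negMulLog a ≤ - (a * Real.log b) + (b - a) := by
  rcases ha.eq_or_lt with rfl | ha'
  · simp [hb.le]
  · have h := Real.log_le_sub_one_of_pos (x := b / a) (by positivity)
    rw [Real.log_div hb.ne' ha'.ne'] at h
    have h5 := mul_le_mul_of_nonneg_left h ha
    have h6 : a * (b / a - 1) = b - a := by field_simp
    rw [h6] at h5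
    unfold Real.negMulLog
    linarith

lemma Hn_le_log_card {μ : Ω → ℝ} (hμ : IsPMF μ) (X : Ω → α) {N : ℝ} (hN : 0 < N)
    (hc : (Fintype.card α : ℝ) = N) : Hn μ X ≤ Real.log N := by
  unfold Hn
  have h1 : ∑ a, Real.negMulLog (rvDist μ X a) ≤
      ∑ a, (- (rvDist μ X a * Real.log (N⁻¹)) + (N⁻¹ - rvDist μ X a)) :=
    Finset.sum_le_sum fun a _ => negMulLog_le_gibbs (rvDist_nonneg hμ.1 _ _) (by positivity)
  refine h1.trans (le_of_eq ?_)
  rw [Finset.sum_add_distrib, Finset.sum_sub_distrib, Finset.sum_neg_distrib, ← Finset.sum_mul,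
    rvDist_sum, hμ.2]
  have hN0 := hN.ne'
  simp [hc, hN0]

/-! ### The two abstract block inequalities -/

/-- Block inequality behind (3a), (3b). -/
lemma block_a {κ : Type*} [Fintype κ] [DecidableEq κ] {μ : Ω → ℝ} (hμ : IsPMF μ) {n : ℕ}
    (X : Ω → Fin n → α) (W : Ω → γ) (K : Ω → κ) (V : Ω → Fin n → β)
    (hK : Hc μ X W ≤ Hc μ X (fun ω => (W ω, K ω))) :
    Hc μ X W ≤ ∑ i, Hc μ (fun ω => V ω i) W
      + ∑ i, Hc μ (fun ω => X ω i) (fun ω => (W ω, (K ω, V ω))) := by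
  have h1 : Hc μ X (fun ω => (W ω, K ω)) ≤ Hc μ (fun ω => (X ω, V ω)) (fun ω => (W ω, K ω)) := by
    have e : Hc μ (fun ω => (X ω, V ω)) (fun ω => (W ω, K ω)) =
        Hc μ (fun ω => (V ω, X ω)) (fun ω => (W ω, K ω)) :=
      Hc_inj_left μ (fun ω => (V ω, X ω)) (fun ω => (W ω, K ω)) Prod.swap Prod.swap_injective
    rw [e, Hc_chain]
    have := Hc_nonneg hμ.1 V (fun ω => (X ω, (W ω, K ω)))
    linarith
  rw [Hc_chain] at h1
  have h2 : Hc μ V (fun ω => (W ω, K ω)) ≤ Hc μ V W :=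
    Hc_comp_le hμ.1 V (fun ω => (W ω, K ω)) Prod.fst
  have h3 := Hc_pi_le hμ W V
  have h4 := Hc_pi_le hμ (fun ω => (V ω, (W ω, K ω))) X
  have h5 : ∀ i, Hc μ (fun ω => X ω i) (fun ω => (V ω, (W ω, K ω))) ≤
      Hc μ (fun ω => X ω i) (fun ω => (W ω, (K ω, V ω))) := fun i =>
    Hc_comp_le hμ.1 (fun ω => X ω i) (fun ω => (V ω, (W ω, K ω)))
      (fun p => (p.2.1, (p.2.2, p.1)))
  have h6 := Finset.sum_le_sum (s := Finset.univ) fun i _ => h5 i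
  linarith

/-- Block inequality behind (3c). -/
lemma block_c {κ σ τ : Type*} [Fintype κ] [DecidableEq κ] [Fintype σ] [DecidableEq σ]
    [Fintype τ] [DecidableEq τ] {μ : Ω → ℝ} (hμ : IsPMF μ) {n : ℕ}
    (S : Ω → Fin n → σ) (X2 : Ω → Fin n → τ) (W : Ω → γ) (K : Ω → κ) (V : Ω → Fin n → β) :
    Hc μ S (fun ω => (X2 ω, W ω)) ≤ Hn μ K + ∑ i, Hc μ (fun ω => V ω i) W
      + ∑ i, Hc μ (fun ω => S ω i) (fun ω => ((X2 ω i, W ω), (K ω, V ω))) := by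
  have h1 : Hc μ S (fun ω => (X2 ω, W ω)) ≤
      Hc μ (fun ω => (S ω, (K ω, V ω))) (fun ω => (X2 ω, W ω)) := by
    have e : Hc μ (fun ω => (S ω, (K ω, V ω))) (fun ω => (X2 ω, W ω)) =
        Hc μ (fun ω => ((K ω, V ω), S ω)) (fun ω => (X2 ω, W ω)) :=
      Hc_inj_left μ (fun ω => ((K ω, V ω), S ω)) (fun ω => (X2 ω, W ω)) Prod.swap
        Prod.swap_injective
    rw [e, Hc_chain]
    have := Hc_nonneg hμ.1 (fun ω => (K ω, V ω)) (fun ω => (S ω, (X2 ω, W ω)))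
    linarith
  rw [Hc_chain] at h1
  have h2 : Hc μ (fun ω => (K ω, V ω)) (fun ω => (X2 ω, W ω)) ≤ Hc μ (fun ω => (K ω, V ω)) W :=
    Hc_comp_le hμ.1 _ (fun ω => (X2 ω, W ω)) Prod.snd
  rw [Hc_chain μ K V W] at h2
  have h2' := Hc_le_Hn hμ K (fun ω => (V ω, W ω))
  have h3 := Hc_pi_le hμ W V
  have h4 := Hc_pi_le hμ (fun ω => ((K ω, V ω), (X2 ω, W ω))) S
  have h5 : ∀ i, Hc μ (fun ω => S ω i) (fun ω => ((K ω, V ω), (X2 ω, W ω))) ≤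
      Hc μ (fun ω => S ω i) (fun ω => ((X2 ω i, W ω), (K ω, V ω))) := fun i =>
    Hc_comp_le hμ.1 (fun ω => S ω i) (fun ω => ((K ω, V ω), (X2 ω, W ω)))
      (fun p => ((p.2.1 i, p.2.2), p.1))
  have h6 := Finset.sum_le_sum (s := Finset.univ) fun i _ => h5 i
  linarith

/-! ### Continuity with respect to total variation -/

lemma negMulLog_sub_le {p q : ℝ} (hp : 0 ≤ p) (hp1 : p ≤ 1) (hq : 0 ≤ q) :
    Real.negMulLog q - Real.negMulLog p ≤ |p - q| + Real.negMulLog (max (q - p) 0) := by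
  rcases le_total q p with h | h
  · rw [max_eq_right (by linarith), Real.negMulLog_zero, abs_of_nonneg (by linarith)]
    rcases hp.eq_or_lt with rfl | hp'
    · have : q = 0 := le_antisymm h hq
      simp [this]
    · have h1 := negMulLog_le_gibbs hq hp'
      have h2 : Real.log p ≤ 0 := Real.log_nonpos hp hp1
      have h3 : Real.negMulLog p = - (p * Real.log p) := by simp [Real.negMulLog]
      nlinarith
  · rw [max_eq_left (by linarith)]
    have := negMulLog_add_le hp (sub_nonneg.2 h)
    rw [add_sub_cancel] at this
    have := abs_nonneg (p - q)
    linarith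

lemma ent_tv {ι : Type*} [Fintype ι] (p q : ι → ℝ) (hp : ∀ i, 0 ≤ p i) (hp1 : ∀ i, p i ≤ 1)
    (hq : ∀ i, 0 ≤ q i) (δ N : ℝ) (hδ : 0 < δ) (hδ1 : δ ≤ 1) (hN : (Fintype.card ι : ℝ) = N)
    (hN1 : 1 ≤ N)
    (htv : ∑ i, |p i - q i| ≤ δ) :
    ∑ i, Real.negMulLog (q i) - ∑ i, Real.negMulLog (p i) ≤
      2 * δ + δ * Real.log N + Real.negMulLog δ := by
  have hN0 : 0 < N := by linarith
  have h1 : ∑ i, Real.negMulLog (q i) - ∑ i, Real.negMulLog (p i) ≤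
      ∑ i, (|p i - q i| + (- (max (q i - p i) 0 * Real.log (δ / N)) +
        (δ / N - max (q i - p i) 0))) := by
    rw [← Finset.sum_sub_distrib]
    refine Finset.sum_le_sum fun i _ => ?_
    have := negMulLog_sub_le (hp i) (hp1 i) (hq i)
    have h2 := negMulLog_le_gibbs (a := max (q i - p i) 0) (b := δ / N) (le_max_right _ _)
      (by positivity)
    linarith
  rw [Finset.sum_add_distrib, Finset.sum_add_distrib, Finset.sum_sub_distrib,
    Finset.sum_neg_distrib, ← Finset.sum_mul] at h1
  have h3 : ∑ _i : ι, δ / N = δ := by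
    simp [hN]; field_simp
  rw [h3] at h1
  set s := ∑ i, max (q i - p i) 0 with hs
  have hs0 : 0 ≤ s := Finset.sum_nonneg fun i _ => le_max_right _ _
  have hsδ : s ≤ δ := by
    refine le_trans (Finset.sum_le_sum fun i _ => ?_) htv
    rw [abs_sub_comm]
    exact max_le (le_abs_self _) (abs_nonneg _)
  have h4 : Real.log (δ / N) = Real.log δ - Real.log N := Real.log_div hδ.ne' hN0.ne'
  have h5 : Real.log (δ / N) ≤ 0 := Real.log_nonpos (by positivity)
    (by rw [div_le_one hN0]; linarith)
  have h6 : -(s * Real.log (δ / N)) ≤ -(δ * Real.log (δ / N)) := by nlinarith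
  have h7 : -(δ * Real.log (δ / N)) = δ * Real.log N + Real.negMulLog δ := by
    rw [h4]; simp only [Real.negMulLog]; ring
  linarith

/-- Entropy of an i.i.d. product. -/
lemma sum_pi_prod {n : ℕ} (F : Fin n → α → ℝ) :
    ∑ z : Fin n → α, ∏ j, F j (z j) = ∏ j, ∑ a, F j a := by
  rw [Finset.prod_univ_sum]
  simp

lemma ent_iid (q : α → ℝ) (hq : ∑ a, q a = 1) : ∀ n : ℕ,
    ∑ z : Fin n → α, Real.negMulLog (∏ j, q (z j)) = n * ∑ a, Real.negMulLog (q a) := by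
  intro n
  induction n with
  | zero => simp
  | succ n ih =>
    rw [← (Fin.consEquiv (fun _ : Fin (n + 1) => α)).sum_comp, Fintype.sum_prod_type]
    simp only [Fin.consEquiv_apply, Fin.prod_univ_succ, Fin.cons_zero, Fin.cons_succ,
      Real.negMulLog_mul, Finset.sum_add_distrib, ← Finset.sum_mul, ← Finset.mul_sum, ih,
      sum_pi_prod (fun _ => q), hq]
    push_cast
    simp
    ring

end

end

noncomputable section

set_option linter.unusedSectionVars false
set_option linter.unusedSimpArgs false

/-! ### Single-letter quantities of a coordination scheme -/

/-- `H(g(U) | W)` in nats. -/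
def HYq {X W U V : Type*} [Fintype X] [Fintype W] [Fintype U] [Fintype V] [DecidableEq V]
    (q : X → W → ℝ) (k : X → U → ℝ) (g : U → V) : ℝ :=
  CEf (fun (y : V) (w : W) => ∑ x, ∑ u, if g u = y then q x w * k x u else 0)

/-- `H(X | W, U)` in nats. -/
def HXU {X W U : Type*} [Fintype X] [Fintype W] [Fintype U]
    (q : X → W → ℝ) (k : X → U → ℝ) : ℝ :=
  CEf (fun (x : X) (p : W × U) => q x p.1 * k x p.2)

/-- `H(g(U) | W) - I(U ; X | W)` in nats. -/
def aQ {X W U V : Type*} [Fintype X] [Fintype W] [Fintype U] [Fintype V] [DecidableEq V]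
    (q : X → W → ℝ) (k : X → U → ℝ) (g : U → V) : ℝ :=
  HYq q k g - CEf q + HXU q k

/-- Marginal of the source on `(X₁, W)`. -/
def m1 {X1 X2 Wa : Type*} [Fintype X2] (q3 : X1 × X2 × Wa → ℝ) : X1 → Wa → ℝ :=
  fun x w => ∑ x2, q3 (x, x2, w)

/-- Marginal of the source on `(X₂, W)`. -/
def m2 {X1 X2 Wa : Type*} [Fintype X1] (q3 : X1 × X2 × Wa → ℝ) : X2 → Wa → ℝ :=
  fun x w => ∑ x1, q3 (x1, x, w)

/-- `p(y | u₁, x₂, w)`. -/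
def DD {X2 Wa U1 U2 Ya : Type*} [Fintype U2] (k2 : X2 → U2 → ℝ) (kY : U1 → U2 → Wa → Ya → ℝ)
    (u1 : U1) (x2 : X2) (w : Wa) (y : Ya) : ℝ :=
  ∑ u2, k2 x2 u2 * kY u1 u2 w y

/-- Joint law of `(X₁, X₂, W, U₁, Y)`. -/
def JJ {X1 X2 Wa U1 U2 Ya : Type*} [Fintype U2] (q3 : X1 × X2 × Wa → ℝ) (k1 : X1 → U1 → ℝ)
    (k2 : X2 → U2 → ℝ) (kY : U1 → U2 → Wa → Ya → ℝ)
    (x1 : X1) (x2 : X2) (w : Wa) (u1 : U1) (y : Ya) : ℝ :=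
  q3 (x1, x2, w) * k1 x1 u1 * DD k2 kY u1 x2 w y

/-- Joint law of `(X₁, X₂, W, Y)`. -/
def mQ {X1 X2 Wa U1 U2 Ya : Type*} [Fintype U1] [Fintype U2] (q3 : X1 × X2 × Wa → ℝ)
    (k1 : X1 → U1 → ℝ) (k2 : X2 → U2 → ℝ) (kY : U1 → U2 → Wa → Ya → ℝ)
    (x1 : X1) (x2 : X2) (w : Wa) (y : Ya) : ℝ :=
  ∑ u1, JJ q3 k1 k2 kY x1 x2 w u1 y

/-- `I(U₁ ; X₁, Y | X₂, W) - H(g(U₁) | W)` in nats. -/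
def cQ {X1 X2 Wa U1 U2 Ya V : Type*} [Fintype X1] [Fintype X2] [Fintype Wa] [Fintype U1]
    [Fintype U2] [Fintype Ya] [Fintype V] [DecidableEq V] (q3 : X1 × X2 × Wa → ℝ)
    (k1 : X1 → U1 → ℝ) (g : U1 → V) (k2 : X2 → U2 → ℝ) (kY : U1 → U2 → Wa → Ya → ℝ) : ℝ :=
  CEf (fun (p : X1 × Ya) (r : X2 × Wa) => mQ q3 k1 k2 kY p.1 r.1 r.2 p.2)
    - CEf (fun (p : X1 × Ya) (r : (X2 × Wa) × U1) => JJ q3 k1 k2 kY p.1 r.1.1 r.1.2 r.2 p.2)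
    - HYq (m1 q3) k1 g

lemma HXU_ind {X W U : Type*} [Fintype X] [Fintype W] [Fintype U]
    (q : X → W → ℝ) (k : X → U → ℝ) (hk : IsKernel k) (x0 : X) (h : ∀ x x' u, k x u = k x' u) :
    HXU q k = CEf q := by
  unfold HXU
  rw [CEf_prod (fun x w u => q x w * k x u)]
  have : ∀ u, CEf (fun x w => q x w * k x u) = k x0 u * CEf q := by
    intro u
    rw [← CEf_smul_right]
    congr 1
    funext x w
    rw [h x x0 u]
  simp_rw [this, ← Finset.sum_mul, (hk x0).2, one_mul]

lemma HYq_congr {X W U U' Xt V : Type*} [Fintype X] [Fintype W] [Fintype U] [Fintype U']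
    [Fintype Xt] [DecidableEq Xt] [Fintype V] [DecidableEq V]
    (q : X → W → ℝ) (k : X → U → ℝ) (k' : X → U' → ℝ) (h : U → Xt) (h' : U' → Xt) (f : Xt → V)
    (H : ∀ x xt, ∑ u, (if h u = xt then k x u else 0) = ∑ u, (if h' u = xt then k' x u else 0)) :
    HYq q k (fun u => f (h u)) = HYq q k' (fun u => f (h' u)) := by
  unfold HYq
  have gen : ∀ {U'' : Type _} [Fintype U''] (k : X → U'' → ℝ) (h : U'' → Xt) (x : X) (w : W) (y : V),
      ∑ u, (if f (h u) = y then q x w * k x u else 0) =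
        ∑ xt, if f xt = y then q x w * ∑ u, (if h u = xt then k x u else 0) else 0 := by
    intro U'' _ k h x w y
    have : ∀ xt, (if f xt = y then q x w * ∑ u, (if h u = xt then k x u else 0) else 0) =
        ∑ u, if h u = xt then (if f xt = y then q x w * k x u else 0) else 0 := by
      intro xt
      by_cases h' : f xt = y <;> simp [h', Finset.mul_sum]
    simp_rw [this]
    rw [Finset.sum_comm]
    simp
  have gen' : ∀ (x : X) (w : W) (y : V),
      ∑ u, (if f (h' u) = y then q x w * k' x u else 0) =
        ∑ xt, if f xt = y then q x w * ∑ u, (if h' u = xt then k' x u else 0) else 0 := by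
    intro x w y
    have : ∀ xt, (if f xt = y then q x w * ∑ u, (if h' u = xt then k' x u else 0) else 0) =
        ∑ u, if h' u = xt then (if f xt = y then q x w * k' x u else 0) else 0 := by
      intro xt
      by_cases h'' : f xt = y <;> simp [h'', Finset.mul_sum]
    simp_rw [this]
    rw [Finset.sum_comm]
    simp
  congr 1
  funext y w
  refine Finset.sum_congr rfl fun x _ => ?_
  rw [gen, gen']
  simp_rw [H]

/-- Reduction of the cardinality of `𝒰₁`. -/
lemma U1_red {X1 X2 Wa Xt1 Yt1 Ya U1 U2 : Type*}
    [Fintype X1] [Fintype X2] [Fintype Wa] [Fintype Xt1] [Fintype Yt1] [Fintype Ya]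
    [Fintype U1] [Fintype U2] [DecidableEq Xt1] [DecidableEq Yt1]
    [Nonempty X1] [Nonempty X2] [Nonempty Wa]
    (q3 : X1 × X2 × Wa → ℝ) (f1 : Xt1 → Yt1)
    (k1 : X1 → U1 → ℝ) (h1 : U1 → Xt1) (k2 : X2 → U2 → ℝ) (kY : U1 → U2 → Wa → Ya → ℝ)
    (hk1 : IsKernel k1) (hk2 : IsKernel k2) (hkY : ∀ u1 u2, IsKernel (kY u1 u2))
    (hind : Subsingleton Yt1 → ∀ x x' u, k1 x u = k1 x' u)
    (N : ℕ) (hN1 : Fintype.card (X1 × X2 × Wa × Xt1 × Ya) ≤ N)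
    (hN2 : ¬ Subsingleton Yt1 → Fintype.card (X1 × X2 × Wa × Xt1 × Ya) + 1 ≤ N) :
    ∃ (k1' : X1 → Fin N → ℝ) (h1' : Fin N → Xt1) (kY' : Fin N → U2 → Wa → Ya → ℝ),
      IsKernel k1' ∧ (∀ u1 u2, IsKernel (kY' u1 u2)) ∧
      (Subsingleton Yt1 → ∀ x x' u, k1' x u = k1' x' u) ∧
      aQ (m1 q3) k1' (fun u => f1 (h1' u)) = aQ (m1 q3) k1 (fun u => f1 (h1 u)) ∧
      cQ q3 k1' (fun u => f1 (h1' u)) k2 kY' ≤ cQ q3 k1 (fun u => f1 (h1 u)) k2 kY ∧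
      ∀ x1 x2 w y, mQ q3 k1' k2 kY' x1 x2 w y = mQ q3 k1 k2 kY x1 x2 w y := by
  classical
  obtain ⟨x10⟩ := ‹Nonempty X1›
  obtain ⟨x20⟩ := ‹Nonempty X2›
  obtain ⟨w0⟩ := ‹Nonempty Wa›
  have hDsum : ∀ u x2 w, ∑ y, DD k2 kY u x2 w y = 1 := by
    intro u x2 w
    unfold DD
    rw [Finset.sum_comm]
    simp_rw [← Finset.mul_sum, (hkY _ _ _).2, mul_one, (hk2 _).2]
  let F : U1 → (X1 × X2 × Wa × Xt1 × Ya) → ℝ := fun u j =>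
    if h1 u = j.2.2.2.1 then k1 j.1 u * DD k2 kY u j.2.1 j.2.2.1 j.2.2.2.2 else 0
  let sl : U1 → ℝ := fun u => CEf (fun x w => m1 q3 x w * k1 x u)
  let g : U1 → ((X1 × X2 × Wa × Xt1 × Ya) ⊕ {_u : Unit // ¬ Subsingleton Yt1}) → ℝ := fun u =>
    Sum.elim (F u) (fun _ => sl u)
  let c : U1 → ℝ := fun u =>
    CEf (fun (p : X1 × Ya) (r : X2 × Wa) => JJ q3 k1 k2 kY p.1 r.1 r.2 u p.2)
  -- consequences of a linear identity between weights
  have lin1 : ∀ {S : Type} [Fintype S] (l : S → ℝ) (e : S → U1) (x : X1) (x2 : X2) (w : Wa)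
      (y : Ya), ∑ xt, ∑ s, l s * F (e s) (x, x2, w, xt, y) =
        ∑ s, l s * (k1 x (e s) * DD k2 kY (e s) x2 w y) := by
    intro S _ l e x x2 w y
    rw [Finset.sum_comm]
    refine Finset.sum_congr rfl fun s _ => ?_
    rw [← Finset.mul_sum]
    simp [F]
  have hbd : ∀ v : U1 → ℝ, (∀ i, 0 ≤ v i) → (∀ j, ∑ i, v i * g i j = 0) →
      ∑ i, v i * c i = 0 := by
    intro v hv hj
    have h0 : ∀ x u, v u * k1 x u = 0 := by
      intro x
      have hs : ∑ u, v u * k1 x u = 0 := by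
        have : ∑ y, ∑ xt, ∑ u, v u * F u (x, x20, w0, xt, y) = ∑ u, v u * k1 x u := by
          have e1 : ∀ y, ∑ xt, ∑ u, v u * F u (x, x20, w0, xt, y) =
              ∑ u, v u * k1 x u * DD k2 kY u x20 w0 y := by
            intro y
            rw [Finset.sum_comm]
            refine Finset.sum_congr rfl fun s _ => ?_
            rw [← Finset.mul_sum]
            simp [F, mul_assoc]
          simp_rw [e1]
          rw [Finset.sum_comm]
          simp_rw [← Finset.mul_sum, hDsum, mul_one]
        rw [← this]
        exact Finset.sum_eq_zero fun y _ => Finset.sum_eq_zero fun xt _ =>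
          hj (Sum.inl (x, x20, w0, xt, y))
      intro u
      exact (Finset.sum_eq_zero_iff_of_nonneg
        (fun u _ => mul_nonneg (hv u) ((hk1 x).1 u))).1 hs u (Finset.mem_univ u)
    refine Finset.sum_eq_zero fun u _ => ?_
    simp only [c]
    rw [← CEf_smul]
    rw [← CEf_zero (α := X1 × Ya) (β := X2 × Wa)]
    congr 1
    funext p r
    unfold JJ
    linear_combination q3 (p.1, r.1, r.2) * DD k2 kY u r.1 r.2 p.2 * h0 p.1 u
  have hU1 : Nonempty U1 := by
    by_contra hcon
    rw [not_nonempty_iff] at hcon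
    have := (hk1 x10).2
    simp at this
  obtain ⟨u0⟩ := hU1
  have hcardJ : Fintype.card ((X1 × X2 × Wa × Xt1 × Ya) ⊕ {_u : Unit // ¬ Subsingleton Yt1}) ≤ N := by
    rw [Fintype.card_sum]
    by_cases hS : Subsingleton Yt1
    · have : Fintype.card {_u : Unit // ¬ Subsingleton Yt1} = 0 := by
        rw [Fintype.card_eq_zero_iff]
        exact ⟨fun a => a.2 hS⟩
      rw [this]; simpa using hN1
    · have : Fintype.card {_u : Unit // ¬ Subsingleton Yt1} ≤ 1 := by
        have := Fintype.card_subtype_le (fun _ : Unit => ¬ Subsingleton Yt1)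
        simpa using this
      have := hN2 hS
      omega
  obtain ⟨e, l, hl, -, heq, hobj⟩ := carath_fin g c hbd (fun _ => 1) (fun _ => zero_le_one)
    ⟨u0, one_ne_zero⟩ N hcardJ
  simp only [one_mul] at heq hobj
  have hF : ∀ x1 x2 w xt y, ∑ s, l s * F (e s) (x1, x2, w, xt, y) =
      ∑ u, F u (x1, x2, w, xt, y) := fun x1 x2 w xt y => heq (Sum.inl (x1, x2, w, xt, y))
  have hii : ∀ x1 x2 w y, ∑ s, l s * k1 x1 (e s) * DD k2 kY (e s) x2 w y =
      ∑ u, k1 x1 u * DD k2 kY u x2 w y := by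
    intro x1 x2 w y
    have e1 : ∑ xt, ∑ s, l s * F (e s) (x1, x2, w, xt, y) =
        ∑ s, l s * k1 x1 (e s) * DD k2 kY (e s) x2 w y := by
      rw [Finset.sum_comm]
      refine Finset.sum_congr rfl fun s _ => ?_
      rw [← Finset.mul_sum]
      simp [F, mul_assoc]
    have e2 : ∑ xt, ∑ u, F u (x1, x2, w, xt, y) = ∑ u, k1 x1 u * DD k2 kY u x2 w y := by
      rw [Finset.sum_comm]
      refine Finset.sum_congr rfl fun s _ => ?_
      simp [F]
    rw [← e1, ← e2]
    exact Finset.sum_congr rfl fun xt _ => hF x1 x2 w xt y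
  have hiii : ∀ x xt, ∑ s, (if h1 (e s) = xt then l s * k1 x (e s) else 0) =
      ∑ u, (if h1 u = xt then k1 x u else 0) := by
    intro x xt
    have e1 : ∑ y, ∑ s, l s * F (e s) (x, x20, w0, xt, y) =
        ∑ s, (if h1 (e s) = xt then l s * k1 x (e s) else 0) := by
      rw [Finset.sum_comm]
      refine Finset.sum_congr rfl fun s _ => ?_
      by_cases h : h1 (e s) = xt
      · simp [F, h, ← Finset.mul_sum, hDsum]
      · simp [F, h]
    have e2 : ∑ y, ∑ u, F u (x, x20, w0, xt, y) =
        ∑ u, (if h1 u = xt then k1 x u else 0) := by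
      rw [Finset.sum_comm]
      refine Finset.sum_congr rfl fun s _ => ?_
      by_cases h : h1 s = xt
      · simp [F, h, ← Finset.mul_sum, hDsum]
      · simp [F, h]
    rw [← e1, ← e2]
    exact Finset.sum_congr rfl fun y _ => hF x x20 w0 xt y
  have hker : IsKernel (fun x s => l s * k1 x (e s)) := by
    intro x
    refine ⟨fun s => mul_nonneg (hl s) ((hk1 x).1 _), ?_⟩
    have e1 : ∑ xt, ∑ s, (if h1 (e s) = xt then l s * k1 x (e s) else 0) =
        ∑ s, l s * k1 x (e s) := by
      rw [Finset.sum_comm]; simp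
    have e2 : ∑ xt, ∑ u, (if h1 u = xt then k1 x u else 0) = ∑ u, k1 x u := by
      rw [Finset.sum_comm]; simp
    rw [← e1, ← (hk1 x).2, ← e2]
    exact Finset.sum_congr rfl fun xt _ => hiii x xt
  have hind' : Subsingleton Yt1 → ∀ x x' s, l s * k1 x (e s) = l s * k1 x' (e s) := by
    intro h x x' s
    rw [hind h x x']
  have hHY : HYq (m1 q3) (fun x s => l s * k1 x (e s)) (fun u => f1 (h1 (e u))) =
      HYq (m1 q3) k1 (fun u => f1 (h1 u)) :=
    HYq_congr (m1 q3) (fun x s => l s * k1 x (e s)) k1 (fun u => h1 (e u)) h1 f1 hiii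
  have hmQ : ∀ x1 x2 w y, mQ q3 (fun x s => l s * k1 x (e s)) k2 (fun s => kY (e s)) x1 x2 w y =
      mQ q3 k1 k2 kY x1 x2 w y := by
    intro x1 x2 w y
    unfold mQ JJ
    simp_rw [mul_assoc, ← Finset.mul_sum]
    congr 1
    have := hii x1 x2 w y
    simp_rw [mul_assoc] at this
    exact this
  refine ⟨fun x s => l s * k1 x (e s), fun s => h1 (e s), fun s => kY (e s), hker,
    fun u1 u2 => hkY _ _, hind', ?_, ?_, hmQ⟩
  · unfold aQ
    rw [hHY]
    congr 1
    by_cases hS : Subsingleton Yt1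
    · rw [HXU_ind _ _ hker x10 (hind' hS), HXU_ind _ _ hk1 x10 (hind hS)]
    · unfold HXU
      rw [CEf_prod (fun x w s => m1 q3 x w * (l s * k1 x (e s))),
        CEf_prod (fun x w u => m1 q3 x w * k1 x u)]
      have := heq (Sum.inr ⟨(), hS⟩)
      simp only [g, Sum.elim_inr, sl] at this
      rw [← this]
      refine Finset.sum_congr rfl fun s _ => ?_
      rw [← CEf_smul]
      congr 1
      funext x w
      ring
  · unfold cQ
    rw [hHY]
    simp_rw [hmQ]
    rw [CEf_prod (fun (p : X1 × Ya) (r : X2 × Wa) s =>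
        JJ q3 (fun x s => l s * k1 x (e s)) k2 (fun s => kY (e s)) p.1 r.1 r.2 s p.2),
      CEf_prod (fun (p : X1 × Ya) (r : X2 × Wa) u => JJ q3 k1 k2 kY p.1 r.1 r.2 u p.2)]
    have : ∑ s, CEf (fun (p : X1 × Ya) (r : X2 × Wa) =>
        JJ q3 (fun x s => l s * k1 x (e s)) k2 (fun s => kY (e s)) p.1 r.1 r.2 s p.2) =
        ∑ s, l s * c (e s) := by
      refine Finset.sum_congr rfl fun s _ => ?_
      simp only [c]
      rw [← CEf_smul]
      congr 1
      funext p r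
      simp only [JJ, DD]
      ring
    rw [this]
    simp only [c] at hobj ⊢
    linarith

/-- Reduction of the cardinality of `𝒰₂`. -/
lemma U2_red {X1 X2 Wa Xt2 Yt1 Yt2 Ya U1 U2 : Type*}
    [Fintype X1] [Fintype X2] [Fintype Wa] [Fintype Xt2] [Fintype Yt1] [Fintype Yt2] [Fintype Ya]
    [Fintype U1] [Fintype U2] [DecidableEq Xt2] [DecidableEq Yt1] [DecidableEq Yt2]
    [Nonempty X2] [Nonempty Wa] [Nonempty U1]
    (q3 : X1 × X2 × Wa → ℝ) (f2 : Xt2 → Yt2)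
    (k1 : X1 → U1 → ℝ) (g1 : U1 → Yt1) (h2 : U2 → Xt2) (k2 : X2 → U2 → ℝ)
    (kY : U1 → U2 → Wa → Ya → ℝ)
    (hk2 : IsKernel k2) (hkY : ∀ u1 u2, IsKernel (kY u1 u2))
    (N : ℕ) (hN1 : Fintype.card (U1 × X2 × Wa × Xt2 × Ya) ≤ N) :
    ∃ (k2' : X2 → Fin N → ℝ) (h2' : Fin N → Xt2) (kY' : U1 → Fin N → Wa → Ya → ℝ),
      IsKernel k2' ∧ (∀ u1 u2, IsKernel (kY' u1 u2)) ∧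
      aQ (m2 q3) k2 (fun u => f2 (h2 u)) ≤ aQ (m2 q3) k2' (fun u => f2 (h2' u)) ∧
      cQ q3 k1 g1 k2' kY' = cQ q3 k1 g1 k2 kY ∧
      ∀ x1 x2 w y, mQ q3 k1 k2' kY' x1 x2 w y = mQ q3 k1 k2 kY x1 x2 w y := by
  classical
  obtain ⟨x20⟩ := ‹Nonempty X2›
  obtain ⟨w0⟩ := ‹Nonempty Wa›
  obtain ⟨u10⟩ := ‹Nonempty U1›
  let F : U2 → (U1 × X2 × Wa × Xt2 × Ya) → ℝ := fun u j =>
    if h2 u = j.2.2.2.1 then k2 j.2.1 u * kY j.1 u j.2.2.1 j.2.2.2.2 else 0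
  let c : U2 → ℝ := fun u => CEf (fun x w => m2 q3 x w * k2 x u)
  have hbd : ∀ v : U2 → ℝ, (∀ i, 0 ≤ v i) → (∀ j, ∑ i, v i * F i j = 0) →
      ∑ i, v i * c i = 0 := by
    intro v hv hj
    have h0 : ∀ x u, v u * k2 x u = 0 := by
      intro x
      have hs : ∑ u, v u * k2 x u = 0 := by
        have : ∑ y, ∑ xt, ∑ u, v u * F u (u10, x, w0, xt, y) = ∑ u, v u * k2 x u := by
          have e1 : ∀ y, ∑ xt, ∑ u, v u * F u (u10, x, w0, xt, y) =
              ∑ u, v u * k2 x u * kY u10 u w0 y := by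
            intro y
            rw [Finset.sum_comm]
            refine Finset.sum_congr rfl fun s _ => ?_
            rw [← Finset.mul_sum]
            simp [F, mul_assoc]
          simp_rw [e1]
          rw [Finset.sum_comm]
          simp_rw [← Finset.mul_sum, (hkY _ _ _).2, mul_one]
        rw [← this]
        exact Finset.sum_eq_zero fun y _ => Finset.sum_eq_zero fun xt _ =>
          hj (u10, x, w0, xt, y)
      intro u
      exact (Finset.sum_eq_zero_iff_of_nonneg
        (fun u _ => mul_nonneg (hv u) ((hk2 x).1 u))).1 hs u (Finset.mem_univ u)
    refine Finset.sum_eq_zero fun u _ => ?_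
    simp only [c]
    rw [← CEf_smul]
    rw [← CEf_zero (α := X2) (β := Wa)]
    congr 1
    funext x w
    linear_combination m2 q3 x w * h0 x u
  have hU2 : Nonempty U2 := by
    by_contra hcon
    rw [not_nonempty_iff] at hcon
    have := (hk2 x20).2
    simp at this
  obtain ⟨u0⟩ := hU2
  obtain ⟨e, l, hl, -, hF', hobj⟩ := carath_fin F c hbd (fun _ => 1) (fun _ => zero_le_one)
    ⟨u0, one_ne_zero⟩ N hN1
  simp only [one_mul] at hF' hobj
  have hF : ∀ u1 x2 w xt y, ∑ s, l s * F (e s) (u1, x2, w, xt, y) =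
      ∑ u, F u (u1, x2, w, xt, y) := fun u1 x2 w xt y => hF' (u1, x2, w, xt, y)
  have hDD : ∀ u1 x2 w y, DD (fun x s => l s * k2 x (e s)) (fun u1 s => kY u1 (e s)) u1 x2 w y =
      DD k2 kY u1 x2 w y := by
    intro u1 x2 w y
    unfold DD
    have e1 : ∑ xt, ∑ s, l s * F (e s) (u1, x2, w, xt, y) =
        ∑ s, l s * k2 x2 (e s) * kY u1 (e s) w y := by
      rw [Finset.sum_comm]
      refine Finset.sum_congr rfl fun s _ => ?_
      rw [← Finset.mul_sum]
      simp [F, mul_assoc]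
    have e2 : ∑ xt, ∑ u, F u (u1, x2, w, xt, y) = ∑ u, k2 x2 u * kY u1 u w y := by
      rw [Finset.sum_comm]
      refine Finset.sum_congr rfl fun s _ => ?_
      simp [F]
    rw [← e1, ← e2]
    exact Finset.sum_congr rfl fun xt _ => hF u1 x2 w xt y
  have hiii : ∀ x xt, ∑ s, (if h2 (e s) = xt then l s * k2 x (e s) else 0) =
      ∑ u, (if h2 u = xt then k2 x u else 0) := by
    intro x xt
    have e1 : ∑ y, ∑ s, l s * F (e s) (u10, x, w0, xt, y) =
        ∑ s, (if h2 (e s) = xt then l s * k2 x (e s) else 0) := by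
      rw [Finset.sum_comm]
      refine Finset.sum_congr rfl fun s _ => ?_
      by_cases h : h2 (e s) = xt
      · simp [F, h, ← Finset.mul_sum, (hkY _ _ _).2]
      · simp [F, h]
    have e2 : ∑ y, ∑ u, F u (u10, x, w0, xt, y) =
        ∑ u, (if h2 u = xt then k2 x u else 0) := by
      rw [Finset.sum_comm]
      refine Finset.sum_congr rfl fun s _ => ?_
      by_cases h : h2 s = xt
      · simp [F, h, ← Finset.mul_sum, (hkY _ _ _).2]
      · simp [F, h]
    rw [← e1, ← e2]
    exact Finset.sum_congr rfl fun y _ => hF u10 x w0 xt y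
  have hker : IsKernel (fun x s => l s * k2 x (e s)) := by
    intro x
    refine ⟨fun s => mul_nonneg (hl s) ((hk2 x).1 _), ?_⟩
    have e1 : ∑ xt, ∑ s, (if h2 (e s) = xt then l s * k2 x (e s) else 0) =
        ∑ s, l s * k2 x (e s) := by
      rw [Finset.sum_comm]; simp
    have e2 : ∑ xt, ∑ u, (if h2 u = xt then k2 x u else 0) = ∑ u, k2 x u := by
      rw [Finset.sum_comm]; simp
    rw [← e1, ← (hk2 x).2, ← e2]
    exact Finset.sum_congr rfl fun xt _ => hiii x xt
  have hHY : HYq (m2 q3) (fun x s => l s * k2 x (e s)) (fun u => f2 (h2 (e u))) =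
      HYq (m2 q3) k2 (fun u => f2 (h2 u)) :=
    HYq_congr (m2 q3) (fun x s => l s * k2 x (e s)) k2 (fun u => h2 (e u)) h2 f2 hiii
  refine ⟨fun x s => l s * k2 x (e s), fun s => h2 (e s), fun u1 s => kY u1 (e s), hker,
    fun u1 u2 => hkY _ _, ?_, ?_, ?_⟩
  · unfold aQ
    rw [hHY]
    unfold HXU
    rw [CEf_prod (fun x w s => m2 q3 x w * (l s * k2 x (e s))),
        CEf_prod (fun x w u => m2 q3 x w * k2 x u)]
    have : ∑ s, CEf (fun x w => m2 q3 x w * (l s * k2 x (e s))) = ∑ s, l s * c (e s) := by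
      refine Finset.sum_congr rfl fun s _ => ?_
      simp only [c]
      rw [← CEf_smul]
      congr 1
      funext x w
      ring
    rw [this]
    simp only [c] at hobj ⊢
    linarith
  · unfold cQ mQ JJ
    simp_rw [hDD]
  · intro x1 x2 w y
    unfold mQ JJ
    simp_rw [hDD]

end

noncomputable section

set_option linter.unusedSectionVars false
set_option linter.unusedSimpArgs false

/-! ### Code stage: single-letterization -/

/-- Insert a letter at position `i`. -/
def ins {α : Type*} {m : ℕ} (i : Fin (m + 1)) (a : α) (z : Fin m → α) : Fin (m + 1) → α :=
  Fin.insertNth (α := fun _ => α) i a z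

@[simp] lemma ins_same {α : Type*} {m : ℕ} (i : Fin (m + 1)) (a : α) (z : Fin m → α) :
    ins i a z i = a := by simp [ins]

@[simp] lemma ins_succAbove {α : Type*} {m : ℕ} (i : Fin (m + 1)) (a : α) (z : Fin m → α)
    (j : Fin m) : ins i a z (i.succAbove j) = z j := by simp [ins]

/-- The insertion equivalence. -/
def insE {α : Type*} {m : ℕ} (i : Fin (m + 1)) : α × (Fin m → α) ≃ (Fin (m + 1) → α) :=
  Fin.insertNthEquiv (fun _ => α) i

lemma insE_apply {α : Type*} {m : ℕ} (i : Fin (m + 1)) (p : α × (Fin m → α)) :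
    insE i p = ins i p.1 p.2 := rfl

lemma sum_ins {α : Type*} [Fintype α] {m : ℕ} (i : Fin (m + 1)) (F : (Fin (m + 1) → α) → ℝ) :
    ∑ x, F x = ∑ a, ∑ z, F (ins i a z) := by
  rw [← (insE i).sum_comp, Fintype.sum_prod_type]
  rfl

lemma sum_ins_ite {α : Type*} [Fintype α] [DecidableEq α] {m : ℕ} (i : Fin (m + 1)) (a : α)
    (F : (Fin (m + 1) → α) → ℝ) :
    ∑ x, (if x i = a then F x else 0) = ∑ z, F (ins i a z) := by
  rw [sum_ins i]
  simp only [ins_same]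
  rw [Finset.sum_comm]
  simp

lemma prod_ins {m : ℕ} (i : Fin (m + 1)) (F : Fin (m + 1) → ℝ) :
    ∏ j, F j = F i * ∏ j, F (i.succAbove j) := Fin.prod_univ_succAbove F i

lemma CEf_split {α β β' γ : Type*} [Fintype α] [Fintype β] [Fintype β'] [Fintype γ]
    (e : β' × γ ≃ β) (f : α → β → ℝ) : CEf f = ∑ c, CEf (fun a b => f a (e (b, c))) := by
  rw [← CEf_equiv e f]
  exact CEf_prod (fun a b c => f a (e (b, c)))

/-- Single-letter kernel extracted from a block encoder. -/
def kIns {X W U : Type*} [Fintype X] {m : ℕ} (c : W → X → ℝ) (e : (Fin (m + 1) → X) → U → ℝ)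
    (i : Fin (m + 1)) (v : Fin m → W) (x : X) (u : U) : ℝ :=
  ∑ z : Fin m → X, (∏ j, c (v j) (z j)) * e (ins i x z) u

lemma kIns_kernel {X W U : Type*} [Fintype X] [Fintype U] [DecidableEq X] {m : ℕ} (c : W → X → ℝ)
    (hc : IsKernel c)
    (e : (Fin (m + 1) → X) → U → ℝ) (he : IsKernel e)
    (i : Fin (m + 1)) (v : Fin m → W) : IsKernel (kIns c e i v) := by
  intro x
  refine ⟨fun u => Finset.sum_nonneg fun z _ => mul_nonneg (Finset.prod_nonneg fun j _ =>
    (hc _).1 _) ((he _).1 _), ?_⟩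
  unfold kIns
  rw [Finset.sum_comm]
  simp_rw [← Finset.mul_sum, (he _).2, mul_one]
  rw [sum_pi_prod (fun j => c (v j))]
  simp [(hc _).2]

lemma sumQW {W : Type*} [Fintype W] [DecidableEq W] {m : ℕ} (qW : W → ℝ) (h : ∑ w, qW w = 1) :
    ∑ v : Fin m → W, ∏ j, qW (v j) = 1 := by
  rw [sum_pi_prod (fun _ => qW)]
  simp [h]

section sideA
variable {X W V : Type*} [Fintype X] [Fintype W] [Fintype V]
  [DecidableEq X] [DecidableEq W] [DecidableEq V] {m κ : ℕ}

/-- Block law of `(Xⁿ, Wⁿ, U)`. -/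
def muA {U : Type*} (q : X → W → ℝ) (e : (Fin (m + 1) → X) → U → ℝ) :
    (Fin (m + 1) → X) × (Fin (m + 1) → W) × U → ℝ :=
  fun ω => (∏ j, q (ω.1 j) (ω.2.1 j)) * e ω.1 ω.2.2

lemma sum_prod_pair (F : Fin (m + 1) → X → W → ℝ) :
    ∑ x : Fin (m + 1) → X, ∑ w : Fin (m + 1) → W, ∏ j, F j (x j) (w j) =
      ∏ j, ∑ x, ∑ w, F j x w := by
  have : ∀ x : Fin (m + 1) → X, ∑ w : Fin (m + 1) → W, ∏ j, F j (x j) (w j) =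
      ∏ j, ∑ w, F j (x j) w := fun x => sum_pi_prod (fun j w => F j (x j) w)
  simp_rw [this]
  exact sum_pi_prod (fun j x => ∑ w, F j x w)

lemma muA_pmf {U : Type*} [Fintype U] (q : X → W → ℝ) (hq : ∀ x w, 0 ≤ q x w)
    (hq1 : ∑ x, ∑ w, q x w = 1)
    (e : (Fin (m + 1) → X) → U → ℝ) (he : IsKernel e) : IsPMF (muA q e) := by
  refine ⟨fun ω => mul_nonneg (Finset.prod_nonneg fun j _ => hq _ _) ((he _).1 _), ?_⟩
  simp only [muA, Fintype.sum_prod_type, ← Finset.mul_sum, (he _).2, mul_one]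
  rw [sum_prod_pair (fun _ => q)]
  simp [hq1]

lemma muA_marg {U : Type*} [Fintype U] [DecidableEq U] (qW : W → ℝ) (c : W → X → ℝ) (q : X → W → ℝ)
    (hq : ∀ x w, q x w = qW w * c w x)
    (e : (Fin (m + 1) → X) → U → ℝ) (i : Fin (m + 1)) (a : X) (w : W) (v : Fin m → W) (u : U) :
    rvDist (muA q e) (fun ω => (ω.1 i, (ω.2.1, ω.2.2))) (a, (ins i w v, u)) =
      (∏ j, qW (v j)) * (q a w * kIns c e i v a u) := by
  unfold rvDist muA
  simp only [Fintype.sum_prod_type, Prod.mk.injEq, ite_and, Finset.sum_ite_eq', Finset.mem_univ, if_true,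
    Finset.sum_ite_irrel, Finset.sum_const_zero]
  rw [sum_ins_ite i a (fun x => (∏ j, q (x j) (ins i w v j)) * e x u)]
  unfold kIns
  simp only [Finset.mul_sum]
  refine Finset.sum_congr rfl fun z _ => ?_
  rw [prod_ins i]
  simp only [ins_same, ins_succAbove, hq, Finset.prod_mul_distrib]
  ring

lemma Hc_muA_X {U : Type*} [Fintype U] [DecidableEq U] (qW : W → ℝ) (c : W → X → ℝ) (q : X → W → ℝ)
    (hq : ∀ x w, q x w = qW w * c w x)
    (e : (Fin (m + 1) → X) → U → ℝ) (i : Fin (m + 1)) :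
    Hc (muA q e) (fun ω => ω.1 i) (fun ω => (ω.2.1, ω.2.2)) =
      ∑ v : Fin m → W, (∏ j, qW (v j)) * HXU q (kIns c e i v) := by
  rw [Hc_eq_CEf]
  rw [CEf_split (β' := W × U) (γ := Fin m → W)
    { toFun := fun p => (insE i (p.1.1, p.2), p.1.2)
      invFun := fun p => ((((insE i).symm p.1).1, p.2), ((insE i).symm p.1).2)
      left_inv := fun p => by simp
      right_inv := fun p => by simp }]
  refine Finset.sum_congr rfl fun v _ => ?_
  unfold HXU
  rw [← CEf_smul]
  congr 1
  funext a p
  exact muA_marg qW c q hq e i a p.1 v p.2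

lemma Hc_muA_V {U Y : Type*} [Fintype U] [DecidableEq U] [Fintype Y] [DecidableEq Y]
    (qW : W → ℝ) (c : W → X → ℝ) (q : X → W → ℝ)
    (hq : ∀ x w, q x w = qW w * c w x)
    (e : (Fin (m + 1) → X) → U → ℝ) (i : Fin (m + 1)) (g : U → Y) :
    Hc (muA q e) (fun ω => g ω.2.2) (fun ω => ω.2.1) =
      ∑ v : Fin m → W, (∏ j, qW (v j)) * HYq q (kIns c e i v) g := by
  rw [Hc_eq_CEf]
  rw [CEf_split (β' := W) (γ := Fin m → W) (insE i)]
  refine Finset.sum_congr rfl fun v _ => ?_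
  unfold HYq
  rw [← CEf_smul]
  congr 1
  funext y w
  have := rvDist_comp (muA q e) (fun ω => (ω.1 i, (ω.2.1, ω.2.2)))
    (fun p => (g p.2.2, p.2.1)) (y, ins i w v)
  simp only at this
  rw [insE_apply]
  rw [this]
  simp only [Fintype.sum_prod_type, Prod.mk.injEq, Finset.mul_sum]
  refine Finset.sum_congr rfl fun x _ => ?_
  rw [Finset.sum_comm]
  refine Finset.sum_congr rfl fun u _ => ?_
  by_cases h : g u = y
  · simp only [h, true_and, Finset.sum_ite_eq', Finset.mem_univ, if_true]
    rw [muA_marg qW c q hq]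
  · simp [h]

lemma CEf_iid (qW : W → ℝ) (hqW : ∑ w, qW w = 1) (q : X → W → ℝ)
    (hq : ∀ w, ∑ x, q x w = qW w) (n : ℕ) :
    CEf (fun (x : Fin n → X) (w : Fin n → W) => ∏ j, q (x j) (w j)) = n * CEf q := by
  rw [CEf_eq, CEf_eq]
  have h1 : ∀ w : Fin n → W, ∑ x : Fin n → X, ∏ j, q (x j) (w j) = ∏ j, qW (w j) := by
    intro w
    rw [sum_pi_prod (fun j x => q x (w j))]
    simp [hq]
  simp_rw [h1, hq]
  rw [ent_iid qW hqW, mul_sub]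
  congr 1
  have h2 := ent_iid (fun p : X × W => q p.1 p.2)
    (by rw [Fintype.sum_prod_type_right]; simp [hq, hqW]) n
  rw [← h2]
  exact ((Equiv.arrowProdEquivProdArrow (Fin n) (fun _ => X) (fun _ => W)).sum_comp
    (fun p : (Fin n → X) × (Fin n → W) => Real.negMulLog (∏ j, q (p.1 j) (p.2 j)))).symm

lemma code_a {Y : Type*} [Fintype Y] [DecidableEq Y] (qW : W → ℝ) (hqW : IsPMF qW)
    (c : W → X → ℝ) (hc : IsKernel c) (q : X → W → ℝ) (hq : ∀ x w, q x w = qW w * c w x)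
    (hκ : 0 < κ) (e : (Fin (m + 1) → X) → Fin κ × (Fin (m + 1) → V) → ℝ)
    (he0 : ∀ x u, 0 ≤ e x u) (he : ∀ x k, ∑ v, e x (k, v) = (κ : ℝ)⁻¹)
    (g : V → Y) (hg : Function.Injective g) :
    0 ≤ ∑ i : Fin (m + 1), ∑ v : Fin m → W, (∏ j, qW (v j)) *
      aQ q (kIns c e i v) (fun u => g (u.2 i)) := by
  have hκ' : (κ : ℝ) ≠ 0 := by positivity
  have heK : IsKernel e := fun x => ⟨he0 x, by
    rw [Fintype.sum_prod_type]; simp [he, hκ']⟩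
  have hq0 : ∀ x w, 0 ≤ q x w := fun x w => by
    rw [hq]; exact mul_nonneg (hqW.1 _) ((hc _).1 _)
  have hqs : ∀ w, ∑ x, q x w = qW w := fun w => by
    simp_rw [hq, ← Finset.mul_sum, (hc w).2, mul_one]
  have hμ := muA_pmf q hq0 (by rw [Finset.sum_comm]; simp [hqs, hqW.2]) e heK
  have hXW : Hc (muA q e) (fun ω => ω.1) (fun ω => ω.2.1) = (m + 1 : ℕ) * CEf q := by
    rw [← CEf_iid qW hqW.2 q hqs, Hc_eq_CEf]
    congr 1
    funext x w
    unfold rvDist muA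
    simp only [Fintype.sum_prod_type, Prod.mk.injEq, ite_and, Finset.sum_ite_eq', Finset.mem_univ,
      if_true, Finset.sum_ite_irrel, Finset.sum_const_zero, ← Finset.mul_sum, he]
    simp [hκ']
  have hXWK : Hc (muA q e) (fun ω => ω.1) (fun ω => (ω.2.1, ω.2.2.1)) = (m + 1 : ℕ) * CEf q := by
    rw [← CEf_iid qW hqW.2 q hqs, Hc_eq_CEf]
    have : (fun (a : Fin (m+1) → X) (p : (Fin (m+1) → W) × Fin κ) =>
      rvDist (muA q e) (fun ω => (ω.1, (ω.2.1, ω.2.2.1))) (a, p)) =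
      fun a p => (∏ j, q (a j) (p.1 j)) * (κ : ℝ)⁻¹ := by
      funext x p
      obtain ⟨w, k⟩ := p
      unfold rvDist muA
      simp only [Fintype.sum_prod_type, Prod.mk.injEq, ite_and, Finset.sum_ite_eq',
        Finset.mem_univ, if_true, Finset.sum_ite_irrel, Finset.sum_const_zero]
      rw [Finset.sum_comm]
      simp only [Finset.sum_ite_eq', Finset.mem_univ, if_true, ← Finset.mul_sum, he]
    rw [this, CEf_prod (fun (a : Fin (m+1) → X) (b : Fin (m+1) → W) (_ : Fin κ) => (∏ j, q (a j) (b j)) * (κ : ℝ)⁻¹)]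
    simp only [CEf_smul_right]
    simp [hκ']
  have hb := block_a hμ (fun ω => ω.1) (fun ω => ω.2.1) (fun ω => ω.2.2.1) (fun ω => ω.2.2.2)
    (by rw [hXW, hXWK])
  rw [hXW] at hb
  have h1 : ∀ i, Hc (muA q e) (fun ω => ω.2.2.2 i) (fun ω => ω.2.1) =
      ∑ v : Fin m → W, (∏ j, qW (v j)) * HYq q (kIns c e i v) (fun u => g (u.2 i)) := by
    intro i
    rw [← Hc_muA_V qW c q hq e i (fun u => g (u.2 i))]
    exact (Hc_inj_left (muA q e) (fun ω => ω.2.2.2 i) (fun ω => ω.2.1) g hg).symm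
  have h2 := fun i => Hc_muA_X qW c q hq e i
  have h3 : ∀ i, Hc (muA q e) (fun ω => ω.1 i) (fun ω => (ω.2.1, (ω.2.2.1, ω.2.2.2))) =
    Hc (muA q e) (fun ω => ω.1 i) (fun ω => (ω.2.1, ω.2.2)) := fun i => rfl
  simp_rw [h3, h1, h2] at hb
  have h4 : ∑ i : Fin (m + 1), ∑ v : Fin m → W, (∏ j, qW (v j)) * CEf q = (m + 1 : ℕ) * CEf q := by
    simp_rw [← Finset.sum_mul, sumQW qW hqW.2]
    simp
  unfold aQ
  simp only [mul_add, mul_sub, Finset.sum_add_distrib, Finset.sum_sub_distrib, h4]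
  linarith

end sideA

end

noncomputable section

set_option linter.unusedSectionVars false
set_option linter.unusedSimpArgs false

/-- Single-letter decoder extracted from a block decoder. -/
def yIns {U1 U2 Wa Ya : Type*} [Fintype Ya] {m : ℕ}
    (dec : U1 → U2 → (Fin (m + 1) → Wa) → (Fin (m + 1) → Ya) → ℝ)
    (i : Fin (m + 1)) (v : Fin m → Wa) (u1 : U1) (u2 : U2) (w : Wa) (y : Ya) : ℝ :=
  ∑ ym : Fin m → Ya, dec u1 u2 (ins i w v) (ins i y ym)

lemma yIns_kernel {U1 U2 Wa Ya : Type*} [Fintype Ya] [DecidableEq Ya] {m : ℕ}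
    (dec : U1 → U2 → (Fin (m + 1) → Wa) → (Fin (m + 1) → Ya) → ℝ)
    (hdec : ∀ u1 u2, IsKernel (dec u1 u2))
    (i : Fin (m + 1)) (v : Fin m → Wa) (u1 : U1) (u2 : U2) : IsKernel (yIns dec i v u1 u2) := by
  intro w
  refine ⟨fun y => Finset.sum_nonneg fun z _ => (hdec _ _ _).1 _, ?_⟩
  unfold yIns
  rw [← sum_ins i, (hdec _ _ _).2]

/-- i.i.d. extension of the source. -/
def qn {X1 X2 Wa : Type*} (q3 : X1 × X2 × Wa → ℝ) (n : ℕ) :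
    (Fin n → X1) × (Fin n → X2) × (Fin n → Wa) → ℝ :=
  fun z => ∏ j, q3 (z.1 j, z.2.1 j, z.2.2 j)

section sideC
variable {X1 X2 Wa Ya U1 U2 : Type*} [Fintype X1] [Fintype X2] [Fintype Wa] [Fintype Ya]
  [Fintype U1] [Fintype U2]
  [DecidableEq X1] [DecidableEq X2] [DecidableEq Wa] [DecidableEq Ya] [DecidableEq U1] {m κ : ℕ}

lemma JJ_marg (qW : Wa → ℝ) (c1 : Wa → X1 → ℝ) (c2 : Wa → X2 → ℝ) (q3 : X1 × X2 × Wa → ℝ)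
    (hq : ∀ x1 x2 w, q3 (x1, x2, w) = qW w * c1 w x1 * c2 w x2)
    (e1 : (Fin (m + 1) → X1) → U1 → ℝ) (e2 : (Fin (m + 1) → X2) → U2 → ℝ)
    (dec : U1 → U2 → (Fin (m + 1) → Wa) → (Fin (m + 1) → Ya) → ℝ)
    (i : Fin (m + 1)) (v : Fin m → Wa) (a : X1) (b : X2) (w : Wa) (u : U1) (y : Ya) :
    ∑ z1, ∑ z2, ∑ ym, JJ (qn q3 (m + 1)) e1 e2 dec (ins i a z1) (ins i b z2) (ins i w v) u
      (ins i y ym) =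
    (∏ j, qW (v j)) * JJ q3 (kIns c1 e1 i v) (kIns c2 e2 i v) (yIns dec i v) a b w u y := by
  unfold JJ DD qn
  have h1 : ∀ z1 z2, ∏ j, q3 (ins i a z1 j, ins i b z2 j, ins i w v j) =
      q3 (a, b, w) * ((∏ j, qW (v j)) * (∏ j, c1 (v j) (z1 j)) * ∏ j, c2 (v j) (z2 j)) := by
    intro z1 z2
    rw [prod_ins i]
    simp only [ins_same, ins_succAbove]
    simp only [hq, Finset.prod_mul_distrib]
  simp only [h1]
  have h2 : ∀ z1 z2, ∑ ym : Fin m → Ya, q3 (a, b, w) * ((∏ j, qW (v j)) * (∏ j, c1 (v j) (z1 j)) * ∏ j, c2 (v j) (z2 j)) *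
        e1 (ins i a z1) u * (∑ u2, e2 (ins i b z2) u2 * dec u u2 (ins i w v) (ins i y ym)) =
      ((∏ j, qW (v j)) * q3 (a, b, w)) * (((∏ j, c1 (v j) (z1 j)) * e1 (ins i a z1) u) *
        ∑ u2, ((∏ j, c2 (v j) (z2 j)) * e2 (ins i b z2) u2) * yIns dec i v u u2 w y) := by
    intro z1 z2
    unfold yIns
    rw [← Finset.mul_sum, Finset.sum_comm]
    simp only [← Finset.mul_sum, mul_assoc]
    ring
  simp only [h2, ← Finset.mul_sum, ← Finset.sum_mul]
  unfold kIns
  rw [Finset.sum_comm]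
  simp only [← Finset.sum_mul]
  ring

/-- Block law of `(X₁ⁿ, X₂ⁿ, Wⁿ, U₁, Yⁿ)`. -/
def muC (q3 : X1 × X2 × Wa → ℝ) (e1 : (Fin (m + 1) → X1) → U1 → ℝ)
    (e2 : (Fin (m + 1) → X2) → U2 → ℝ)
    (dec : U1 → U2 → (Fin (m + 1) → Wa) → (Fin (m + 1) → Ya) → ℝ) :
    (Fin (m + 1) → X1) × (Fin (m + 1) → X2) × (Fin (m + 1) → Wa) × U1 × (Fin (m + 1) → Ya) → ℝ :=
  fun ω => JJ (qn q3 (m + 1)) e1 e2 dec ω.1 ω.2.1 ω.2.2.1 ω.2.2.2.1 ω.2.2.2.2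

lemma DD_sum {X2 Wa U1 U2 Ya : Type*} [Fintype U2] [Fintype Ya] (k2 : X2 → U2 → ℝ)
    (kY : U1 → U2 → Wa → Ya → ℝ) (hk2 : IsKernel k2) (hkY : ∀ u1 u2, IsKernel (kY u1 u2))
    (u1 : U1) (x2 : X2) (w : Wa) : ∑ y, DD k2 kY u1 x2 w y = 1 := by
  unfold DD
  rw [Finset.sum_comm]
  simp [← Finset.mul_sum, (hkY _ _ _).2, (hk2 _).2]

lemma DD_nonneg {X2 Wa U1 U2 Ya : Type*} [Fintype U2] [Fintype Ya] (k2 : X2 → U2 → ℝ)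
    (kY : U1 → U2 → Wa → Ya → ℝ) (hk2 : IsKernel k2) (hkY : ∀ u1 u2, IsKernel (kY u1 u2))
    (u1 : U1) (x2 : X2) (w : Wa) (y : Ya) : 0 ≤ DD k2 kY u1 x2 w y :=
  Finset.sum_nonneg fun u2 _ => mul_nonneg ((hk2 _).1 _) ((hkY _ _ _).1 _)

lemma qn_sum (q3 : X1 × X2 × Wa → ℝ) (h : ∑ z, q3 z = 1) (n : ℕ) :
    ∑ x1, ∑ x2, ∑ w, qn q3 n (x1, x2, w) = 1 := by
  unfold qn
  have h1 : ∀ (x1 : Fin n → X1) (x2 : Fin n → X2), ∑ w : Fin n → Wa, ∏ j, q3 (x1 j, x2 j, w j) =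
      ∏ j, ∑ w, q3 (x1 j, x2 j, w) := fun x1 x2 => sum_pi_prod (fun j w => q3 (x1 j, x2 j, w))
  have h2 : ∀ (x1 : Fin n → X1), ∑ x2 : Fin n → X2, ∏ j, ∑ w, q3 (x1 j, x2 j, w) =
      ∏ j, ∑ x2, ∑ w, q3 (x1 j, x2, w) :=
    fun x1 => sum_pi_prod (fun j x2 => ∑ w, q3 (x1 j, x2, w))
  simp_rw [h1, h2]
  rw [sum_pi_prod (fun _ x1 => ∑ x2, ∑ w, q3 (x1, x2, w))]
  simp only [Fintype.sum_prod_type] at h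
  simp [h]

lemma muC_pmf (q3 : X1 × X2 × Wa → ℝ) (hq3 : IsPMF q3) (e1 : (Fin (m + 1) → X1) → U1 → ℝ)
    (e2 : (Fin (m + 1) → X2) → U2 → ℝ)
    (dec : U1 → U2 → (Fin (m + 1) → Wa) → (Fin (m + 1) → Ya) → ℝ)
    (he1 : IsKernel e1) (he2 : IsKernel e2) (hdec : ∀ u1 u2, IsKernel (dec u1 u2)) :
    IsPMF (muC q3 e1 e2 dec) := by
  refine ⟨fun ω => mul_nonneg (mul_nonneg (Finset.prod_nonneg fun j _ => hq3.1 _) ((he1 _).1 _))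
    (DD_nonneg e2 dec he2 hdec _ _ _ _), ?_⟩
  simp only [muC, JJ, Fintype.sum_prod_type, ← Finset.mul_sum, DD_sum e2 dec he2 hdec, mul_one,
    (he1 _).2]
  exact qn_sum q3 hq3.2 _

lemma muC_marg (qW : Wa → ℝ) (c1 : Wa → X1 → ℝ) (c2 : Wa → X2 → ℝ) (q3 : X1 × X2 × Wa → ℝ)
    (hq : ∀ x1 x2 w, q3 (x1, x2, w) = qW w * c1 w x1 * c2 w x2)
    (e1 : (Fin (m + 1) → X1) → U1 → ℝ) (e2 : (Fin (m + 1) → X2) → U2 → ℝ)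
    (dec : U1 → U2 → (Fin (m + 1) → Wa) → (Fin (m + 1) → Ya) → ℝ)
    (i : Fin (m + 1)) (v : Fin m → Wa) (a : X1) (b : X2) (w : Wa) (u : U1) (y : Ya) :
    rvDist (muC q3 e1 e2 dec)
      (fun ω => ((ω.1 i, ω.2.2.2.2 i), ((ω.2.1 i, ω.2.2.1), ω.2.2.2.1)))
      ((a, y), ((b, ins i w v), u)) =
    (∏ j, qW (v j)) * JJ q3 (kIns c1 e1 i v) (kIns c2 e2 i v) (yIns dec i v) a b w u y := by
  rw [← JJ_marg qW c1 c2 q3 hq]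
  unfold rvDist muC
  simp only [Fintype.sum_prod_type, Prod.mk.injEq]
  rw [← sum_ins_ite i a (fun x1 => ∑ z2, ∑ ym, JJ (qn q3 (m + 1)) e1 e2 dec x1 (ins i b z2)
    (ins i w v) u (ins i y ym))]
  refine Finset.sum_congr rfl fun x1 _ => ?_
  by_cases h1 : x1 i = a
  swap
  · simp [h1]
  rw [if_pos h1]
  rw [← sum_ins_ite i b (fun x2 => ∑ ym, JJ (qn q3 (m + 1)) e1 e2 dec x1 x2
    (ins i w v) u (ins i y ym))]
  refine Finset.sum_congr rfl fun x2 _ => ?_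
  by_cases h2 : x2 i = b
  swap
  · simp [h2]
  rw [if_pos h2]
  rw [← sum_ins_ite i y (fun ym => JJ (qn q3 (m + 1)) e1 e2 dec x1 x2
    (ins i w v) u ym)]
  rw [Finset.sum_eq_single (ins i w v), Finset.sum_eq_single u]
  · refine Finset.sum_congr rfl fun ym _ => ?_
    simp [h1, h2]
  · intro u' _ hu
    simp [hu]
  · simp
  · intro u' _ hu
    simp [hu]
  · simp

lemma muC_Hc_U (qW : Wa → ℝ) (c1 : Wa → X1 → ℝ) (c2 : Wa → X2 → ℝ) (q3 : X1 × X2 × Wa → ℝ)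
    (hq : ∀ x1 x2 w, q3 (x1, x2, w) = qW w * c1 w x1 * c2 w x2)
    (e1 : (Fin (m + 1) → X1) → U1 → ℝ) (e2 : (Fin (m + 1) → X2) → U2 → ℝ)
    (dec : U1 → U2 → (Fin (m + 1) → Wa) → (Fin (m + 1) → Ya) → ℝ)
    (i : Fin (m + 1)) :
    Hc (muC q3 e1 e2 dec) (fun ω => (ω.1 i, ω.2.2.2.2 i))
      (fun ω => ((ω.2.1 i, ω.2.2.1), ω.2.2.2.1)) =
    ∑ v : Fin m → Wa, (∏ j, qW (v j)) *
      CEf (fun (p : X1 × Ya) (r : (X2 × Wa) × U1) =>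
        JJ q3 (kIns c1 e1 i v) (kIns c2 e2 i v) (yIns dec i v) p.1 r.1.1 r.1.2 r.2 p.2) := by
  rw [Hc_eq_CEf]
  rw [CEf_split (β' := (X2 × Wa) × U1) (γ := Fin m → Wa)
    { toFun := fun p => ((p.1.1.1, insE i (p.1.1.2, p.2)), p.1.2)
      invFun := fun p => (((p.1.1, ((insE i).symm p.1.2).1), p.2), ((insE i).symm p.1.2).2)
      left_inv := fun p => by simp
      right_inv := fun p => by simp }]
  refine Finset.sum_congr rfl fun v _ => ?_
  rw [← CEf_smul]
  congr 1
  funext p r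
  exact muC_marg qW c1 c2 q3 hq e1 e2 dec i v p.1 r.1.1 r.1.2 r.2 p.2

lemma muC_marg' (qW : Wa → ℝ) (c1 : Wa → X1 → ℝ) (c2 : Wa → X2 → ℝ) (q3 : X1 × X2 × Wa → ℝ)
    (hq : ∀ x1 x2 w, q3 (x1, x2, w) = qW w * c1 w x1 * c2 w x2)
    (e1 : (Fin (m + 1) → X1) → U1 → ℝ) (e2 : (Fin (m + 1) → X2) → U2 → ℝ)
    (dec : U1 → U2 → (Fin (m + 1) → Wa) → (Fin (m + 1) → Ya) → ℝ)
    (i : Fin (m + 1)) (v : Fin m → Wa) (a : X1) (b : X2) (w : Wa) (y : Ya) :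
    rvDist (muC q3 e1 e2 dec)
      (fun ω => ((ω.1 i, ω.2.2.2.2 i), (ω.2.1 i, ω.2.2.1)))
      ((a, y), (b, ins i w v)) =
    (∏ j, qW (v j)) * mQ q3 (kIns c1 e1 i v) (kIns c2 e2 i v) (yIns dec i v) a b w y := by
  unfold mQ
  rw [Finset.mul_sum]
  simp_rw [← muC_marg qW c1 c2 q3 hq]
  have := rvDist_snd (muC q3 e1 e2 dec)
    (fun ω => ((ω.1 i, ω.2.2.2.2 i), (ω.2.1 i, ω.2.2.1))) (fun ω => ω.2.2.2.1)
    ((a, y), (b, ins i w v))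
  rw [← this]
  refine Finset.sum_congr rfl fun u _ => ?_
  unfold rvDist
  refine Finset.sum_congr rfl fun ω _ => ?_
  simp only [Prod.mk.injEq, and_assoc]

lemma muC_Hc (qW : Wa → ℝ) (c1 : Wa → X1 → ℝ) (c2 : Wa → X2 → ℝ) (q3 : X1 × X2 × Wa → ℝ)
    (hq : ∀ x1 x2 w, q3 (x1, x2, w) = qW w * c1 w x1 * c2 w x2)
    (e1 : (Fin (m + 1) → X1) → U1 → ℝ) (e2 : (Fin (m + 1) → X2) → U2 → ℝ)
    (dec : U1 → U2 → (Fin (m + 1) → Wa) → (Fin (m + 1) → Ya) → ℝ)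
    (i : Fin (m + 1)) :
    Hc (muC q3 e1 e2 dec) (fun ω => (ω.1 i, ω.2.2.2.2 i)) (fun ω => (ω.2.1 i, ω.2.2.1)) =
    ∑ v : Fin m → Wa, (∏ j, qW (v j)) *
      CEf (fun (p : X1 × Ya) (r : X2 × Wa) =>
        mQ q3 (kIns c1 e1 i v) (kIns c2 e2 i v) (yIns dec i v) p.1 r.1 r.2 p.2) := by
  rw [Hc_eq_CEf]
  rw [CEf_split (β' := X2 × Wa) (γ := Fin m → Wa)
    { toFun := fun p => (p.1.1, insE i (p.1.2, p.2))
      invFun := fun p => ((p.1, ((insE i).symm p.2).1), ((insE i).symm p.2).2)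
      left_inv := fun p => by simp
      right_inv := fun p => by simp }]
  refine Finset.sum_congr rfl fun v _ => ?_
  rw [← CEf_smul]
  congr 1
  funext p r
  exact muC_marg' qW c1 c2 q3 hq e1 e2 dec i v p.1 r.1 r.2 p.2

lemma muC_HV {Y : Type*} [Fintype Y] [DecidableEq Y] (qW : Wa → ℝ) (c1 : Wa → X1 → ℝ)
    (c2 : Wa → X2 → ℝ) (hc2 : IsKernel c2) (q3 : X1 × X2 × Wa → ℝ)
    (hq : ∀ x1 x2 w, q3 (x1, x2, w) = qW w * c1 w x1 * c2 w x2)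
    (e1 : (Fin (m + 1) → X1) → U1 → ℝ) (e2 : (Fin (m + 1) → X2) → U2 → ℝ)
    (dec : U1 → U2 → (Fin (m + 1) → Wa) → (Fin (m + 1) → Ya) → ℝ)
    (he2 : IsKernel e2) (hdec : ∀ u1 u2, IsKernel (dec u1 u2))
    (i : Fin (m + 1)) (g : U1 → Y) :
    Hc (muC q3 e1 e2 dec) (fun ω => g ω.2.2.2.1) (fun ω => ω.2.2.1) =
    ∑ v : Fin m → Wa, (∏ j, qW (v j)) * HYq (m1 q3) (kIns c1 e1 i v) g := by
  have hm : ∀ x w, m1 q3 x w = qW w * c1 w x := by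
    intro x w
    unfold m1
    simp_rw [hq, ← Finset.mul_sum, (hc2 w).2, mul_one]
  rw [← Hc_muA_V qW c1 (m1 q3) hm e1 i g, Hc_eq_CEf, Hc_eq_CEf]
  congr 1
  funext y w
  have h1 := rvDist_comp (muC q3 e1 e2 dec) (fun ω => (ω.1, (ω.2.2.1, ω.2.2.2.1)))
    (fun p => (g p.2.2, p.2.1)) (y, w)
  have h2 := rvDist_comp (muA (m1 q3) e1) (fun ω => (ω.1, (ω.2.1, ω.2.2)))
    (fun p => (g p.2.2, p.2.1)) (y, w)
  simp only at h1 h2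
  rw [h1, h2]
  refine Finset.sum_congr rfl fun p _ => ?_
  obtain ⟨x, w, u⟩ := p
  congr 1
  unfold rvDist muC muA JJ
  simp only [Fintype.sum_prod_type, Prod.mk.injEq, ite_and, Finset.sum_ite_eq', Finset.mem_univ,
      if_true, Finset.sum_ite_irrel, Finset.sum_const_zero, ← Finset.mul_sum,
      DD_sum e2 dec he2 hdec, mul_one, ← Finset.sum_mul]
  congr 1
  unfold qn m1
  rw [sum_pi_prod (fun j x2 => q3 (x j, x2, w j))]

end sideC

end

noncomputable section

set_option linter.unusedSectionVars false
set_option linter.unusedSimpArgs false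

section codeC
variable {X1 X2 Wa Ya U1 U2 : Type*} [Fintype X1] [Fintype X2] [Fintype Wa] [Fintype Ya]
  [Fintype U1] [Fintype U2]
  [DecidableEq X1] [DecidableEq X2] [DecidableEq Wa] [DecidableEq Ya] [DecidableEq U1] {m κ : ℕ}

/-- Distance to the target. -/
def TVq (q4 : X1 × X2 × Wa × Ya → ℝ) (M : X1 → X2 → Wa → Ya → ℝ) : ℝ :=
  ∑ a, ∑ b, ∑ w, ∑ y, |M a b w y - q4 (a, b, w, y)|

lemma q4_marg (qW : Wa → ℝ) (q4 : X1 × X2 × Wa × Ya → ℝ)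
    (h4 : ∀ w, ∑ a, ∑ b, ∑ y, q4 (a, b, w, y) = qW w)
    (i : Fin (m + 1)) (v : Fin m → Wa) (a : X1) (b : X2) (w : Wa) (y : Ya) :
    ∑ z1, ∑ z2, ∑ ym, ∏ j, q4 (ins i a z1 j, ins i b z2 j, ins i w v j, ins i y ym j) =
      (∏ j, qW (v j)) * q4 (a, b, w, y) := by
  simp only [prod_ins i, ins_same, ins_succAbove, ← Finset.mul_sum]
  rw [mul_comm]
  congr 1
  have h1 : ∀ (z1 : Fin m → X1) (z2 : Fin m → X2), ∑ ym : Fin m → Ya,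
      ∏ j, q4 (z1 j, z2 j, v j, ym j) = ∏ j, ∑ y, q4 (z1 j, z2 j, v j, y) :=
    fun z1 z2 => sum_pi_prod (fun j y => q4 (z1 j, z2 j, v j, y))
  have h2 : ∀ (z1 : Fin m → X1), ∑ z2 : Fin m → X2,
      ∏ j, ∑ y, q4 (z1 j, z2 j, v j, y) = ∏ j, ∑ b, ∑ y, q4 (z1 j, b, v j, y) :=
    fun z1 => sum_pi_prod (fun j b => ∑ y, q4 (z1 j, b, v j, y))
  simp_rw [h1, h2]
  rw [sum_pi_prod (fun j a => ∑ b, ∑ y, q4 (a, b, v j, y))]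
  simp_rw [h4]

lemma code_tv (qW : Wa → ℝ) (hqW : ∀ w, 0 ≤ qW w)
    (c1 : Wa → X1 → ℝ) (c2 : Wa → X2 → ℝ) (q3 : X1 × X2 × Wa → ℝ)
    (hq : ∀ x1 x2 w, q3 (x1, x2, w) = qW w * c1 w x1 * c2 w x2)
    (q4 : X1 × X2 × Wa × Ya → ℝ)
    (h4 : ∀ w, ∑ a, ∑ b, ∑ y, q4 (a, b, w, y) = qW w)
    (e1 : (Fin (m + 1) → X1) → U1 → ℝ) (e2 : (Fin (m + 1) → X2) → U2 → ℝ)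
    (dec : U1 → U2 → (Fin (m + 1) → Wa) → (Fin (m + 1) → Ya) → ℝ)
    (i : Fin (m + 1)) :
    ∑ v : Fin m → Wa, (∏ j, qW (v j)) *
      TVq q4 (mQ q3 (kIns c1 e1 i v) (kIns c2 e2 i v) (yIns dec i v)) ≤
    ∑ x1, ∑ x2, ∑ w, ∑ y, |mQ (qn q3 (m + 1)) e1 e2 dec x1 x2 w y -
      ∏ j, q4 (x1 j, x2 j, w j, y j)| := by
  set P := mQ (qn q3 (m + 1)) e1 e2 dec with hP
  have hm : ∀ (v : Fin m → Wa) a b w y, ∑ z1, ∑ z2, ∑ ym, P (ins i a z1) (ins i b z2) (ins i w v) (ins i y ym) =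
      (∏ j, qW (v j)) * mQ q3 (kIns c1 e1 i v) (kIns c2 e2 i v) (yIns dec i v) a b w y := by
    intro v a b w y
    rw [hP]
    unfold mQ
    rw [Finset.mul_sum]
    simp_rw [← JJ_marg qW c1 c2 q3 hq]
    have : ∀ z1 z2, ∑ ym : Fin m → Ya, ∑ u1, JJ (qn q3 (m + 1)) e1 e2 dec (ins i a z1) (ins i b z2) (ins i w v) u1
      (ins i y ym) = ∑ u1, ∑ ym, JJ (qn q3 (m + 1)) e1 e2 dec (ins i a z1) (ins i b z2) (ins i w v) u1
      (ins i y ym) := fun _ _ => Finset.sum_comm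
    simp_rw [this]
    have : ∀ z1, ∑ z2 : Fin m → X2, ∑ u1, ∑ ym : Fin m → Ya, JJ (qn q3 (m + 1)) e1 e2 dec (ins i a z1) (ins i b z2) (ins i w v) u1
      (ins i y ym) = ∑ u1, ∑ z2, ∑ ym, JJ (qn q3 (m + 1)) e1 e2 dec (ins i a z1) (ins i b z2) (ins i w v) u1
      (ins i y ym) := fun _ => Finset.sum_comm
    simp_rw [this]
    exact Finset.sum_comm
  set G : (Fin (m+1) → X1) → (Fin (m+1) → X2) → (Fin (m+1) → Wa) → (Fin (m+1) → Ya) → ℝ :=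
    fun x1 x2 w y => |P x1 x2 w y - ∏ j, q4 (x1 j, x2 j, w j, y j)| with hG
  have hterm : ∀ (v : Fin m → Wa) a b w y, (∏ j, qW (v j)) *
      |mQ q3 (kIns c1 e1 i v) (kIns c2 e2 i v) (yIns dec i v) a b w y - q4 (a, b, w, y)| ≤
      ∑ z1, ∑ z2, ∑ ym, G (ins i a z1) (ins i b z2) (ins i w v) (ins i y ym) := by
    intro v a b w y
    have h0 : 0 ≤ ∏ j, qW (v j) := Finset.prod_nonneg fun j _ => hqW _
    rw [← abs_of_nonneg h0, ← abs_mul, mul_sub, ← hm, ← q4_marg qW q4 h4]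
    simp only [← Finset.sum_sub_distrib]
    refine (Finset.abs_sum_le_sum_abs _ _).trans (Finset.sum_le_sum fun z1 _ => ?_)
    refine (Finset.abs_sum_le_sum_abs _ _).trans (Finset.sum_le_sum fun z2 _ => ?_)
    exact Finset.abs_sum_le_sum_abs _ _
  have hR : ∑ x1, ∑ x2, ∑ w, ∑ y, G x1 x2 w y = ∑ v : Fin m → Wa, ∑ a, ∑ b, ∑ w, ∑ y,
      ∑ z1, ∑ z2, ∑ ym, G (ins i a z1) (ins i b z2) (ins i w v) (ins i y ym) := by
    rw [sum_ins i]
    simp_rw [sum_ins (α := X2) i, sum_ins (α := Wa) i, sum_ins (α := Ya) i]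
    let e : ((Fin m → Wa) × X1 × X2 × Wa × Ya × (Fin m → X1) × (Fin m → X2) × (Fin m → Ya)) ≃
       (X1 × (Fin m → X1) × X2 × (Fin m → X2) × Wa × (Fin m → Wa) × Ya × (Fin m → Ya)) :=
      { toFun := fun p => (p.2.1, p.2.2.2.2.2.1, p.2.2.1, p.2.2.2.2.2.2.1, p.2.2.2.1, p.1,
          p.2.2.2.2.1, p.2.2.2.2.2.2.2)
        invFun := fun p => (p.2.2.2.2.2.1, p.1, p.2.2.1, p.2.2.2.2.1, p.2.2.2.2.2.2.1, p.2.1,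
          p.2.2.2.1, p.2.2.2.2.2.2.2)
        left_inv := fun p => rfl
        right_inv := fun p => rfl }
    have := e.sum_comp (fun p => G (ins i p.1 p.2.1) (ins i p.2.2.1 p.2.2.2.1)
      (ins i p.2.2.2.2.1 p.2.2.2.2.2.1) (ins i p.2.2.2.2.2.2.1 p.2.2.2.2.2.2.2))
    simp only [Fintype.sum_prod_type] at this
    exact this.symm
  rw [hR]
  refine Finset.sum_le_sum fun v _ => ?_
  unfold TVq
  simp only [Finset.mul_sum]
  exact Finset.sum_le_sum fun a _ => Finset.sum_le_sum fun b _ => Finset.sum_le_sum fun w _ =>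
    Finset.sum_le_sum fun y _ => by
      have := hterm v a b w y
      simpa only [Finset.mul_sum] using this

lemma code_c {V Y : Type*} [Fintype V] [DecidableEq V] [Fintype Y] [DecidableEq Y]
    (qW : Wa → ℝ) (hqW : IsPMF qW)
    (c1 : Wa → X1 → ℝ) (c2 : Wa → X2 → ℝ) (hc2 : IsKernel c2)
    (q3 : X1 × X2 × Wa → ℝ) (hq3 : IsPMF q3)
    (hq : ∀ x1 x2 w, q3 (x1, x2, w) = qW w * c1 w x1 * c2 w x2)
    (q4 : X1 × X2 × Wa × Ya → ℝ) (hq4 : IsPMF q4)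
    (h4 : ∀ w, ∑ a, ∑ b, ∑ y, q4 (a, b, w, y) = qW w)
    (hκ : 0 < κ)
    (e1 : (Fin (m + 1) → X1) → Fin κ × (Fin (m + 1) → V) → ℝ)
    (e2 : (Fin (m + 1) → X2) → U2 → ℝ)
    (dec : Fin κ × (Fin (m + 1) → V) → U2 → (Fin (m + 1) → Wa) → (Fin (m + 1) → Ya) → ℝ)
    (he1 : IsKernel e1) (he2 : IsKernel e2) (hdec : ∀ u1 u2, IsKernel (dec u1 u2))
    (g : V → Y) (hg : Function.Injective g)
    (δ : ℝ) (hδ : 0 < δ) (hδ1 : δ ≤ 1)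
    (htv : ∑ x1, ∑ x2, ∑ w, ∑ y, |mQ (qn q3 (m + 1)) e1 e2 dec x1 x2 w y -
      ∏ j, q4 (x1 j, x2 j, w j, y j)| ≤ δ) :
    ∑ i : Fin (m + 1), ∑ v : Fin m → Wa, (∏ j, qW (v j)) *
      cQ q3 (kIns c1 e1 i v) (fun u => g (u.2 i)) (kIns c2 e2 i v) (yIns dec i v) ≤
    Real.log κ + ((m : ℝ) + 1) * (2 * (2 * δ +
      δ * Real.log (Fintype.card (X1 × X2 × Wa × Ya)) + Real.negMulLog δ)) := by
  set A : ℝ := (Fintype.card (X1 × X2 × Wa × Ya) : ℝ) with hA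
  have hq41 : ∀ z, q4 z ≤ 1 := fun z => by
    rw [← hq4.2]
    exact Finset.single_le_sum (fun i _ => hq4.1 i) (Finset.mem_univ z)
  have hA1 : 1 ≤ A := by
    have : Nonempty (X1 × X2 × Wa × Ya) := by
      by_contra h
      rw [not_nonempty_iff] at h
      have := hq4.2
      simp at this
    rw [hA]
    exact_mod_cast Fintype.card_pos
  set μ := muC q3 e1 e2 dec with hμd
  have hμ : IsPMF μ := muC_pmf q3 hq3 e1 e2 dec he1 he2 hdec
  have hb := block_c hμ (fun ω j => (ω.1 j, ω.2.2.2.2 j)) (fun ω => ω.2.1) (fun ω => ω.2.2.1)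
    (fun ω => ω.2.2.2.1.1) (fun ω => ω.2.2.2.1.2)
  have hK : Hn μ (fun ω => ω.2.2.2.1.1) ≤ Real.log κ :=
    Hn_le_log_card hμ _ (by positivity) (by simp)
  have h1 := fun i => muC_Hc qW c1 c2 q3 hq e1 e2 dec i
  have h2 := fun i => muC_Hc_U qW c1 c2 q3 hq e1 e2 dec i
  have h3 : ∀ i, Hc μ (fun ω => ω.2.2.2.1.2 i) (fun ω => ω.2.2.1) =
      ∑ v : Fin m → Wa, (∏ j, qW (v j)) * HYq (m1 q3) (kIns c1 e1 i v) (fun u => g (u.2 i)) := by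
    intro i
    rw [← muC_HV qW c1 c2 hc2 q3 hq e1 e2 dec he2 hdec i (fun u => g (u.2 i))]
    exact (Hc_inj_left μ (fun ω => ω.2.2.2.1.2 i) (fun ω => ω.2.2.1) g hg).symm
  have hS : ∑ i : Fin (m + 1), ∑ v : Fin m → Wa, (∏ j, qW (v j)) *
      cQ q3 (kIns c1 e1 i v) (fun u => g (u.2 i)) (kIns c2 e2 i v) (yIns dec i v) =
      ∑ i, Hc μ (fun ω => (ω.1 i, ω.2.2.2.2 i)) (fun ω => (ω.2.1 i, ω.2.2.1)) -
      ∑ i, Hc μ (fun ω => (ω.1 i, ω.2.2.2.2 i)) (fun ω => ((ω.2.1 i, ω.2.2.1), ω.2.2.2.1)) -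
      ∑ i, Hc μ (fun ω => ω.2.2.2.1.2 i) (fun ω => ω.2.2.1) := by
    simp_rw [h3]
    rw [hμd]
    simp_rw [h1, h2]
    unfold cQ
    simp only [mul_sub, Finset.sum_sub_distrib]
  rw [hS]
  -- entropy continuity part
  have hZ : ∀ i, Hc μ (fun ω => (ω.1 i, ω.2.2.2.2 i)) (fun ω => (ω.2.1 i, ω.2.2.1)) ≤
      Hc μ (fun ω => (ω.1 i, ω.2.2.2.2 i)) (fun ω => (ω.2.1 i, ω.2.2.1 i)) := fun i =>
    Hc_comp_le hμ.1 (fun ω => (ω.1 i, ω.2.2.2.2 i)) (fun ω => (ω.2.1 i, ω.2.2.1))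
      (fun p => (p.1, p.2 i))
  have hZs := Finset.sum_le_sum (s := Finset.univ) fun i _ => hZ i
  have hpi := Hn_pi_le hμ (fun ω j => (ω.2.1 j, ω.2.2.1 j))
  have hpi2 : Hn μ (fun ω j => (ω.2.1 j, ω.2.2.1 j)) = Hn μ (fun ω => (ω.2.1, ω.2.2.1)) := by
    exact Hn_comp_inj μ (fun ω => (ω.2.1, ω.2.2.1)) (fun p j => (p.1 j, p.2 j)) (fun p q h => by
      have := fun j => congrFun h j
      simp only [Prod.mk.injEq] at this
      exact Prod.ext (funext fun j => (this j).1) (funext fun j => (this j).2))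
  rw [hpi2] at hpi
  -- law of the whole block
  have hfull : Hn μ (fun ω => ((fun j => (ω.1 j, ω.2.2.2.2 j) : Fin (m+1) → X1 × Ya),
      (ω.2.1, ω.2.2.1))) = Hn μ (fun ω => (ω.1, ω.2.1, ω.2.2.1, ω.2.2.2.2)) := by
    exact Hn_comp_inj μ (fun ω => (ω.1, ω.2.1, ω.2.2.1, ω.2.2.2.2))
      (fun p => ((fun j => (p.1 j, p.2.2.2 j) : Fin (m+1) → X1 × Ya), (p.2.1, p.2.2.1)))
      (fun p q h => by
        simp only [Prod.mk.injEq] at h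
        have h1 := fun j => congrFun h.1 j
        simp only [Prod.mk.injEq] at h1
        exact Prod.ext (funext fun j => (h1 j).1) (Prod.ext h.2.1 (Prod.ext h.2.2
          (funext fun j => (h1 j).2))))
  have hlaw : ∀ x1 x2 w y, rvDist μ (fun ω => (ω.1, ω.2.1, ω.2.2.1, ω.2.2.2.2)) (x1, x2, w, y) =
      mQ (qn q3 (m + 1)) e1 e2 dec x1 x2 w y := by
    intro x1 x2 w y
    rw [hμd]
    unfold rvDist muC mQ
    simp only [Fintype.sum_prod_type, Prod.mk.injEq, ite_and, Finset.sum_ite_eq', Finset.mem_univ,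
      if_true, Finset.sum_ite_irrel, Finset.sum_const_zero]
  have hblk := ent_tv (fun z : (Fin (m+1) → X1) × (Fin (m+1) → X2) × (Fin (m+1) → Wa) ×
      (Fin (m+1) → Ya) => rvDist μ (fun ω => (ω.1, ω.2.1, ω.2.2.1, ω.2.2.2.2)) z)
    (fun z => ∏ j, q4 (z.1 j, z.2.1 j, z.2.2.1 j, z.2.2.2 j))
    (fun z => rvDist_nonneg hμ.1 _ _)
    (fun z => by
      have := rvDist_sum μ (fun ω => (ω.1, ω.2.1, ω.2.2.1, ω.2.2.2.2))
      rw [hμ.2] at this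
      rw [← this]
      exact Finset.single_le_sum (f := fun z => rvDist μ (fun ω => (ω.1, ω.2.1, ω.2.2.1, ω.2.2.2.2)) z) (fun i _ => rvDist_nonneg hμ.1 _ _) (Finset.mem_univ z))
    (fun z => Finset.prod_nonneg fun j _ => hq4.1 _) δ (A ^ (m + 1)) hδ hδ1
    (by
      rw [hA]
      simp only [Fintype.card_prod, Fintype.card_fun, Fintype.card_fin]
      push_cast
      ring)
    (one_le_pow₀ hA1)
    (by
      simp only [Fintype.sum_prod_type, hlaw]
      exact htv)
  have hiid : ∑ z : (Fin (m+1) → X1) × (Fin (m+1) → X2) × (Fin (m+1) → Wa) ×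
      (Fin (m+1) → Ya), Real.negMulLog (∏ j, q4 (z.1 j, z.2.1 j, z.2.2.1 j, z.2.2.2 j)) =
      ((m : ℝ) + 1) * ∑ z, Real.negMulLog (q4 z) := by
    have := ent_iid q4 hq4.2 (m + 1)
    push_cast at this
    rw [← this]
    let E : (Fin (m+1) → X1 × X2 × Wa × Ya) ≃ (Fin (m+1) → X1) × (Fin (m+1) → X2) × (Fin (m+1) → Wa) ×
      (Fin (m+1) → Ya) :=
      { toFun := fun z => (fun j => (z j).1, fun j => (z j).2.1, fun j => (z j).2.2.1, fun j => (z j).2.2.2)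
        invFun := fun z j => (z.1 j, z.2.1 j, z.2.2.1 j, z.2.2.2 j)
        left_inv := fun z => rfl
        right_inv := fun z => rfl }
    exact (E.sum_comp (fun z => Real.negMulLog (∏ j, q4 (z.1 j, z.2.1 j, z.2.2.1 j, z.2.2.2 j)))).symm
  -- single letters
  have hsingle : ∀ i, Hn μ (fun ω => ((ω.1 i, ω.2.2.2.2 i), (ω.2.1 i, ω.2.2.1 i))) ≤
      ∑ z, Real.negMulLog (q4 z) + (2 * δ + δ * Real.log A + Real.negMulLog δ) := by
    intro i
    have hp : Hn μ (fun ω => ((ω.1 i, ω.2.2.2.2 i), (ω.2.1 i, ω.2.2.1 i))) =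
        Hn μ (fun ω => (ω.1 i, ω.2.1 i, ω.2.2.1 i, ω.2.2.2.2 i)) :=
      Hn_comp_inj μ (fun ω => (ω.1 i, ω.2.1 i, ω.2.2.1 i, ω.2.2.2.2 i))
        (fun p => ((p.1, p.2.2.2), (p.2.1, p.2.2.1))) (fun p q h => by
          simp only [Prod.mk.injEq] at h
          exact Prod.ext h.1.1 (Prod.ext h.2.1 (Prod.ext h.2.2 h.1.2)))
    have hl : ∀ a b w y, rvDist μ (fun ω => (ω.1 i, ω.2.1 i, ω.2.2.1 i, ω.2.2.2.2 i)) (a, b, w, y) =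
        ∑ v : Fin m → Wa, (∏ j, qW (v j)) *
          mQ q3 (kIns c1 e1 i v) (kIns c2 e2 i v) (yIns dec i v) a b w y := by
      intro a b w y
      have := rvDist_comp μ (fun ω => ((ω.1 i, ω.2.2.2.2 i), (ω.2.1 i, ω.2.2.1)))
        (fun p => (p.1.1, p.2.1, p.2.2 i, p.1.2)) (a, b, w, y)
      simp only at this
      rw [this]
      simp_rw [← muC_marg' qW c1 c2 q3 hq e1 e2 dec]
      rw [← sum_ins_ite i w (fun wn => rvDist (muC q3 e1 e2 dec)
        (fun ω => ((ω.1 i, ω.2.2.2.2 i), (ω.2.1 i, ω.2.2.1))) ((a, y), (b, wn)))]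
      simp only [Fintype.sum_prod_type, Prod.mk.injEq]
      rw [Finset.sum_eq_single a, Finset.sum_eq_single y, Finset.sum_eq_single b]
      · refine Finset.sum_congr rfl fun wn _ => ?_
        simp [hμd]
      · intro b' _ hb'
        simp [hb']
      · simp
      · intro b' _ hb'
        simp [hb']
      · simp
      · intro b' _ hb'
        simp [hb']
      · simp
    have htvi : ∑ z, |q4 z - rvDist μ (fun ω => (ω.1 i, ω.2.1 i, ω.2.2.1 i, ω.2.2.2.2 i)) z| ≤ δ := by
      refine le_trans ?_ ((code_tv qW hqW.1 c1 c2 q3 hq q4 h4 e1 e2 dec i).trans htv)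
      simp only [Fintype.sum_prod_type, hl]
      unfold TVq
      have hR : ∑ v : Fin m → Wa, (∏ j, qW (v j)) * ∑ a, ∑ b, ∑ w, ∑ y,
          |mQ q3 (kIns c1 e1 i v) (kIns c2 e2 i v) (yIns dec i v) a b w y - q4 (a, b, w, y)| =
          ∑ a, ∑ b, ∑ w, ∑ y, ∑ v : Fin m → Wa, (∏ j, qW (v j)) *
          |mQ q3 (kIns c1 e1 i v) (kIns c2 e2 i v) (yIns dec i v) a b w y - q4 (a, b, w, y)| := by
        simp only [Finset.mul_sum]
        rw [Finset.sum_comm]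
        refine Finset.sum_congr rfl fun a _ => ?_
        rw [Finset.sum_comm]
        refine Finset.sum_congr rfl fun b _ => ?_
        rw [Finset.sum_comm]
        refine Finset.sum_congr rfl fun w _ => ?_
        rw [Finset.sum_comm]
      rw [hR]
      refine Finset.sum_le_sum fun a _ => Finset.sum_le_sum fun b _ => Finset.sum_le_sum fun w _ =>
        Finset.sum_le_sum fun y _ => ?_
      have hone : q4 (a, b, w, y) = ∑ v : Fin m → Wa, (∏ j, qW (v j)) * q4 (a, b, w, y) := by
        rw [← Finset.sum_mul, sumQW qW hqW.2, one_mul]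
      rw [hone, ← Finset.sum_sub_distrib]
      refine (Finset.abs_sum_le_sum_abs _ _).trans (Finset.sum_le_sum fun v _ => le_of_eq ?_)
      rw [← hone, ← mul_sub, abs_mul, abs_of_nonneg (Finset.prod_nonneg fun j _ => hqW.1 _),
        abs_sub_comm]
    have := ent_tv q4 (fun z => rvDist μ (fun ω => (ω.1 i, ω.2.1 i, ω.2.2.1 i, ω.2.2.2.2 i)) z)
      hq4.1 hq41 (fun z => rvDist_nonneg hμ.1 _ _) δ A hδ hδ1 hA.symm hA1 htvi
    rw [hp]
    unfold Hn
    linarith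
  have hsum := Finset.sum_le_sum (s := Finset.univ) fun i _ => hsingle i
  simp only [Finset.sum_const, Finset.card_univ, Fintype.card_fin, nsmul_eq_mul] at hsum
  push_cast at hsum
  have hc1 : ∑ i, Hc μ (fun ω => (ω.1 i, ω.2.2.2.2 i)) (fun ω => (ω.2.1 i, ω.2.2.1 i)) =
      ∑ i, Hn μ (fun ω => ((ω.1 i, ω.2.2.2.2 i), (ω.2.1 i, ω.2.2.1 i))) -
      ∑ i, Hn μ (fun ω => (ω.2.1 i, ω.2.2.1 i)) := by
    unfold Hc
    rw [Finset.sum_sub_distrib]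
  have hc2' : Hc μ (fun ω j => (ω.1 j, ω.2.2.2.2 j)) (fun ω => (ω.2.1, ω.2.2.1)) =
      Hn μ (fun ω => (ω.1, ω.2.1, ω.2.2.1, ω.2.2.2.2)) - Hn μ (fun ω => (ω.2.1, ω.2.2.1)) := by
    rw [← hfull]
    rfl
  rw [hiid] at hblk
  have hblk' : ((m : ℝ) + 1) * ∑ z, Real.negMulLog (q4 z) -
      Hn μ (fun ω => (ω.1, ω.2.1, ω.2.2.1, ω.2.2.2.2)) ≤
      2 * δ + δ * Real.log (A ^ (m + 1)) + Real.negMulLog δ := hblk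
  rw [Real.log_pow] at hblk'
  push_cast at hblk'
  have hnm : 0 ≤ Real.negMulLog δ := Real.negMulLog_nonneg hδ.le hδ1
  have herr : 2 * δ + δ * (((m : ℝ) + 1) * Real.log A) + Real.negMulLog δ ≤
      ((m : ℝ) + 1) * (2 * δ + δ * Real.log A + Real.negMulLog δ) := by
    have hm0 : (0 : ℝ) ≤ m := by positivity
    nlinarith [mul_nonneg hm0 hnm, mul_nonneg hm0 hδ.le]
  rw [hc2'] at hb
  have hb' : Hn μ (fun ω => (ω.1, ω.2.1, ω.2.2.1, ω.2.2.2.2)) - Hn μ (fun ω => (ω.2.1, ω.2.2.1)) ≤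
     Hn μ (fun ω => ω.2.2.2.1.1) + ∑ i, Hc μ (fun ω => ω.2.2.2.1.2 i) (fun ω => ω.2.2.1) +
     ∑ i, Hc μ (fun ω => (ω.1 i, ω.2.2.2.2 i)) (fun ω => ((ω.2.1 i, ω.2.2.1), ω.2.2.2.1)) := hb
  rw [hc1] at hZs
  linarith

end codeC

end

noncomputable section

set_option linter.unusedSectionVars false
set_option linter.unusedSimpArgs false

/-! ### From codes to single-letter schemes -/

section enc
variable {X Xt Yt : Type*} [Fintype X] [Fintype Xt] [Fintype Yt]
  [DecidableEq X] [DecidableEq Xt] [DecidableEq Yt] {n κ : ℕ}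

/-- Effective encoder seen through the deterministic link. -/
def eEnc (f : Xt → Yt) (E : (Fin n → X) × Fin κ → (Fin n → Xt) → ℝ) (x : Fin n → X)
    (u : Fin κ × (Fin n → Set.range f)) : ℝ :=
  (κ : ℝ)⁻¹ * ∑ xt : Fin n → Xt,
    if (fun i => Set.rangeFactorization f (xt i)) = u.2 then E (x, u.1) xt else 0

lemma eEnc_nonneg (f : Xt → Yt) (E : (Fin n → X) × Fin κ → (Fin n → Xt) → ℝ) (hE : IsKernel E)
    (x : Fin n → X) (u : Fin κ × (Fin n → Set.range f)) : 0 ≤ eEnc f E x u := by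
  refine mul_nonneg (by positivity) (Finset.sum_nonneg fun xt _ => ?_)
  split_ifs
  · exact (hE _).1 _
  · exact le_rfl

lemma eEnc_sum (f : Xt → Yt) (E : (Fin n → X) × Fin κ → (Fin n → Xt) → ℝ)
    (x : Fin n → X) (k : Fin κ) (Φ : (Fin n → Set.range f) → ℝ) :
    ∑ v, eEnc f E x (k, v) * Φ v = (κ : ℝ)⁻¹ * ∑ xt, E (x, k) xt *
      Φ (fun i => Set.rangeFactorization f (xt i)) := by
  unfold eEnc
  simp only [mul_assoc, ← Finset.mul_sum]
  congr 1
  simp only [Finset.sum_mul]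
  rw [Finset.sum_comm]
  refine Finset.sum_congr rfl fun xt _ => ?_
  simp only [ite_mul, zero_mul, Finset.sum_ite_eq, Finset.mem_univ, if_true]

lemma eEnc_sum1 (f : Xt → Yt) (E : (Fin n → X) × Fin κ → (Fin n → Xt) → ℝ) (hE : IsKernel E)
    (x : Fin n → X) (k : Fin κ) : ∑ v, eEnc f E x (k, v) = (κ : ℝ)⁻¹ := by
  have := eEnc_sum f E x k (fun _ => 1)
  simpa [(hE _).2] using this

lemma eEnc_kernel (f : Xt → Yt) (E : (Fin n → X) × Fin κ → (Fin n → Xt) → ℝ) (hE : IsKernel E)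
    (hκ : 0 < κ) : IsKernel (eEnc f E) := fun x => ⟨eEnc_nonneg f E hE x, by
  have hκ' : (κ : ℝ) ≠ 0 := by positivity
  rw [Fintype.sum_prod_type]
  simp [eEnc_sum1 f E hE, hκ']⟩

lemma eEnc_ind (f : Xt → Yt) (E : (Fin n → X) × Fin κ → (Fin n → Xt) → ℝ) (hE : IsKernel E)
    (h : Subsingleton Yt) (x : Fin n → X) (u : Fin κ × (Fin n → Set.range f)) :
    eEnc f E x u = (κ : ℝ)⁻¹ := by
  unfold eEnc
  have : ∀ xt : Fin n → Xt, (fun i => Set.rangeFactorization f (xt i)) = u.2 := by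
    intro xt
    exact Subsingleton.elim _ _
  simp [this, (hE _).2]

end enc

/-- Effective decoder. -/
def decE {Wa Xt1 Xt2 Yt1 Yt2 Ya : Type*} {n κ1 κ2 : ℕ} (f1 : Xt1 → Yt1) (f2 : Xt2 → Yt2)
    (D : Fin κ1 × Fin κ2 × (Fin n → Wa) × (Fin n → Yt1 × Yt2) → (Fin n → Ya) → ℝ)
    (u1 : Fin κ1 × (Fin n → Set.range f1)) (u2 : Fin κ2 × (Fin n → Set.range f2))
    (w : Fin n → Wa) (y : Fin n → Ya) : ℝ :=
  D (u1.1, u2.1, w, fun i => ((u1.2 i).1, (u2.2 i).1)) y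

lemma induced_eq {X1 X2 Wa Xt1 Xt2 Yt1 Yt2 Ya : Type*}
    [Fintype X1] [Fintype X2] [Fintype Wa] [Fintype Xt1] [Fintype Xt2]
    [Fintype Yt1] [Fintype Yt2] [Fintype Ya]
    [DecidableEq X1] [DecidableEq X2] [DecidableEq Wa] [DecidableEq Xt1] [DecidableEq Xt2]
    [DecidableEq Yt1] [DecidableEq Yt2] [DecidableEq Ya]
    (f1 : Xt1 → Yt1) (f2 : Xt2 → Yt2) (q3 : X1 × X2 × Wa → ℝ) {n κ1 κ2 : ℕ}
    (E2 : (Fin n → X2) × Fin κ2 → (Fin n → Xt2) → ℝ)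
    (E1 : (Fin n → X1) × Fin κ1 → (Fin n → Xt1) → ℝ)
    (D : Fin κ1 × Fin κ2 × (Fin n → Wa) × (Fin n → Yt1 × Yt2) → (Fin n → Ya) → ℝ)
    (x1 : Fin n → X1) (x2 : Fin n → X2) (w : Fin n → Wa) (y : Fin n → Ya) :
    inducedNoCrib q3 (detCh f1 f2) E2 E1 D (x1, x2, w, y) =
      mQ (qn q3 n) (eEnc f1 E1) (eEnc f2 E2) (decE f1 f2 D) x1 x2 w y := by
  unfold inducedNoCrib mQ JJ DD decE
  simp only [Fintype.sum_prod_type]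
  refine Finset.sum_congr rfl fun k1 _ => ?_
  simp only [mul_assoc]
  rw [← Finset.mul_sum]
  rw [eEnc_sum f1 E1 x1 k1 (fun v1 => ∑ k2, ∑ v2, eEnc f2 E2 x2 (k2, v2) *
    D (k1, k2, w, fun i => ((v1 i).1, (v2 i).1)) y)]
  have h1 : ∀ (v1 : Fin n → Set.range f1) k2, ∑ v2, eEnc f2 E2 x2 (k2, v2) *
      D (k1, k2, w, fun i => ((v1 i).1, (v2 i).1)) y = (κ2 : ℝ)⁻¹ * ∑ xt2, E2 (x2, k2) xt2 *
      D (k1, k2, w, fun i => ((v1 i).1, f2 (xt2 i))) y := fun v1 k2 =>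
    eEnc_sum f2 E2 x2 k2 (fun v2 => D (k1, k2, w, fun i => ((v1 i).1, (v2 i).1)) y)
  simp only [h1]
  have h2 : ∀ k2 (xt1 : Fin n → Xt1) (xt2 : Fin n → Xt2), ∑ yt : Fin n → Yt1 × Yt2,
      (∏ i, detCh f1 f2 (xt1 i, xt2 i) (yt i)) * D (k1, k2, w, yt) y =
      D (k1, k2, w, fun i => (f1 (xt1 i), f2 (xt2 i))) y := by
    intro k2 xt1 xt2
    have h3 : ∀ yt : Fin n → Yt1 × Yt2, (∏ i, detCh f1 f2 (xt1 i, xt2 i) (yt i)) =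
        if yt = (fun i => (f1 (xt1 i), f2 (xt2 i))) then 1 else 0 := by
      intro yt
      unfold detCh
      rw [Finset.prod_ite_zero]
      simp only [Finset.mem_univ, true_implies, Finset.prod_const_one, funext_iff]
    simp [h3]
  simp only [← Finset.mul_sum, h2]
  rw [Finset.sum_comm]
  unfold qn
  simp only [Finset.mul_sum, Set.rangeFactorization_coe]
  refine Finset.sum_congr rfl fun xt1 _ => Finset.sum_congr rfl fun k2 _ =>
    Finset.sum_congr rfl fun xt2 _ => ?_
  rw [mul_inv]
  ring

/-- A single-letter scheme with auxiliary alphabets `Fin N1`, `Fin N2`. -/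
structure Sch (X1 X2 Wa Xt1 Xt2 Ya : Type*) [Fintype Ya] (N1 N2 : ℕ) where
  k1 : X1 → Fin N1 → ℝ
  h1 : Fin N1 → Xt1
  k2 : X2 → Fin N2 → ℝ
  h2 : Fin N2 → Xt2
  kY : Fin N1 → Fin N2 → Wa → Ya → ℝ
  hk1 : IsKernel k1
  hk2 : IsKernel k2
  hkY : ∀ u1 u2, IsKernel (kY u1 u2)

section red
variable {X1 X2 Wa Xt1 Xt2 Yt1 Yt2 Ya : Type*}
    [Fintype X1] [Fintype X2] [Fintype Wa] [Fintype Xt1] [Fintype Xt2]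
    [Fintype Yt1] [Fintype Yt2] [Fintype Ya]
    [DecidableEq X1] [DecidableEq X2] [DecidableEq Wa] [DecidableEq Xt1] [DecidableEq Xt2]
    [DecidableEq Yt1] [DecidableEq Yt2] [DecidableEq Ya]

lemma t_red {U1 U2 : Type*} [Fintype U1] [Fintype U2]
    [Nonempty X1] [Nonempty X2] [Nonempty Wa] [Nonempty Xt1] [Nonempty Xt2] [Nonempty Ya]
    (f1 : Xt1 → Yt1) (f2 : Xt2 → Yt2) (q3 : X1 × X2 × Wa → ℝ)
    (k1 : X1 → U1 → ℝ) (h1 : U1 → Xt1) (k2 : X2 → U2 → ℝ) (h2 : U2 → Xt2)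
    (kY : U1 → U2 → Wa → Ya → ℝ)
    (hk1 : IsKernel k1) (hk2 : IsKernel k2) (hkY : ∀ u1 u2, IsKernel (kY u1 u2))
    (hind : Subsingleton Yt1 → ∀ x x' u, k1 x u = k1 x' u) (N1 N2 : ℕ)
    (hN1 : N1 = Fintype.card X1 * Fintype.card X2 * Fintype.card Wa * Fintype.card Xt1 *
        Fintype.card Xt2 * (Fintype.card Yt1 * Fintype.card Yt2) * Fintype.card Ya)
    (hN2 : N2 = N1 * Fintype.card X1 * Fintype.card X2 * Fintype.card Wa * Fintype.card Xt1 *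
        Fintype.card Xt2 * (Fintype.card Yt1 * Fintype.card Yt2) * Fintype.card Ya) :
    ∃ s : Sch X1 X2 Wa Xt1 Xt2 Ya N1 N2,
      aQ (m1 q3) k1 (fun u => f1 (h1 u)) ≤ aQ (m1 q3) s.k1 (fun u => f1 (s.h1 u)) ∧
      aQ (m2 q3) k2 (fun u => f2 (h2 u)) ≤ aQ (m2 q3) s.k2 (fun u => f2 (s.h2 u)) ∧
      cQ q3 s.k1 (fun u => f1 (s.h1 u)) s.k2 s.kY ≤ cQ q3 k1 (fun u => f1 (h1 u)) k2 kY ∧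
      mQ q3 s.k1 s.k2 s.kY = mQ q3 k1 k2 kY := by
  have hY1 : Nonempty Yt1 := ⟨f1 (Classical.arbitrary _)⟩
  have hY2 : Nonempty Yt2 := ⟨f2 (Classical.arbitrary _)⟩
  have p1 : 0 < Fintype.card X1 := Fintype.card_pos
  have p2 : 0 < Fintype.card X2 := Fintype.card_pos
  have p3 : 0 < Fintype.card Wa := Fintype.card_pos
  have p4 : 0 < Fintype.card Xt1 := Fintype.card_pos
  have p5 : 0 < Fintype.card Xt2 := Fintype.card_pos
  have p6 : 0 < Fintype.card Yt1 := Fintype.card_pos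
  have p7 : 0 < Fintype.card Yt2 := Fintype.card_pos
  have p8 : 0 < Fintype.card Ya := Fintype.card_pos
  have e1 : N1 = Fintype.card (X1 × X2 × Wa × Xt1 × Ya) * (Fintype.card Xt2 * Fintype.card Yt2) *
      Fintype.card Yt1 := by
    rw [hN1]; simp only [Fintype.card_prod]; ring
  have c1 : Fintype.card (X1 × X2 × Wa × Xt1 × Ya) ≤ Fintype.card (X1 × X2 × Wa × Xt1 × Ya) *
      (Fintype.card Xt2 * Fintype.card Yt2) := Nat.le_mul_of_pos_right _ (by positivity)
  have cpos : 0 < Fintype.card (X1 × X2 × Wa × Xt1 × Ya) := Fintype.card_pos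
  have hN1pos : 0 < N1 := by rw [hN1]; positivity
  obtain ⟨k1', h1', kY', hk1', hkY', -, ha, hc, hm⟩ := U1_red q3 f1 k1 h1 k2 kY hk1 hk2 hkY hind N1
    (by rw [e1]; exact c1.trans (Nat.le_mul_of_pos_right _ p6))
    (by
      intro hs
      rw [not_subsingleton_iff_nontrivial] at hs
      have : 2 ≤ Fintype.card Yt1 := Fintype.one_lt_card
      rw [e1]
      nlinarith)
  have : Nonempty (Fin N1) := ⟨⟨0, hN1pos⟩⟩
  obtain ⟨k2', h2', kY'', hk2', hkY'', ha2, hc2, hm2⟩ := U2_red q3 f2 k1' (fun u => f1 (h1' u)) h2 k2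
    kY' hk2 hkY' N2
    (by
      rw [hN2]
      have : N1 * Fintype.card X1 * Fintype.card X2 * Fintype.card Wa * Fintype.card Xt1 *
        Fintype.card Xt2 * (Fintype.card Yt1 * Fintype.card Yt2) * Fintype.card Ya =
        Fintype.card (Fin N1 × X2 × Wa × Xt2 × Ya) * (Fintype.card X1 * Fintype.card Xt1 *
         (Fintype.card Yt1 * Fintype.card Yt2)) := by
        simp only [Fintype.card_prod, Fintype.card_fin]; ring
      rw [this]
      exact Nat.le_mul_of_pos_right _ (by positivity))
  refine ⟨⟨k1', h1', k2', h2', kY'', hk1', hk2', hkY''⟩, ha.ge, ha2, ?_, ?_⟩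
  · simp only
    rw [hc2]
    exact hc
  · funext x1 x2 w y
    simp only
    rw [hm2, hm]

lemma code_to_sch [Nonempty X1] [Nonempty X2] [Nonempty Wa] [Nonempty Xt1] [Nonempty Xt2] [Nonempty Ya]
    (f1 : Xt1 → Yt1) (f2 : Xt2 → Yt2) (q3 : X1 × X2 × Wa → ℝ) (hq3 : IsPMF q3)
    (qW : Wa → ℝ) (hqW : IsPMF qW)
    (c1 : Wa → X1 → ℝ) (c2 : Wa → X2 → ℝ) (hc1 : IsKernel c1) (hc2 : IsKernel c2)
    (hq : ∀ x1 x2 w, q3 (x1, x2, w) = qW w * c1 w x1 * c2 w x2)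
    (q4 : X1 × X2 × Wa × Ya → ℝ) (hq4 : IsPMF q4)
    (h4 : ∀ w, ∑ a, ∑ b, ∑ y, q4 (a, b, w, y) = qW w) {m κ1 κ2 : ℕ} (hκ1 : 0 < κ1) (hκ2 : 0 < κ2)
    (E2 : (Fin (m + 1) → X2) × Fin κ2 → (Fin (m + 1) → Xt2) → ℝ)
    (E1 : (Fin (m + 1) → X1) × Fin κ1 → (Fin (m + 1) → Xt1) → ℝ)
    (D : Fin κ1 × Fin κ2 × (Fin (m + 1) → Wa) × (Fin (m + 1) → Yt1 × Yt2) → (Fin (m + 1) → Ya) → ℝ)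
    (hE2 : IsKernel E2) (hE1 : IsKernel E1) (hD : IsKernel D)
    (δ : ℝ) (hδ : 0 < δ) (hδ1 : δ ≤ 1)
    (htv : tvIID q4 (inducedNoCrib q3 (detCh f1 f2) E2 E1 D) ≤ δ) (N1 N2 : ℕ)
    (hN1 : N1 = Fintype.card X1 * Fintype.card X2 * Fintype.card Wa * Fintype.card Xt1 *
        Fintype.card Xt2 * (Fintype.card Yt1 * Fintype.card Yt2) * Fintype.card Ya)
    (hN2 : N2 = N1 * Fintype.card X1 * Fintype.card X2 * Fintype.card Wa * Fintype.card Xt1 *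
        Fintype.card Xt2 * (Fintype.card Yt1 * Fintype.card Yt2) * Fintype.card Ya) :
    ∃ (p : Fin (m + 1) × (Fin m → Wa) → ℝ)
      (s : Fin (m + 1) × (Fin m → Wa) → Sch X1 X2 Wa Xt1 Xt2 Ya N1 N2),
      IsPMF p ∧
      0 ≤ ∑ t, p t * aQ (m1 q3) (s t).k1 (fun u => f1 ((s t).h1 u)) ∧
      0 ≤ ∑ t, p t * aQ (m2 q3) (s t).k2 (fun u => f2 ((s t).h2 u)) ∧
      ∑ t, p t * cQ q3 (s t).k1 (fun u => f1 ((s t).h1 u)) (s t).k2 (s t).kY ≤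
        Real.log κ1 / ((m : ℝ) + 1) + (2 * (2 * δ +
      δ * Real.log (Fintype.card (X1 × X2 × Wa × Ya)) + Real.negMulLog δ)) ∧
      ∑ t, p t * TVq q4 (mQ q3 (s t).k1 (s t).k2 (s t).kY) ≤ δ := by
  set e1 := eEnc f1 E1 with he1
  set e2 := eEnc f2 E2 with he2
  set dec := decE f1 f2 D with hdecd
  have he1k : IsKernel e1 := eEnc_kernel f1 E1 hE1 hκ1
  have he2k : IsKernel e2 := eEnc_kernel f2 E2 hE2 hκ2
  have hdec : ∀ u1 u2, IsKernel (dec u1 u2) := fun u1 u2 w => hD _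
  have htv' : ∑ x1, ∑ x2, ∑ w, ∑ y, |mQ (qn q3 (m + 1)) e1 e2 dec x1 x2 w y -
      ∏ j, q4 (x1 j, x2 j, w j, y j)| ≤ δ := by
    refine le_trans (le_of_eq ?_) htv
    unfold tvIID
    simp only [Fintype.sum_prod_type, induced_eq]
    rfl
  have hm1 : ∀ x w, m1 q3 x w = qW w * c1 w x := by
    intro x w
    unfold m1
    simp_rw [hq, ← Finset.mul_sum, (hc2 w).2, mul_one]
  have hm2 : ∀ x w, m2 q3 x w = qW w * c2 w x := by
    intro x w
    unfold m2
    simp_rw [hq, ← Finset.sum_mul, ← Finset.mul_sum, (hc1 w).2, mul_one]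
  -- deterministic sections of the links
  set ψ1 : Set.range f1 → Xt1 := fun v => v.2.choose with hψ1
  have hψ1' : ∀ v, f1 (ψ1 v) = v.1 := fun v => v.2.choose_spec
  set ψ2 : Set.range f2 → Xt2 := fun v => v.2.choose with hψ2
  have hψ2' : ∀ v, f2 (ψ2 v) = v.1 := fun v => v.2.choose_spec
  have hg1 : Function.Injective (fun v => f1 (ψ1 v)) := by
    simp only [hψ1']; exact Subtype.val_injective
  have hg2 : Function.Injective (fun v => f2 (ψ2 v)) := by
    simp only [hψ2']; exact Subtype.val_injective
  have A1 := code_a qW hqW c1 hc1 (m1 q3) hm1 hκ1 e1 (eEnc_nonneg f1 E1 hE1)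
    (eEnc_sum1 f1 E1 hE1) (fun v => f1 (ψ1 v)) hg1
  have A2 := code_a qW hqW c2 hc2 (m2 q3) hm2 hκ2 e2 (eEnc_nonneg f2 E2 hE2)
    (eEnc_sum1 f2 E2 hE2) (fun v => f2 (ψ2 v)) hg2
  have C := code_c qW hqW c1 c2 hc2 q3 hq3 hq q4 hq4 h4 hκ1 e1 e2 dec he1k he2k hdec
    (fun v => f1 (ψ1 v)) hg1 δ hδ hδ1 htv'
  have T := fun i => (code_tv qW hqW.1 c1 c2 q3 hq q4 h4 e1 e2 dec i).trans htv'
  have key := fun t : Fin (m + 1) × (Fin m → Wa) =>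
    t_red f1 f2 q3 (kIns c1 e1 t.1 t.2) (fun u => ψ1 (u.2 t.1)) (kIns c2 e2 t.1 t.2)
      (fun u => ψ2 (u.2 t.1)) (yIns dec t.1 t.2)
      (kIns_kernel c1 hc1 e1 he1k _ _) (kIns_kernel c2 hc2 e2 he2k _ _)
      (yIns_kernel dec hdec _ _)
      (by
        intro hs x x' u
        unfold kIns
        simp only [he1, eEnc_ind f1 E1 hE1 hs])
      N1 N2 hN1 hN2
  choose s hs1 hs2 hs3 hs4 using key
  have hm0 : (0 : ℝ) < (m : ℝ) + 1 := by positivity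
  set p : Fin (m + 1) × (Fin m → Wa) → ℝ := fun t => ((m : ℝ) + 1)⁻¹ * ∏ j, qW (t.2 j) with hp
  have hp0 : ∀ t, 0 ≤ p t := fun t => mul_nonneg (by positivity)
    (Finset.prod_nonneg fun j _ => hqW.1 _)
  have conv : ∀ F : Fin (m + 1) → (Fin m → Wa) → ℝ, ∑ t, p t * F t.1 t.2 =
      ((m : ℝ) + 1)⁻¹ * ∑ i, ∑ v, (∏ j, qW (v j)) * F i v := by
    intro F
    rw [Fintype.sum_prod_type]
    simp only [hp, Finset.mul_sum, mul_assoc]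
  refine ⟨p, s, ⟨hp0, ?_⟩, ?_, ?_, ?_, ?_⟩
  · have := conv (fun _ _ => 1)
    simp only [mul_one, sumQW qW hqW.2] at this
    rw [this]
    simp
    field_simp
  · refine le_trans ?_ (Finset.sum_le_sum fun t _ => mul_le_mul_of_nonneg_left (hs1 t) (hp0 t))
    rw [conv (fun i v => aQ (m1 q3) (kIns c1 e1 i v) (fun u => f1 (ψ1 (u.2 i))))]
    exact mul_nonneg (by positivity) A1
  · refine le_trans ?_ (Finset.sum_le_sum fun t _ => mul_le_mul_of_nonneg_left (hs2 t) (hp0 t))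
    rw [conv (fun i v => aQ (m2 q3) (kIns c2 e2 i v) (fun u => f2 (ψ2 (u.2 i))))]
    exact mul_nonneg (by positivity) A2
  · refine le_trans (Finset.sum_le_sum fun t _ => mul_le_mul_of_nonneg_left (hs3 t) (hp0 t)) ?_
    rw [conv (fun i v => cQ q3 (kIns c1 e1 i v) (fun u => f1 (ψ1 (u.2 i))) (kIns c2 e2 i v)
      (yIns dec i v))]
    refine (mul_le_mul_of_nonneg_left C (by positivity)).trans (le_of_eq ?_)
    field_simp
  · simp only [hs4]
    rw [conv (fun i v => TVq q4 (mQ q3 (kIns c1 e1 i v) (kIns c2 e2 i v) (yIns dec i v)))]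
    have := Finset.sum_le_sum (s := Finset.univ) fun i _ => T i
    simp only [Finset.sum_const, Finset.card_univ, Fintype.card_fin, nsmul_eq_mul] at this
    push_cast at this
    refine (mul_le_mul_of_nonneg_left this (by positivity)).trans (le_of_eq ?_)
    field_simp

end red

end

noncomputable section

set_option linter.unusedSectionVars false
set_option linter.unusedSimpArgs false

section comp
variable {X1 X2 Wa Xt1 Xt2 Yt1 Yt2 Ya : Type*}
    [Fintype X1] [Fintype X2] [Fintype Wa] [Fintype Xt1] [Fintype Xt2]
    [Fintype Yt1] [Fintype Yt2] [Fintype Ya]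
    [DecidableEq X1] [DecidableEq X2] [DecidableEq Wa] [DecidableEq Xt1] [DecidableEq Xt2]
    [DecidableEq Yt1] [DecidableEq Yt2] [DecidableEq Ya]

lemma exists_delta (A ε : ℝ) (hε : 0 < ε) : ∃ δ : ℝ, 0 < δ ∧ δ ≤ 1 ∧ δ ≤ ε ∧
    2 * (2 * δ + δ * A + Real.negMulLog δ) ≤ ε := by
  have hc : Continuous (fun δ : ℝ => 2 * (2 * δ + δ * A + Real.negMulLog δ)) := by
    have := Real.continuous_negMulLog
    fun_prop
  have h0 := hc.tendsto 0
  simp only [mul_zero, zero_mul, Real.negMulLog_zero, add_zero] at h0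
  have h1 := (h0.eventually (gt_mem_nhds hε))
  rw [Metric.eventually_nhds_iff] at h1
  obtain ⟨r, hr, h1⟩ := h1
  refine ⟨min (r / 2) (min 1 ε), by positivity, ?_, ?_, ?_⟩
  · exact (min_le_right _ _).trans (min_le_left _ _)
  · exact (min_le_right _ _).trans (min_le_right _ _)
  · refine (h1 ?_).le
    rw [Real.dist_eq, sub_zero, abs_of_pos (by positivity)]
    exact (min_le_left _ _).trans_lt (by linarith)

lemma four_red {ι : Type*} [Fintype ι] (p : ι → ℝ) (hp : IsPMF p) (a1 a2 c tv : ι → ℝ) :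
    ∃ (e : Fin 4 → ι) (l : Fin 4 → ℝ), IsPMF l ∧
      ∑ s, l s * a1 (e s) = ∑ i, p i * a1 i ∧ ∑ s, l s * a2 (e s) = ∑ i, p i * a2 i ∧
      ∑ s, l s * c (e s) = ∑ i, p i * c i ∧ ∑ s, l s * tv (e s) ≤ ∑ i, p i * tv i := by
  obtain ⟨e, l, hl, -, hg, hc⟩ := carath_fin (J := Fin 4)
    (fun i => ![1, a1 i, a2 i, c i]) (fun i => - tv i) (by
      intro v hv h
      have h0 := h 0
      simp only [Matrix.cons_val_zero, mul_one] at h0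
      rw [Finset.sum_eq_zero_iff_of_nonneg (fun i _ => hv i)] at h0
      exact Finset.sum_eq_zero fun i hi => by rw [h0 i hi, zero_mul]) p hp.1
    (by
      by_contra! hcon
      have := hp.2
      simp [hcon] at this) 4 (by simp)
  refine ⟨e, l, ⟨hl, ?_⟩, ?_, ?_, ?_, ?_⟩
  · have := hg 0
    simpa [hp.2] using this
  · simpa using hg 1
  · simpa using hg 2
  · simpa using hg 3
  · simp only [mul_neg, Finset.sum_neg_distrib] at hc
    linarith

lemma approx [Nonempty X1] [Nonempty X2] [Nonempty Wa] [Nonempty Xt1] [Nonempty Xt2] [Nonempty Ya]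
    (f1 : Xt1 → Yt1) (f2 : Xt2 → Yt2) (q3 : X1 × X2 × Wa → ℝ) (hq3 : IsPMF q3)
    (qW : Wa → ℝ) (hqW : IsPMF qW)
    (c1 : Wa → X1 → ℝ) (c2 : Wa → X2 → ℝ) (hc1 : IsKernel c1) (hc2 : IsKernel c2)
    (hq : ∀ x1 x2 w, q3 (x1, x2, w) = qW w * c1 w x1 * c2 w x2)
    (q4 : X1 × X2 × Wa × Ya → ℝ) (hq4 : IsPMF q4)
    (h4 : ∀ w, ∑ a, ∑ b, ∑ y, q4 (a, b, w, y) = qW w)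
    (R01 R02 : ℝ) (hach : AchievableNoCrib q3 (detCh f1 f2) q4 R01 R02) (N1 N2 : ℕ)
    (hN1 : N1 = Fintype.card X1 * Fintype.card X2 * Fintype.card Wa * Fintype.card Xt1 *
        Fintype.card Xt2 * (Fintype.card Yt1 * Fintype.card Yt2) * Fintype.card Ya)
    (hN2 : N2 = N1 * Fintype.card X1 * Fintype.card X2 * Fintype.card Wa * Fintype.card Xt1 *
        Fintype.card Xt2 * (Fintype.card Yt1 * Fintype.card Yt2) * Fintype.card Ya)
    (ε : ℝ) (hε : 0 < ε) :
    ∃ (p : Fin 4 → ℝ) (s : Fin 4 → Sch X1 X2 Wa Xt1 Xt2 Ya N1 N2),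
      IsPMF p ∧
      0 ≤ ∑ t, p t * aQ (m1 q3) (s t).k1 (fun u => f1 ((s t).h1 u)) ∧
      0 ≤ ∑ t, p t * aQ (m2 q3) (s t).k2 (fun u => f2 ((s t).h2 u)) ∧
      ∑ t, p t * cQ q3 (s t).k1 (fun u => f1 ((s t).h1 u)) (s t).k2 (s t).kY ≤
        R01 * Real.log 2 + ε ∧
      ∑ t, p t * TVq q4 (mQ q3 (s t).k1 (s t).k2 (s t).kY) ≤ ε := by
  obtain ⟨δ, hδ, hδ1, hδε, hδ2⟩ := exists_delta
    (Real.log (Fintype.card (X1 × X2 × Wa × Ya))) ε hε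
  obtain ⟨κ1, κ2, hκ1, hκ2, hR1, hR2, E2, E1, D, hE2, hE1, hD, htend⟩ := hach
  have hev := (htend.eventually (gt_mem_nhds hδ)).and (Filter.eventually_ge_atTop 1)
  obtain ⟨n, hn, hn1⟩ := hev.exists
  obtain ⟨m, rfl⟩ : ∃ m, n = m + 1 := ⟨n - 1, by omega⟩
  obtain ⟨p, s, hp, ha1, ha2, hc, htv⟩ := code_to_sch f1 f2 q3 hq3 qW hqW c1 c2 hc1 hc2 hq q4 hq4 h4
    (hκ1 (m + 1)) (hκ2 (m + 1)) (E2 (m + 1)) (E1 (m + 1)) (D (m + 1)) (hE2 _) (hE1 _) (hD _)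
    δ hδ hδ1 hn.le N1 N2 hN1 hN2
  obtain ⟨e, l, hl, h1, h2, h3, h5⟩ := four_red p hp
    (fun t => aQ (m1 q3) (s t).k1 (fun u => f1 ((s t).h1 u)))
    (fun t => aQ (m2 q3) (s t).k2 (fun u => f2 ((s t).h2 u)))
    (fun t => cQ q3 (s t).k1 (fun u => f1 ((s t).h1 u)) (s t).k2 (s t).kY)
    (fun t => TVq q4 (mQ q3 (s t).k1 (s t).k2 (s t).kY))
  have hlog : Real.log (κ1 (m + 1)) / ((m : ℝ) + 1) ≤ R01 * Real.log 2 := by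
    rw [div_le_iff₀ (by positivity)]
    have h := Real.log_le_log (by exact_mod_cast hκ1 (m + 1)) (hR1 (m + 1))
    rw [Real.log_rpow (by norm_num)] at h
    push_cast at h
    linarith
  refine ⟨l, fun t => s (e t), hl, ?_, ?_, ?_, ?_⟩
  · exact h1 ▸ ha1
  · exact h2 ▸ ha2
  · have : ∀ a b c : ℝ, a = b → b ≤ c → a ≤ c := fun a b c h h' => h ▸ h'
    refine this _ _ _ h3 (hc.trans ?_)
    linarith
  · exact h5.trans (htv.trans hδε)

/-- Space of kernel data. -/
abbrev Dat (X1 X2 Wa Ya : Type*) (N1 N2 : ℕ) : Type _ :=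
  (Fin 4 → ℝ) × (Fin 4 → X1 → Fin N1 → ℝ) × (Fin 4 → X2 → Fin N2 → ℝ) ×
    (Fin 4 → Fin N1 → Fin N2 → Wa → Ya → ℝ)

lemma CEf_continuous {Z α β : Type*} [TopologicalSpace Z] [Fintype α] [Fintype β]
    (f : Z → α → β → ℝ) (hf : ∀ a b, Continuous fun z => f z a b) :
    Continuous fun z => CEf (f z) := by
  unfold CEf
  refine continuous_finsetSum _ fun b _ => Continuous.sub
    (continuous_finsetSum _ fun a _ => Real.continuous_negMulLog.comp (hf a b)) ?_
  exact Real.continuous_negMulLog.comp (continuous_finsetSum _ fun a _ => hf a b)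

lemma HYq_continuous {Z X W U V : Type*} [TopologicalSpace Z] [Fintype X] [Fintype W] [Fintype U]
    [Fintype V] [DecidableEq V] (q : X → W → ℝ) (k : Z → X → U → ℝ)
    (hk : ∀ x u, Continuous fun z => k z x u) (g : U → V) :
    Continuous fun z => HYq q (k z) g := by
  unfold HYq
  refine CEf_continuous _ fun y w => continuous_finsetSum _ fun x _ =>
    continuous_finsetSum _ fun u _ => ?_
  by_cases h : g u = y
  · simp only [h, if_true]
    exact continuous_const.mul (hk x u)
  · simp [h, continuous_const]

lemma aQ_continuous {Z X W U V : Type*} [TopologicalSpace Z] [Fintype X] [Fintype W] [Fintype U]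
    [Fintype V] [DecidableEq V] (q : X → W → ℝ) (k : Z → X → U → ℝ)
    (hk : ∀ x u, Continuous fun z => k z x u) (g : U → V) :
    Continuous fun z => aQ q (k z) g := by
  unfold aQ HXU
  refine ((HYq_continuous q k hk g).sub continuous_const).add ?_
  exact CEf_continuous _ fun x p => continuous_const.mul (hk _ _)

lemma JJ_continuous {Z U1 U2 : Type*} [TopologicalSpace Z] [Fintype U1] [Fintype U2]
    (q3 : X1 × X2 × Wa → ℝ) (k1 : Z → X1 → U1 → ℝ) (k2 : Z → X2 → U2 → ℝ)
    (kY : Z → U1 → U2 → Wa → Ya → ℝ) (h1 : ∀ x u, Continuous fun z => k1 z x u)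
    (h2 : ∀ x u, Continuous fun z => k2 z x u)
    (hY : ∀ u1 u2 w y, Continuous fun z => kY z u1 u2 w y) (x1 : X1) (x2 : X2) (w : Wa) (u : U1)
    (y : Ya) :
    Continuous fun z => JJ q3 (k1 z) (k2 z) (kY z) x1 x2 w u y := by
  unfold JJ DD
  exact (continuous_const.mul (h1 _ _)).mul
    (continuous_finsetSum _ fun u2 _ => (h2 _ _).mul (hY _ _ _ _))

lemma mQ_continuous {Z U1 U2 : Type*} [TopologicalSpace Z] [Fintype U1] [Fintype U2]
    (q3 : X1 × X2 × Wa → ℝ) (k1 : Z → X1 → U1 → ℝ) (k2 : Z → X2 → U2 → ℝ)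
    (kY : Z → U1 → U2 → Wa → Ya → ℝ) (h1 : ∀ x u, Continuous fun z => k1 z x u)
    (h2 : ∀ x u, Continuous fun z => k2 z x u)
    (hY : ∀ u1 u2 w y, Continuous fun z => kY z u1 u2 w y) (x1 : X1) (x2 : X2) (w : Wa)
    (y : Ya) :
    Continuous fun z => mQ q3 (k1 z) (k2 z) (kY z) x1 x2 w y := by
  unfold mQ
  exact continuous_finsetSum _ fun u _ => JJ_continuous q3 k1 k2 kY h1 h2 hY _ _ _ _ _

lemma cQ_continuous {Z U1 U2 V : Type*} [TopologicalSpace Z] [Fintype U1] [Fintype U2]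
    [Fintype V] [DecidableEq V]
    (q3 : X1 × X2 × Wa → ℝ) (k1 : Z → X1 → U1 → ℝ) (g : U1 → V) (k2 : Z → X2 → U2 → ℝ)
    (kY : Z → U1 → U2 → Wa → Ya → ℝ) (h1 : ∀ x u, Continuous fun z => k1 z x u)
    (h2 : ∀ x u, Continuous fun z => k2 z x u)
    (hY : ∀ u1 u2 w y, Continuous fun z => kY z u1 u2 w y) :
    Continuous fun z => cQ q3 (k1 z) g (k2 z) (kY z) := by
  unfold cQ
  refine ((CEf_continuous _ fun p r => mQ_continuous q3 k1 k2 kY h1 h2 hY _ _ _ _).sub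
    (CEf_continuous _ fun p r => JJ_continuous q3 k1 k2 kY h1 h2 hY _ _ _ _ _)).sub ?_
  exact HYq_continuous _ _ h1 _

lemma TVq_continuous {Z U1 U2 : Type*} [TopologicalSpace Z] [Fintype U1] [Fintype U2]
    (q3 : X1 × X2 × Wa → ℝ) (q4 : X1 × X2 × Wa × Ya → ℝ) (k1 : Z → X1 → U1 → ℝ)
    (k2 : Z → X2 → U2 → ℝ)
    (kY : Z → U1 → U2 → Wa → Ya → ℝ) (h1 : ∀ x u, Continuous fun z => k1 z x u)
    (h2 : ∀ x u, Continuous fun z => k2 z x u)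
    (hY : ∀ u1 u2 w y, Continuous fun z => kY z u1 u2 w y) :
    Continuous fun z => TVq q4 (mQ q3 (k1 z) (k2 z) (kY z)) := by
  unfold TVq
  exact continuous_finsetSum _ fun a _ => continuous_finsetSum _ fun b _ =>
    continuous_finsetSum _ fun w _ => continuous_finsetSum _ fun y _ =>
      ((mQ_continuous q3 k1 k2 kY h1 h2 hY _ _ _ _).sub continuous_const).abs

/-- Valid data. -/
def DatOK (X1 X2 Wa Ya : Type*) [Fintype Ya] (N1 N2 : ℕ) : Set (Dat X1 X2 Wa Ya N1 N2) :=
  {z | IsPMF z.1 ∧ (∀ t, IsKernel (z.2.1 t)) ∧ (∀ t, IsKernel (z.2.2.1 t)) ∧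
    ∀ t u1 u2, IsKernel (z.2.2.2 t u1 u2)}

lemma le_one_of_sum {β : Type*} [Fintype β] {f : β → ℝ} (h : (∀ b, 0 ≤ f b) ∧ ∑ b, f b = 1)
    (b : β) : f b ≤ 1 := by
  rw [← h.2]
  exact Finset.single_le_sum (fun i _ => h.1 i) (Finset.mem_univ b)

lemma isClosed_kernel {Z β : Type*} [TopologicalSpace Z] [Fintype β] (f : Z → β → ℝ)
    (hf : ∀ b, Continuous fun z => f z b) :
    IsClosed {z | (∀ b, 0 ≤ f z b) ∧ ∑ b, f z b = 1} := by
  rw [Set.ofPred_and, Set.ofPred_forall]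
  exact (isClosed_iInter fun b => isClosed_le continuous_const (hf b)).inter
    (isClosed_eq (continuous_finsetSum _ fun b _ => hf b) continuous_const)

lemma DatOK_compact (N1 N2 : ℕ) : IsCompact (DatOK X1 X2 Wa Ya N1 N2) := by
  refine (isCompact_Icc (a := (0 : Dat X1 X2 Wa Ya N1 N2)) (b := 1)).of_isClosed_subset ?_ ?_
  · have e : DatOK X1 X2 Wa Ya N1 N2 =
        {z : Dat X1 X2 Wa Ya N1 N2 | (∀ t, 0 ≤ z.1 t) ∧ ∑ t, z.1 t = 1} ∩
        ((⋂ t, ⋂ x, {z | (∀ b, 0 ≤ z.2.1 t x b) ∧ ∑ b, z.2.1 t x b = 1}) ∩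
        ((⋂ t, ⋂ x, {z | (∀ b, 0 ≤ z.2.2.1 t x b) ∧ ∑ b, z.2.2.1 t x b = 1}) ∩
        (⋂ t, ⋂ u1, ⋂ u2, ⋂ w, {z | (∀ b, 0 ≤ z.2.2.2 t u1 u2 w b) ∧
          ∑ b, z.2.2.2 t u1 u2 w b = 1}))) := by
      ext z
      simp only [DatOK, IsPMF, IsKernel, Set.mem_inter_iff, Set.mem_iInter, Set.mem_setOf_eq]
    rw [e]
    refine IsClosed.inter (isClosed_kernel (fun z : Dat X1 X2 Wa Ya N1 N2 => z.1) (by fun_prop)) ?_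
    refine IsClosed.inter ?_ (IsClosed.inter ?_ ?_)
    · exact isClosed_iInter fun t => isClosed_iInter fun x =>
        isClosed_kernel (fun z : Dat X1 X2 Wa Ya N1 N2 => z.2.1 t x) (by fun_prop)
    · exact isClosed_iInter fun t => isClosed_iInter fun x =>
        isClosed_kernel (fun z : Dat X1 X2 Wa Ya N1 N2 => z.2.2.1 t x) (by fun_prop)
    · exact isClosed_iInter fun t => isClosed_iInter fun x => isClosed_iInter fun x' =>
        isClosed_iInter fun x'' =>
        isClosed_kernel (fun z : Dat X1 X2 Wa Ya N1 N2 => z.2.2.2 t x x' x'') (by fun_prop)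
  · rintro z ⟨h1, h2, h3, h4⟩
    refine ⟨⟨fun t => h1.1 t, fun t x u => (h2 t x).1 u, fun t x u => (h3 t x).1 u,
      fun t u1 u2 w y => (h4 t u1 u2 w).1 y⟩, ⟨fun t => le_one_of_sum h1 t,
        fun t x u => le_one_of_sum (h2 t x) u, fun t x u => le_one_of_sum (h3 t x) u,
      fun t u1 u2 w y => le_one_of_sum (h4 t u1 u2 w) y⟩⟩

/-- Total constraint violation. -/
def viol (f1 : Xt1 → Yt1) (f2 : Xt2 → Yt2) (q3 : X1 × X2 × Wa → ℝ) (q4 : X1 × X2 × Wa × Ya → ℝ)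
    (R : ℝ) {N1 N2 : ℕ} (h1 : Fin 4 → Fin N1 → Xt1) (h2 : Fin 4 → Fin N2 → Xt2)
    (z : Dat X1 X2 Wa Ya N1 N2) : ℝ :=
  max 0 (- ∑ t, z.1 t * aQ (m1 q3) (z.2.1 t) (fun u => f1 (h1 t u))) +
  max 0 (- ∑ t, z.1 t * aQ (m2 q3) (z.2.2.1 t) (fun u => f2 (h2 t u))) +
  max 0 ((∑ t, z.1 t * cQ q3 (z.2.1 t) (fun u => f1 (h1 t u)) (z.2.2.1 t) (z.2.2.2 t)) - R) +
  ∑ t, z.1 t * TVq q4 (mQ q3 (z.2.1 t) (z.2.2.1 t) (z.2.2.2 t))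

lemma viol_continuous (f1 : Xt1 → Yt1) (f2 : Xt2 → Yt2) (q3 : X1 × X2 × Wa → ℝ)
    (q4 : X1 × X2 × Wa × Ya → ℝ)
    (R : ℝ) {N1 N2 : ℕ} (h1 : Fin 4 → Fin N1 → Xt1) (h2 : Fin 4 → Fin N2 → Xt2) :
    Continuous (viol f1 f2 q3 q4 R h1 h2) := by
  unfold viol
  have c0 : ∀ t, Continuous fun z : Dat X1 X2 Wa Ya N1 N2 => z.1 t := by fun_prop
  have c1 : ∀ t x u, Continuous fun z : Dat X1 X2 Wa Ya N1 N2 => z.2.1 t x u := by fun_prop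
  have c2 : ∀ t x u, Continuous fun z : Dat X1 X2 Wa Ya N1 N2 => z.2.2.1 t x u := by fun_prop
  have c3 : ∀ t x u w y, Continuous fun z : Dat X1 X2 Wa Ya N1 N2 => z.2.2.2 t x u w y := by
    fun_prop
  refine Continuous.add (Continuous.add (Continuous.add ?_ ?_) ?_) ?_
  · exact continuous_const.max (continuous_finsetSum _ fun t _ => (c0 t).mul
      (aQ_continuous _ (fun z : Dat X1 X2 Wa Ya N1 N2 => z.2.1 t) (c1 t) _)).neg
  · exact continuous_const.max (continuous_finsetSum _ fun t _ => (c0 t).mul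
      (aQ_continuous _ (fun z : Dat X1 X2 Wa Ya N1 N2 => z.2.2.1 t) (c2 t) _)).neg
  · exact continuous_const.max ((continuous_finsetSum _ fun t _ => (c0 t).mul
      (cQ_continuous q3 (fun z : Dat X1 X2 Wa Ya N1 N2 => z.2.1 t) _
        (fun z => z.2.2.1 t) (fun z => z.2.2.2 t) (c1 t) (c2 t) (c3 t))).sub continuous_const)
  · exact continuous_finsetSum _ fun t _ => (c0 t).mul
      (TVq_continuous q3 q4 (fun z : Dat X1 X2 Wa Ya N1 N2 => z.2.1 t)
        (fun z => z.2.2.1 t) (fun z => z.2.2.2 t) (c1 t) (c2 t) (c3 t))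

lemma TVq_nonneg (q4 : X1 × X2 × Wa × Ya → ℝ) (M : X1 → X2 → Wa → Ya → ℝ) : 0 ≤ TVq q4 M :=
  Finset.sum_nonneg fun _ _ => Finset.sum_nonneg fun _ _ => Finset.sum_nonneg fun _ _ =>
    Finset.sum_nonneg fun _ _ => abs_nonneg _

lemma TVq_zero (q4 : X1 × X2 × Wa × Ya → ℝ) (M : X1 → X2 → Wa → Ya → ℝ) (h : TVq q4 M = 0) :
    ∀ a b w y, M a b w y = q4 (a, b, w, y) := by
  intro a b w y
  unfold TVq at h
  have e1 := (Finset.sum_eq_zero_iff_of_nonneg (fun _ _ => Finset.sum_nonneg fun _ _ =>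
    Finset.sum_nonneg fun _ _ => Finset.sum_nonneg fun _ _ => abs_nonneg _)).1 h a
      (Finset.mem_univ _)
  have e2 := (Finset.sum_eq_zero_iff_of_nonneg (fun _ _ => 
    Finset.sum_nonneg fun _ _ => Finset.sum_nonneg fun _ _ => abs_nonneg _)).1 e1 b
      (Finset.mem_univ _)
  have e3 := (Finset.sum_eq_zero_iff_of_nonneg (fun _ _ => 
    Finset.sum_nonneg fun _ _ => abs_nonneg _)).1 e2 w (Finset.mem_univ _)
  have e4 := (Finset.sum_eq_zero_iff_of_nonneg (fun _ _ => abs_nonneg _)).1 e3 y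
    (Finset.mem_univ _)
  exact sub_eq_zero.1 (abs_eq_zero.1 e4)

lemma exact_sch (f1 : Xt1 → Yt1) (f2 : Xt2 → Yt2) (q3 : X1 × X2 × Wa → ℝ)
    (q4 : X1 × X2 × Wa × Ya → ℝ) (R : ℝ) (N1 N2 : ℕ)
    (happ : ∀ ε : ℝ, 0 < ε → ∃ (p : Fin 4 → ℝ) (s : Fin 4 → Sch X1 X2 Wa Xt1 Xt2 Ya N1 N2),
      IsPMF p ∧
      0 ≤ ∑ t, p t * aQ (m1 q3) (s t).k1 (fun u => f1 ((s t).h1 u)) ∧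
      0 ≤ ∑ t, p t * aQ (m2 q3) (s t).k2 (fun u => f2 ((s t).h2 u)) ∧
      ∑ t, p t * cQ q3 (s t).k1 (fun u => f1 ((s t).h1 u)) (s t).k2 (s t).kY ≤ R + ε ∧
      ∑ t, p t * TVq q4 (mQ q3 (s t).k1 (s t).k2 (s t).kY) ≤ ε) :
    ∃ (p : Fin 4 → ℝ) (s : Fin 4 → Sch X1 X2 Wa Xt1 Xt2 Ya N1 N2),
      IsPMF p ∧
      0 ≤ ∑ t, p t * aQ (m1 q3) (s t).k1 (fun u => f1 ((s t).h1 u)) ∧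
      0 ≤ ∑ t, p t * aQ (m2 q3) (s t).k2 (fun u => f2 ((s t).h2 u)) ∧
      ∑ t, p t * cQ q3 (s t).k1 (fun u => f1 ((s t).h1 u)) (s t).k2 (s t).kY ≤ R ∧
      ∑ t, p t * TVq q4 (mQ q3 (s t).k1 (s t).k2 (s t).kY) = 0 := by
  classical
  let Hh := (Fin 4 → Fin N1 → Xt1) × (Fin 4 → Fin N2 → Xt2)
  have hne : (DatOK X1 X2 Wa Ya N1 N2).Nonempty := by
    obtain ⟨p, s, hp, -⟩ := happ 1 one_pos
    exact ⟨(p, fun t => (s t).k1, fun t => (s t).k2, fun t => (s t).kY), hp,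
      fun t => (s t).hk1, fun t => (s t).hk2, fun t => (s t).hkY⟩
  have hmin : ∀ h : Hh, ∃ z ∈ DatOK X1 X2 Wa Ya N1 N2, ∀ z' ∈ DatOK X1 X2 Wa Ya N1 N2,
      viol f1 f2 q3 q4 R h.1 h.2 z ≤ viol f1 f2 q3 q4 R h.1 h.2 z' := by
    intro h
    obtain ⟨z, hz, hm⟩ := (DatOK_compact N1 N2).exists_isMinOn hne
      (viol_continuous f1 f2 q3 q4 R h.1 h.2).continuousOn
    exact ⟨z, hz, fun z' hz' => hm hz'⟩
  choose Z hZ hZm using hmin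
  have hTVnn : ∀ h, 0 ≤ ∑ t, (Z h).1 t *
      TVq q4 (mQ q3 ((Z h).2.1 t) ((Z h).2.2.1 t) ((Z h).2.2.2 t)) := fun h =>
    Finset.sum_nonneg fun t _ => mul_nonneg ((hZ h).1.1 t) (TVq_nonneg _ _)
  by_cases hex : ∃ h : Hh, viol f1 f2 q3 q4 R h.1 h.2 (Z h) ≤ 0
  · obtain ⟨h, hh⟩ := hex
    have hT := hTVnn h
    unfold viol at hh
    have g1 := le_max_left 0 (- ∑ t, (Z h).1 t * aQ (m1 q3) ((Z h).2.1 t) (fun u => f1 (h.1 t u)))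
    have g2 := le_max_left 0 (- ∑ t, (Z h).1 t * aQ (m2 q3) ((Z h).2.2.1 t) (fun u => f2 (h.2 t u)))
    have g3 := le_max_left 0 ((∑ t, (Z h).1 t * cQ q3 ((Z h).2.1 t) (fun u => f1 (h.1 t u))
      ((Z h).2.2.1 t) ((Z h).2.2.2 t)) - R)
    have g1' := le_max_right 0 (- ∑ t, (Z h).1 t * aQ (m1 q3) ((Z h).2.1 t) (fun u => f1 (h.1 t u)))
    have g2' := le_max_right 0
      (- ∑ t, (Z h).1 t * aQ (m2 q3) ((Z h).2.2.1 t) (fun u => f2 (h.2 t u)))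
    have g3' := le_max_right 0 ((∑ t, (Z h).1 t * cQ q3 ((Z h).2.1 t) (fun u => f1 (h.1 t u))
      ((Z h).2.2.1 t) ((Z h).2.2.2 t)) - R)
    refine ⟨(Z h).1, fun t => ⟨(Z h).2.1 t, h.1 t, (Z h).2.2.1 t, h.2 t, (Z h).2.2.2 t,
      (hZ h).2.1 t, (hZ h).2.2.1 t, (hZ h).2.2.2 t⟩, (hZ h).1, ?_, ?_, ?_, ?_⟩
    all_goals simp only
    all_goals linarith
  · push Not at hex
    exfalso
    obtain ⟨p0, s0, -⟩ := happ 1 one_pos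
    haveI : Nonempty Hh := ⟨(fun t => (s0 t).h1, fun t => (s0 t).h2)⟩
    obtain ⟨h0, hh0⟩ := Finite.exists_min (fun h : Hh => viol f1 f2 q3 q4 R h.1 h.2 (Z h))
    set η := viol f1 f2 q3 q4 R h0.1 h0.2 (Z h0) with hη
    have hηp : 0 < η := hex h0
    obtain ⟨p, s, hp, h1, h2, h3, h4⟩ := happ (η / 4) (by linarith)
    have k1 := hh0 ((fun t => (s t).h1, fun t => (s t).h2))
    have k2 := hZm (fun t => (s t).h1, fun t => (s t).h2)
      (p, fun t => (s t).k1, fun t => (s t).k2, fun t => (s t).kY) ⟨hp,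
      fun t => (s t).hk1, fun t => (s t).hk2, fun t => (s t).hkY⟩
    have k3 : viol f1 f2 q3 q4 R (fun t => (s t).h1) (fun t => (s t).h2)
      (p, fun t => (s t).k1, fun t => (s t).k2, fun t => (s t).kY) ≤ η / 2 := by
      unfold viol
      simp only
      rw [max_eq_left (by linarith), max_eq_left (by linarith)]
      have : max 0 ((∑ t, p t * cQ q3 (s t).k1 (fun u => f1 ((s t).h1 u)) (s t).k2 (s t).kY) - R)
        ≤ η / 4 := max_le (by linarith) (by linarith)
      linarith
    simp only at k1 k2
    linarith

end comp
end

noncomputable section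

set_option linter.unusedSectionVars false
set_option linter.unusedSimpArgs false

lemma three_red {ι : Type*} [Fintype ι] (p : ι → ℝ) (hp : IsPMF p) (a1 a2 c : ι → ℝ) :
    ∃ (e : Fin 3 → ι) (l : Fin 3 → ℝ), IsPMF l ∧ (∀ s, p (e s) ≠ 0) ∧
      ∑ s, l s * a1 (e s) = ∑ i, p i * a1 i ∧ ∑ s, l s * a2 (e s) = ∑ i, p i * a2 i ∧
      ∑ s, l s * c (e s) ≤ ∑ i, p i * c i := by
  obtain ⟨e, l, hl, hne, hg, hc⟩ := carath_fin (J := Fin 3)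
    (fun i => ![1, a1 i, a2 i]) (fun i => - c i) (by
      intro v hv h
      have h0 := h 0
      simp only [Matrix.cons_val_zero, mul_one] at h0
      rw [Finset.sum_eq_zero_iff_of_nonneg (fun i _ => hv i)] at h0
      exact Finset.sum_eq_zero fun i hi => by rw [h0 i hi, zero_mul]) p hp.1
    (by
      by_contra! hcon
      have := hp.2
      simp [hcon] at this) 3 (by simp)
  refine ⟨e, l, ⟨hl, ?_⟩, hne, ?_, ?_, ?_⟩
  · have := hg 0
    simpa [hp.2] using this
  · simpa using hg 1
  · simpa using hg 2
  · simp only [mul_neg, Finset.sum_neg_distrib] at hc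
    linarith

lemma rvDist_split {Ω β γ : Type*} [Fintype Ω] [Fintype γ] [DecidableEq β]
    (ν : Ω → ℝ) (X : Ω → β) (C : Ω → γ) (F : β → γ → Ω) (h1 : ∀ b c, X (F b c) = b)
    (h2 : ∀ b c, C (F b c) = c) (h3 : ∀ ω, F (X ω) (C ω) = ω) (b : β) :
    rvDist ν X b = ∑ c, ν (F b c) := by
  unfold rvDist
  rw [← Finset.sum_filter]
  refine Finset.sum_bij' (fun ω _ => C ω) (fun c _ => F b c) ?_ ?_ ?_ ?_ ?_
  · simp
  · intro c _
    simp [h1]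
  · intro ω hω
    simp only [Finset.mem_filter, Finset.mem_univ, true_and] at hω
    rw [← hω, h3]
  · intro c _
    exact h2 b c
  · intro ω hω
    simp only [Finset.mem_filter, Finset.mem_univ, true_and] at hω
    rw [← hω, h3]

section single
variable {Ω X W U V T : Type*} [Fintype Ω] [Fintype X] [Fintype W] [Fintype U] [Fintype V]
  [Fintype T] [DecidableEq X] [DecidableEq W] [DecidableEq U] [DecidableEq V] [DecidableEq T]

lemma single_Y (ν : Ω → ℝ) (rX : Ω → X) (rW : Ω → W) (rU : Ω → U) (rT : Ω → T)
    (p : T → ℝ) (q : X → W → ℝ) (k : T → X → U → ℝ) (g : T → U → V)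
    (hl : ∀ x w u t, rvDist ν (fun ω => (rX ω, ((rW ω, rU ω), rT ω))) (x, ((w, u), t)) =
      p t * (q x w * k t x u)) :
    Hc ν (fun ω => g (rT ω) (rU ω)) (fun ω => (rW ω, rT ω)) = ∑ t, p t * HYq q (k t) (g t) := by
  rw [Hc_eq_CEf]
  have hr : ∀ (y : V) (c : W × T),
      rvDist ν (fun ω => (g (rT ω) (rU ω), rW ω, rT ω)) (y, c) =
        p c.2 * ∑ x, ∑ u, if g c.2 u = y then q x c.1 * k c.2 x u else 0 := by
    rintro y ⟨w, t⟩
    have := rvDist_comp ν (fun ω => (rX ω, ((rW ω, rU ω), rT ω)))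
      (fun z => (g z.2.2 z.2.1.2, z.2.1.1, z.2.2)) (y, w, t)
    simp only at this
    rw [this]
    simp only [Fintype.sum_prod_type, hl, Prod.mk.injEq, Finset.mul_sum]
    refine Finset.sum_congr rfl fun x _ => ?_
    rw [Finset.sum_comm]
    refine Finset.sum_congr rfl fun u _ => ?_
    have e : ∀ w' t', (if g t' u = y ∧ w' = w ∧ t' = t then p t' * (q x w' * k t' x u) else 0) =
        if w' = w then (if t' = t then (if g t' u = y then p t' * (q x w' * k t' x u) else 0)
          else 0) else 0 := by
      intro w' t'
      split_ifs <;> first | rfl | tauto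
    simp only [e]
    rw [Finset.sum_eq_single w (by intro b _ hb; simp [hb]) (by simp)]
    rw [Finset.sum_eq_single t (by intro b _ hb; simp [hb]) (by simp)]
    simp
  simp only [hr]
  rw [CEf_prod (fun y w t => p t * ∑ x, ∑ u, if g t u = y then q x w * k t x u else 0)]
  simp only [CEf_smul]
  rfl

lemma single_XU (ν : Ω → ℝ) (rX : Ω → X) (rW : Ω → W) (rU : Ω → U) (rT : Ω → T)
    (p : T → ℝ) (q : X → W → ℝ) (k : T → X → U → ℝ)
    (hl : ∀ x w u t, rvDist ν (fun ω => (rX ω, ((rW ω, rU ω), rT ω))) (x, ((w, u), t)) =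
      p t * (q x w * k t x u)) :
    Hc ν rX (fun ω => ((rW ω, rU ω), rT ω)) = ∑ t, p t * HXU q (k t) := by
  rw [Hc_eq_CEf]
  have : (fun (a : X) (c : (W × U) × T) => rvDist ν (fun ω => (rX ω, (rW ω, rU ω), rT ω)) (a, c)) =
      fun a c => p c.2 * (q a c.1.1 * k c.2 a c.1.2) := by
    funext a c
    exact hl a c.1.1 c.1.2 c.2
  rw [this, CEf_prod (fun x (c : W × U) t => p t * (q x c.1 * k t x c.2))]
  simp only [CEf_smul]
  rfl

lemma single_X (ν : Ω → ℝ) (rX : Ω → X) (rW : Ω → W) (rU : Ω → U) (rT : Ω → T)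
    (p : T → ℝ) (q : X → W → ℝ) (k : T → X → U → ℝ) (hk : ∀ t x, ∑ u, k t x u = 1)
    (hl : ∀ x w u t, rvDist ν (fun ω => (rX ω, ((rW ω, rU ω), rT ω))) (x, ((w, u), t)) =
      p t * (q x w * k t x u)) :
    Hc ν rX (fun ω => (rW ω, rT ω)) = ∑ t, p t * CEf q := by
  rw [Hc_eq_CEf]
  have : (fun (a : X) (c : W × T) => rvDist ν (fun ω => (rX ω, rW ω, rT ω)) (a, c)) =
      fun a c => p c.2 * q a c.1 := by
    funext a ⟨w, t⟩
    have h1 := rvDist_comp ν (fun ω => (rX ω, ((rW ω, rU ω), rT ω)))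
      (fun z => (z.1, z.2.1.1, z.2.2)) (a, w, t)
    simp only at h1
    rw [h1]
    simp only [Fintype.sum_prod_type, hl, Prod.mk.injEq]
    rw [Finset.sum_eq_single a (by intro b _ hb; simp [hb]) (by simp)]
    rw [Finset.sum_eq_single w (by intro b _ hb; simp [hb]) (by simp)]
    simp [← Finset.mul_sum, hk]
  rw [this, CEf_prod (fun x w t => p t * q x w)]
  simp only [CEf_smul]

/-- Inequality (3a)/(3b) from the averaged single-letter quantity. -/
lemma single_ineq (ν : Ω → ℝ) (rX : Ω → X) (rW : Ω → W) (rU : Ω → U) (rT : Ω → T)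
    (p : T → ℝ) (q : X → W → ℝ) (k : T → X → U → ℝ) (hk : ∀ t x, ∑ u, k t x u = 1)
    (g : T → U → V)
    (hl : ∀ x w u t, rvDist ν (fun ω => (rX ω, ((rW ω, rU ω), rT ω))) (x, ((w, u), t)) =
      p t * (q x w * k t x u))
    (ha : 0 ≤ ∑ t, p t * aQ q (k t) (g t)) :
    condHb ν (fun ω => g (rT ω) (rU ω)) (fun ω => (rW ω, rT ω)) ≥
      condIb ν (fun ω => (rU ω, g (rT ω) (rU ω))) rX (fun ω => (rW ω, rT ω)) := by
  have e1 := single_Y ν rX rW rU rT p q k g hl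
  have e2 := single_XU ν rX rW rU rT p q k hl
  have e3 := single_X ν rX rW rU rT p q k hk hl
  have i1 := Hn_comp_inj ν (fun ω => ((rW ω, rU ω), rT ω))
    (fun z => ((z.1.2, g z.2 z.1.2), (z.1.1, z.2)))
    (fun z z' h => by
      simp only [Prod.mk.injEq] at h
      exact Prod.ext (Prod.ext h.2.1 h.1.1) h.2.2)
  have i2 := Hn_comp_inj ν (fun ω => (rX ω, ((rW ω, rU ω), rT ω)))
    (fun z => ((z.2.1.2, g z.2.2 z.2.1.2), z.1, (z.2.1.1, z.2.2)))
    (fun z z' h => by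
      simp only [Prod.mk.injEq] at h
      exact Prod.ext h.2.1 (Prod.ext (Prod.ext h.2.2.1 h.1.1) h.2.2.2))
  have hlog : 0 < Real.log 2 := Real.log_pos (by norm_num)
  unfold condHb condIb
  simp only [Hb_eq_Hn]
  simp only at i1 i2
  rw [i1, i2, ge_iff_le, ← add_div, ← sub_div, ← sub_div, ← sub_div,
    div_le_div_iff_of_pos_right hlog]
  unfold Hc at e1 e2 e3
  have hs : ∑ t, p t * aQ q (k t) (g t) =
      ∑ t, p t * HYq q (k t) (g t) - ∑ t, p t * CEf q + ∑ t, p t * HXU q (k t) := by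
    rw [← Finset.sum_sub_distrib, ← Finset.sum_add_distrib]
    refine Finset.sum_congr rfl fun t _ => ?_
    unfold aQ
    ring
  rw [hs] at ha
  linarith

end single
end

noncomputable section

set_option linter.unusedSectionVars false
set_option linter.unusedSimpArgs false

section rate
variable {Ω X1 X2 Wa U1 U2 V T Ya : Type*} [Fintype Ω] [Fintype X1] [Fintype X2] [Fintype Wa]
  [Fintype U1] [Fintype U2] [Fintype V] [Fintype T] [Fintype Ya]
  [DecidableEq X1] [DecidableEq X2] [DecidableEq Wa] [DecidableEq U1] [DecidableEq V]
  [DecidableEq T] [DecidableEq Ya]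

lemma rate_ineq (ν : Ω → ℝ) (r1 : Ω → X1) (r2 : Ω → X2) (rW : Ω → Wa) (rU : Ω → U1) (rT : Ω → T)
    (rY : Ω → Ya) (p : T → ℝ) (q3 : X1 × X2 × Wa → ℝ) (k1 : T → X1 → U1 → ℝ)
    (k2 : T → X2 → U2 → ℝ) (kY : T → U1 → U2 → Wa → Ya → ℝ) (g : T → U1 → V)
    (hl : ∀ x w u t, rvDist ν (fun ω => (r1 ω, ((rW ω, rU ω), rT ω))) (x, ((w, u), t)) =
      p t * (m1 q3 x w * k1 t x u))
    (hJ : ∀ x1 y x2 w u t, rvDist ν (fun ω => ((r1 ω, rY ω), (((r2 ω, rW ω), rU ω), rT ω)))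
      ((x1, y), (((x2, w), u), t)) = p t * JJ q3 (k1 t) (k2 t) (kY t) x1 x2 w u y)
    (R : ℝ)
    (hc : ∑ t, p t * cQ q3 (k1 t) (g t) (k2 t) (kY t) ≤ R * Real.log 2) :
    R ≥ condIb ν (fun ω => (rU ω, g (rT ω) (rU ω))) (fun ω => (r1 ω, rY ω))
        (fun ω => (r2 ω, rW ω, rT ω))
      - condHb ν (fun ω => g (rT ω) (rU ω)) (fun ω => (rW ω, rT ω)) := by
  have e1 := single_Y ν r1 rW rU rT p (m1 q3) k1 g hl
  have e2 : Hc ν (fun ω => (r1 ω, rY ω)) (fun ω => (((r2 ω, rW ω), rU ω), rT ω)) =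
      ∑ t, p t * CEf (fun (a : X1 × Ya) (r : (X2 × Wa) × U1) =>
        JJ q3 (k1 t) (k2 t) (kY t) a.1 r.1.1 r.1.2 r.2 a.2) := by
    rw [Hc_eq_CEf]
    have : (fun (a : X1 × Ya) (c : ((X2 × Wa) × U1) × T) =>
        rvDist ν (fun ω => ((r1 ω, rY ω), (((r2 ω, rW ω), rU ω), rT ω))) (a, c)) =
        fun a c => p c.2 * JJ q3 (k1 c.2) (k2 c.2) (kY c.2) a.1 c.1.1.1 c.1.1.2 c.1.2 a.2 := by
      funext a c
      exact hJ a.1 a.2 c.1.1.1 c.1.1.2 c.1.2 c.2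
    rw [this, CEf_prod (fun (a : X1 × Ya) (r : (X2 × Wa) × U1) t =>
      p t * JJ q3 (k1 t) (k2 t) (kY t) a.1 r.1.1 r.1.2 r.2 a.2)]
    simp only [CEf_smul]
  have e3 : Hc ν (fun ω => (r1 ω, rY ω)) (fun ω => ((r2 ω, rW ω), rT ω)) =
      ∑ t, p t * CEf (fun (a : X1 × Ya) (r : X2 × Wa) =>
        mQ q3 (k1 t) (k2 t) (kY t) a.1 r.1 r.2 a.2) := by
    rw [Hc_eq_CEf]
    have : (fun (a : X1 × Ya) (c : (X2 × Wa) × T) =>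
        rvDist ν (fun ω => ((r1 ω, rY ω), ((r2 ω, rW ω), rT ω))) (a, c)) =
        fun a c => p c.2 * mQ q3 (k1 c.2) (k2 c.2) (kY c.2) a.1 c.1.1 c.1.2 a.2 := by
      funext ⟨x1, y⟩ ⟨⟨x2, w⟩, t⟩
      have h1 := rvDist_comp ν (fun ω => ((r1 ω, rY ω), (((r2 ω, rW ω), rU ω), rT ω)))
        (fun z => (z.1, z.2.1.1, z.2.2)) ((x1, y), (x2, w), t)
      simp only at h1
      rw [h1]
      simp only [Fintype.sum_prod_type, hJ, Prod.mk.injEq]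
      rw [Finset.sum_eq_single x1 (by intro b _ hb; simp [hb]) (by simp)]
      rw [Finset.sum_eq_single y (by intro b _ hb; simp [hb]) (by simp)]
      rw [Finset.sum_eq_single x2 (by intro b _ hb; simp [hb]) (by simp)]
      rw [Finset.sum_eq_single w (by intro b _ hb; simp [hb]) (by simp)]
      simp [← Finset.mul_sum, mQ]
    rw [this, CEf_prod (fun (a : X1 × Ya) (r : X2 × Wa) t =>
      p t * mQ q3 (k1 t) (k2 t) (kY t) a.1 r.1 r.2 a.2)]
    simp only [CEf_smul]
  have i1 := Hn_comp_inj ν (fun ω => (((r2 ω, rW ω), rU ω), rT ω))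
    (fun z => ((z.1.2, g z.2 z.1.2), (z.1.1.1, z.1.1.2, z.2)))
    (fun z z' h => by
      simp only [Prod.mk.injEq] at h
      exact Prod.ext (Prod.ext (Prod.ext h.2.1 h.2.2.1) h.1.1) h.2.2.2)
  have i2 := Hn_comp_inj ν (fun ω => ((r1 ω, rY ω), (((r2 ω, rW ω), rU ω), rT ω)))
    (fun z => ((z.2.1.2, g z.2.2 z.2.1.2), z.1, (z.2.1.1.1, z.2.1.1.2, z.2.2)))
    (fun z z' h => by
      simp only [Prod.mk.injEq] at h
      exact Prod.ext h.2.1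
        (Prod.ext (Prod.ext (Prod.ext h.2.2.1 h.2.2.2.1) h.1.1) h.2.2.2.2))
  have i3 := Hn_comp_inj ν (fun ω => ((r2 ω, rW ω), rT ω))
    (fun z => (z.1.1, z.1.2, z.2))
    (fun z z' h => by
      simp only [Prod.mk.injEq] at h
      exact Prod.ext (Prod.ext h.1 h.2.1) h.2.2)
  have i4 := Hn_comp_inj ν (fun ω => ((r1 ω, rY ω), ((r2 ω, rW ω), rT ω)))
    (fun z => (z.1, (z.2.1.1, z.2.1.2, z.2.2)))
    (fun z z' h => by
      simp only [Prod.mk.injEq] at h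
      exact Prod.ext h.1 (Prod.ext (Prod.ext h.2.1 h.2.2.1) h.2.2.2))
  have hlog : 0 < Real.log 2 := Real.log_pos (by norm_num)
  unfold condHb condIb
  simp only [Hb_eq_Hn]
  simp only at i1 i2 i3 i4
  rw [i1, i2, i3, i4, ge_iff_le, ← add_div, ← sub_div, ← sub_div, ← sub_div, ← sub_div,
    div_le_iff₀ hlog]
  unfold Hc at e1 e2 e3
  have hs : ∑ t, p t * cQ q3 (k1 t) (g t) (k2 t) (kY t) =
      ∑ t, p t * CEf (fun (a : X1 × Ya) (r : X2 × Wa) =>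
        mQ q3 (k1 t) (k2 t) (kY t) a.1 r.1 r.2 a.2)
      - ∑ t, p t * CEf (fun (a : X1 × Ya) (r : (X2 × Wa) × U1) =>
        JJ q3 (k1 t) (k2 t) (kY t) a.1 r.1.1 r.1.2 r.2 a.2)
      - ∑ t, p t * HYq (m1 q3) (k1 t) (g t) := by
    rw [← Finset.sum_sub_distrib, ← Finset.sum_sub_distrib]
    refine Finset.sum_congr rfl fun t _ => ?_
    unfold cQ
    ring
  rw [hs] at hc
  linarith

end rate

section base
variable {X1 X2 Wa U1 U2 V T Ya : Type*} [Fintype X1] [Fintype X2] [Fintype Wa]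
  [Fintype U1] [Fintype U2] [Fintype T] [Fintype Ya]
  [DecidableEq X1] [DecidableEq X2] [DecidableEq Wa] [DecidableEq U1] [DecidableEq U2]
  [DecidableEq T] [DecidableEq Ya]

/-- Base law of `(X₁, X₂, W, T, U₁, U₂, Y)`. -/
def nuB (q3 : X1 × X2 × Wa → ℝ) (p : T → ℝ) (k1 : T → X1 → U1 → ℝ)
    (k2 : T → X2 → U2 → ℝ) (kY : T → U1 → U2 → Wa → Ya → ℝ) :
    X1 × X2 × Wa × T × U1 × U2 × Ya → ℝ := fun ω =>
  q3 (ω.1, ω.2.1, ω.2.2.1) * p ω.2.2.2.1 * k1 ω.2.2.2.1 ω.1 ω.2.2.2.2.1 *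
    k2 ω.2.2.2.1 ω.2.1 ω.2.2.2.2.2.1 *
    kY ω.2.2.2.1 ω.2.2.2.2.1 ω.2.2.2.2.2.1 ω.2.2.1 ω.2.2.2.2.2.2

variable (q3 : X1 × X2 × Wa → ℝ) (p : T → ℝ) (k1 : T → X1 → U1 → ℝ)
    (k2 : T → X2 → U2 → ℝ) (kY : T → U1 → U2 → Wa → Ya → ℝ)

lemma nuB_law1 (hk2 : ∀ t, IsKernel (k2 t)) (hkY : ∀ t u1 u2, IsKernel (kY t u1 u2))
    (x : X1) (w : Wa) (u : U1) (t : T) :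
    rvDist (nuB q3 p k1 k2 kY) (fun ω => (ω.1, ((ω.2.2.1, ω.2.2.2.2.1), ω.2.2.2.1)))
      (x, ((w, u), t)) = p t * (m1 q3 x w * k1 t x u) := by
  rw [rvDist_split _ _ (fun ω => (ω.2.1, ω.2.2.2.2.2.1, ω.2.2.2.2.2.2))
    (fun b c => (b.1, c.1, b.2.1.1, b.2.2, b.2.1.2, c.2.1, c.2.2))
    (fun _ _ => rfl) (fun _ _ => rfl) (fun _ => rfl)]
  simp only [Fintype.sum_prod_type, nuB, m1, ← Finset.mul_sum, (hkY _ _ _ _).2, mul_one,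
    (hk2 _ _).2]
  rw [← Finset.sum_mul, ← Finset.sum_mul]
  ring

lemma nuB_law2 (hk1 : ∀ t, IsKernel (k1 t)) (hkY : ∀ t u1 u2, IsKernel (kY t u1 u2))
    (x : X2) (w : Wa) (u : U2) (t : T) :
    rvDist (nuB q3 p k1 k2 kY) (fun ω => (ω.2.1, ((ω.2.2.1, ω.2.2.2.2.2.1), ω.2.2.2.1)))
      (x, ((w, u), t)) = p t * (m2 q3 x w * k2 t x u) := by
  rw [rvDist_split _ _ (fun ω => (ω.1, ω.2.2.2.2.1, ω.2.2.2.2.2.2))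
    (fun b c => (c.1, b.1, b.2.1.1, b.2.2, c.2.1, b.2.1.2, c.2.2))
    (fun _ _ => rfl) (fun _ _ => rfl) (fun _ => rfl)]
  simp only [Fintype.sum_prod_type, nuB, m2, ← Finset.mul_sum, (hkY _ _ _ _).2, mul_one]
  simp only [← Finset.sum_mul, ← Finset.mul_sum, (hk1 _ _).2, mul_one]
  ring

lemma nuB_lawJ (x1 : X1) (y : Ya) (x2 : X2) (w : Wa) (u : U1) (t : T) :
    rvDist (nuB q3 p k1 k2 kY)
      (fun ω => ((ω.1, ω.2.2.2.2.2.2), (((ω.2.1, ω.2.2.1), ω.2.2.2.2.1), ω.2.2.2.1)))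
      ((x1, y), (((x2, w), u), t)) = p t * JJ q3 (k1 t) (k2 t) (kY t) x1 x2 w u y := by
  rw [rvDist_split _ _ (fun ω => ω.2.2.2.2.2.1)
    (fun b c => (b.1.1, b.2.1.1.1, b.2.1.1.2, b.2.2, b.2.1.2, c, b.1.2))
    (fun _ _ => rfl) (fun _ _ => rfl) (fun _ => rfl)]
  simp only [nuB, JJ, DD, Finset.mul_sum]
  refine Finset.sum_congr rfl fun u2 _ => ?_
  ring

end base

section fin
variable {X1 X2 Wa Xt1 Xt2 Yt1 Yt2 Ya : Type*}
    [Fintype X1] [Fintype X2] [Fintype Wa] [Fintype Xt1] [Fintype Xt2]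
    [Fintype Yt1] [Fintype Yt2] [Fintype Ya]
    [DecidableEq X1] [DecidableEq X2] [DecidableEq Wa] [DecidableEq Xt1] [DecidableEq Xt2]
    [DecidableEq Yt1] [DecidableEq Yt2] [DecidableEq Ya]

lemma source_setup [Nonempty X1] [Nonempty X2] (q3 : X1 × X2 × Wa → ℝ) (hq3 : IsPMF q3)
    (hCI : ∀ x1 x2 w, (∑ a : X1, ∑ b : X2, q3 (a, b, w)) * q3 (x1, x2, w) =
      (∑ b : X2, q3 (x1, b, w)) * (∑ a : X1, q3 (a, x2, w))) :
    ∃ (qW : Wa → ℝ) (c1 : Wa → X1 → ℝ) (c2 : Wa → X2 → ℝ), IsPMF qW ∧ IsKernel c1 ∧ IsKernel c2 ∧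
      (∀ x1 x2 w, q3 (x1, x2, w) = qW w * c1 w x1 * c2 w x2) ∧
      ∀ w, qW w = ∑ a, ∑ b, q3 (a, b, w) := by
  classical
  set qW : Wa → ℝ := fun w => ∑ a, ∑ b, q3 (a, b, w) with hqW
  have h0 : ∀ w, 0 ≤ qW w := fun w => Finset.sum_nonneg fun _ _ => Finset.sum_nonneg fun _ _ =>
    hq3.1 _
  refine ⟨qW, fun w x => if qW w = 0 then (Fintype.card X1 : ℝ)⁻¹ else (∑ b, q3 (x, b, w)) / qW w,
    fun w x => if qW w = 0 then (Fintype.card X2 : ℝ)⁻¹ else (∑ a, q3 (a, x, w)) / qW w,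
    ⟨h0, ?_⟩, ?_, ?_, ?_, fun w => rfl⟩
  · rw [← hq3.2, hqW]
    simp only [Fintype.sum_prod_type]
    rw [Finset.sum_comm]
    refine Finset.sum_congr rfl fun a _ => ?_
    rw [Finset.sum_comm]
  · intro w
    by_cases h : qW w = 0
    · simp [h]
    · simp only [h, if_false]
      refine ⟨fun b => div_nonneg (Finset.sum_nonneg fun _ _ => hq3.1 _) (h0 w), ?_⟩
      rw [← Finset.sum_div]
      exact div_self h
  · intro w
    by_cases h : qW w = 0
    · simp [h]
    · simp only [h, if_false]
      refine ⟨fun b => div_nonneg (Finset.sum_nonneg fun _ _ => hq3.1 _) (h0 w), ?_⟩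
      rw [← Finset.sum_div, Finset.sum_comm]
      exact div_self h
  · intro x1 x2 w
    by_cases h : qW w = 0
    · simp only [h, if_true, zero_mul]
      have h' := h
      simp only [hqW] at h'
      have e1 := (Finset.sum_eq_zero_iff_of_nonneg (fun _ _ => Finset.sum_nonneg fun _ _ =>
        hq3.1 _)).1 h' x1 (Finset.mem_univ _)
      exact (Finset.sum_eq_zero_iff_of_nonneg (fun _ _ => hq3.1 _)).1 e1 x2 (Finset.mem_univ _)
    · simp only [h, if_false]
      have := hCI x1 x2 w
      change qW w * _ = _ at this
      field_simp
      linarith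

/-- Everything up to the exact scheme with three time-sharing values. -/
lemma main_sch
    (f1 : Xt1 → Yt1) (f2 : Xt2 → Yt2)
    (q3 : X1 × X2 × Wa → ℝ) (hq3 : IsPMF q3)
    (q4 : X1 × X2 × Wa × Ya → ℝ) (hq4 : IsPMF q4)
    (hmarg : ∀ x1 x2 w, ∑ y, q4 (x1, x2, w, y) = q3 (x1, x2, w))
    (hCI : ∀ x1 x2 w, (∑ a : X1, ∑ b : X2, q3 (a, b, w)) * q3 (x1, x2, w) =
      (∑ b : X2, q3 (x1, b, w)) * (∑ a : X1, q3 (a, x2, w)))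
    (R01 R02 : ℝ)
    (hach : AchievableNoCrib q3 (detCh f1 f2) q4 R01 R02) (N1 N2 : ℕ)
    (hN1 : N1 = Fintype.card X1 * Fintype.card X2 * Fintype.card Wa * Fintype.card Xt1 *
        Fintype.card Xt2 * (Fintype.card Yt1 * Fintype.card Yt2) * Fintype.card Ya)
    (hN2 : N2 = N1 * Fintype.card X1 * Fintype.card X2 * Fintype.card Wa * Fintype.card Xt1 *
        Fintype.card Xt2 * (Fintype.card Yt1 * Fintype.card Yt2) * Fintype.card Ya) :
    ∃ (p : Fin 3 → ℝ) (s : Fin 3 → Sch X1 X2 Wa Xt1 Xt2 Ya N1 N2),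
      IsPMF p ∧
      0 ≤ ∑ t, p t * aQ (m1 q3) (s t).k1 (fun u => f1 ((s t).h1 u)) ∧
      0 ≤ ∑ t, p t * aQ (m2 q3) (s t).k2 (fun u => f2 ((s t).h2 u)) ∧
      ∑ t, p t * cQ q3 (s t).k1 (fun u => f1 ((s t).h1 u)) (s t).k2 (s t).kY ≤ R01 * Real.log 2 ∧
      ∀ t x1 x2 w y, mQ q3 (s t).k1 (s t).k2 (s t).kY x1 x2 w y = q4 (x1, x2, w, y) := by
  obtain ⟨⟨x10, x20, w0, y0⟩⟩ : Nonempty (X1 × X2 × Wa × Ya) := by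
    by_contra hcon
    rw [not_nonempty_iff] at hcon
    have := hq4.2
    simp at this
  have n1 : Nonempty X1 := ⟨x10⟩
  have n2 : Nonempty X2 := ⟨x20⟩
  have n3 : Nonempty Wa := ⟨w0⟩
  have n4 : Nonempty Ya := ⟨y0⟩
  have hach' := hach
  obtain ⟨κ1, κ2, hκ1, hκ2, -, -, E2, E1, -, hE2, hE1, -, -⟩ := hach'
  have n5 : Nonempty Xt1 := by
    by_contra hcon
    rw [not_nonempty_iff] at hcon
    have := (hE1 1 (fun _ => x10, ⟨0, hκ1 1⟩)).2
    simp at this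
  have n6 : Nonempty Xt2 := by
    by_contra hcon
    rw [not_nonempty_iff] at hcon
    have := (hE2 1 (fun _ => x20, ⟨0, hκ2 1⟩)).2
    simp at this
  obtain ⟨qW, c1, c2, hqW, hc1, hc2, hq, hqWe⟩ := source_setup q3 hq3 hCI
  obtain ⟨p, s, hp, h1, h2, h3, h4⟩ := exact_sch f1 f2 q3 q4 (R01 * Real.log 2) N1 N2
    (approx f1 f2 q3 hq3 qW hqW c1 c2 hc1 hc2 hq q4 hq4
      (fun w => by simp only [hmarg, hqWe]) R01 R02 hach N1 N2 hN1 hN2)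
  obtain ⟨e, l, hl, hne, g1, g2, g3⟩ := three_red p hp
    (fun t => aQ (m1 q3) (s t).k1 (fun u => f1 ((s t).h1 u)))
    (fun t => aQ (m2 q3) (s t).k2 (fun u => f2 ((s t).h2 u)))
    (fun t => cQ q3 (s t).k1 (fun u => f1 ((s t).h1 u)) (s t).k2 (s t).kY)
  rw [Finset.sum_eq_zero_iff_of_nonneg
    (fun t _ => mul_nonneg (hp.1 t) (TVq_nonneg _ _))] at h4
  refine ⟨l, fun t => s (e t), hl, ?_, ?_, ?_, ?_⟩
  · exact g1 ▸ h1
  · exact g2 ▸ h2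
  · exact g3.trans h3
  · intro t
    have := (mul_eq_zero.1 (h4 (e t) (Finset.mem_univ _))).resolve_left (hne t)
    exact TVq_zero _ _ this

/-- Embedding of the base sample space. -/
def iotaB {N1 N2 : ℕ} (f1 : Xt1 → Yt1) (f2 : Xt2 → Yt2) (h1 : Fin 3 → Fin N1 → Xt1)
    (h2 : Fin 3 → Fin N2 → Xt2) (ω : X1 × X2 × Wa × Fin 3 × Fin N1 × Fin N2 × Ya) :
    X1 × X2 × Wa × Fin 3 × Fin N1 × Fin N2 × Xt1 × Xt2 × (Yt1 × Yt2) × Ya :=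
  (ω.1, ω.2.1, ω.2.2.1, ω.2.2.2.1, ω.2.2.2.2.1, ω.2.2.2.2.2.1,
    h1 ω.2.2.2.1 ω.2.2.2.2.1, h2 ω.2.2.2.1 ω.2.2.2.2.2.1,
    (f1 (h1 ω.2.2.2.1 ω.2.2.2.2.1), f2 (h2 ω.2.2.2.1 ω.2.2.2.2.2.1)), ω.2.2.2.2.2.2)

lemma Hb_push {Ω Ω' α : Type*} [Fintype Ω] [Fintype Ω'] [DecidableEq Ω'] [Fintype α]
    [DecidableEq α] (ν : Ω → ℝ) (ι : Ω → Ω') (X : Ω' → α) :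
    Hb (rvDist ν ι) X = Hb ν (fun ω => X (ι ω)) := by
  unfold Hb
  congr 1
  funext a
  rw [rvDist_comp ν ι X a]
  rfl

lemma condHb_push {Ω Ω' α γ : Type*} [Fintype Ω] [Fintype Ω'] [DecidableEq Ω'] [Fintype α]
    [DecidableEq α] [Fintype γ] [DecidableEq γ] (ν : Ω → ℝ) (ι : Ω → Ω') (X : Ω' → α)
    (Z : Ω' → γ) :
    condHb (rvDist ν ι) X Z = condHb ν (fun ω => X (ι ω)) (fun ω => Z (ι ω)) := by
  unfold condHb
  simp only [Hb_push]

lemma condIb_push {Ω Ω' α β γ : Type*} [Fintype Ω] [Fintype Ω'] [DecidableEq Ω'] [Fintype α]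
    [DecidableEq α] [Fintype β] [DecidableEq β] [Fintype γ] [DecidableEq γ] (ν : Ω → ℝ)
    (ι : Ω → Ω') (X : Ω' → α) (Y : Ω' → β) (Z : Ω' → γ) :
    condIb (rvDist ν ι) X Y Z =
      condIb ν (fun ω => X (ι ω)) (fun ω => Y (ι ω)) (fun ω => Z (ι ω)) := by
  unfold condIb
  simp only [Hb_push]

lemma mu_form {N1 N2 : ℕ} (f1 : Xt1 → Yt1) (f2 : Xt2 → Yt2) (h1 : Fin 3 → Fin N1 → Xt1)
    (h2 : Fin 3 → Fin N2 → Xt2)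
    [DecidableEq (X1 × X2 × Wa × Fin 3 × Fin N1 × Fin N2 × Xt1 × Xt2 × (Yt1 × Yt2) × Ya)]
    (ν : X1 × X2 × Wa × Fin 3 × Fin N1 × Fin N2 × Ya → ℝ)
    (x1 : X1) (x2 : X2) (w : Wa) (t : Fin 3) (u1 : Fin N1) (u2 : Fin N2) (xt1 : Xt1) (xt2 : Xt2)
    (yt : Yt1 × Yt2) (y : Ya) :
    rvDist ν (iotaB f1 f2 h1 h2) (x1, x2, w, t, u1, u2, xt1, xt2, yt, y) =
      if xt1 = h1 t u1 ∧ xt2 = h2 t u2 ∧ yt = (f1 xt1, f2 xt2) then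
        ν (x1, x2, w, t, u1, u2, y) else 0 := by
  unfold rvDist
  rw [Finset.sum_eq_single (x1, x2, w, t, u1, u2, y)]
  · simp only [iotaB, Prod.mk.injEq, true_and, and_true]
    by_cases h : xt1 = h1 t u1 ∧ xt2 = h2 t u2 ∧ yt = (f1 xt1, f2 xt2)
    · obtain ⟨rfl, rfl, rfl⟩ := h
      simp
    · rw [if_neg h, if_neg]
      rintro ⟨rfl, rfl, rfl⟩
      exact h ⟨rfl, rfl, rfl⟩
  · rintro ⟨a1, a2, a3, a4, a5, a6, a7⟩ _ hne
    rw [if_neg]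
    intro h
    simp only [iotaB, Prod.mk.injEq] at h
    obtain ⟨rfl, rfl, rfl, rfl, rfl, rfl, -, -, -, rfl⟩ := h
    exact hne rfl
  · simp

end fin
end

/-- **Theorem 2, converse direction** (deterministic links, conditionally independent
sources, no cribbing).  If `(R₀₁, R₀₂)` is achievable without cribbing (for some
`R₀₂ ≥ 0`) over the deterministic-links MAC `Ỹ = (f₁(X̃₁), f₂(X̃₂))` with sources
conditionally independent given `W`, then there exist finite auxiliary alphabets
(of cardinalities `|𝒯| ≤ 3`, `|𝒰₁| ≤ |𝒳₁||𝒳₂||𝒲||𝒳̃₁||𝒳̃₂||𝒴̃||𝒴|` and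
`|𝒰₂| ≤ |𝒰₁||𝒳₁||𝒳₂||𝒲||𝒳̃₁||𝒳̃₂||𝒴̃||𝒴|`) and a pmf of the form (7) whose
conditional `(X₁,X₂,W,Y)`-marginal given `T = t` is the target for every `t`,
satisfying (3a)–(3c). -/
theorem strong_coordination_det_links_converse
    {X1 X2 Wa Xt1 Xt2 Yt1 Yt2 Ya : Type*}
    [Fintype X1] [Fintype X2] [Fintype Wa] [Fintype Xt1] [Fintype Xt2]
    [Fintype Yt1] [Fintype Yt2] [Fintype Ya]
    [DecidableEq X1] [DecidableEq X2] [DecidableEq Wa] [DecidableEq Xt1] [DecidableEq Xt2]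
    [DecidableEq Yt1] [DecidableEq Yt2] [DecidableEq Ya]
    (f1 : Xt1 → Yt1) (f2 : Xt2 → Yt2)
    (q3 : X1 × X2 × Wa → ℝ) (hq3 : IsPMF q3)
    (q4 : X1 × X2 × Wa × Ya → ℝ) (hq4 : IsPMF q4)
    (hmarg : ∀ x1 x2 w, ∑ y, q4 (x1, x2, w, y) = q3 (x1, x2, w))
    -- `I(X₁; X₂ | W) = 0`, i.e. `q(w) q(x₁,x₂,w) = q(x₁,w) q(x₂,w)`
    (hCI : ∀ x1 x2 w, (∑ a : X1, ∑ b : X2, q3 (a, b, w)) * q3 (x1, x2, w) =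
      (∑ b : X2, q3 (x1, b, w)) * (∑ a : X1, q3 (a, x2, w)))
    (R01 R02 : ℝ) (hR01 : 0 ≤ R01) (hR02 : 0 ≤ R02)
    (hach : AchievableNoCrib q3 (detCh f1 f2) q4 R01 R02) :
    ∃ cT cU1 cU2 : ℕ,
      cT ≤ 3 ∧
      cU1 ≤ Fintype.card X1 * Fintype.card X2 * Fintype.card Wa * Fintype.card Xt1 *
        Fintype.card Xt2 * (Fintype.card Yt1 * Fintype.card Yt2) * Fintype.card Ya ∧
      cU2 ≤ cU1 * Fintype.card X1 * Fintype.card X2 * Fintype.card Wa * Fintype.card Xt1 *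
        Fintype.card Xt2 * (Fintype.card Yt1 * Fintype.card Yt2) * Fintype.card Ya ∧
      ∃ pT : Fin cT → ℝ, ∃ k1u : X1 × Fin cT → Fin cU1 → ℝ,
      ∃ k1x : Fin cU1 × X1 × Fin cT → Xt1 → ℝ, ∃ k2u : X2 × Fin cT → Fin cU2 → ℝ,
      ∃ k2x : Fin cU2 × X2 × Fin cT → Xt2 → ℝ,
      ∃ kY : Fin cU1 × Fin cU2 × Wa × (Yt1 × Yt2) × Fin cT → Ya → ℝ,
      ∃ μ : X1 × X2 × Wa × Fin cT × Fin cU1 × Fin cU2 × Xt1 × Xt2 × (Yt1 × Yt2) × Ya → ℝ,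
        IsPMF pT ∧ IsKernel k1u ∧ IsKernel k1x ∧ IsKernel k2u ∧ IsKernel k2x ∧
        IsKernel kY ∧
        -- the pmf `μ` has the factorized form (7)
        (∀ x1 x2 w t u1 u2 xt1 xt2 yt y,
          μ (x1, x2, w, t, u1, u2, xt1, xt2, yt, y) =
            q3 (x1, x2, w) * pT t * k1u (x1, t) u1 * k1x (u1, x1, t) xt1 *
              k2u (x2, t) u2 * k2x (u2, x2, t) xt2 *
              (if yt = (f1 xt1, f2 xt2) then 1 else 0) * kY (u1, u2, w, yt, t) y) ∧
        -- the conditional `(X₁,X₂,W,Y)`-marginal given `T = t` equals the target for every `t`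
        (∀ t x1 x2 w y,
          (∑ u1 : Fin cU1, ∑ u2 : Fin cU2, ∑ xt1 : Xt1, ∑ xt2 : Xt2,
            q3 (x1, x2, w) * k1u (x1, t) u1 * k1x (u1, x1, t) xt1 *
              k2u (x2, t) u2 * k2x (u2, x2, t) xt2 *
              kY (u1, u2, w, (f1 xt1, f2 xt2), t) y) = q4 (x1, x2, w, y)) ∧
        -- (3a): H(Ỹ₁ | W, T) ≥ I(U₁, Ỹ₁; X₁ | W, T)
        (condHb μ (fun ω => (pr9 ω).1) (fun ω => (pr3 ω, pr4 ω)) ≥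
          condIb μ (fun ω => (pr5 ω, (pr9 ω).1)) pr1 (fun ω => (pr3 ω, pr4 ω))) ∧
        -- (3b): H(Ỹ₂ | W, T) ≥ I(U₂, Ỹ₂; X₂ | W, T)
        (condHb μ (fun ω => (pr9 ω).2) (fun ω => (pr3 ω, pr4 ω)) ≥
          condIb μ (fun ω => (pr6 ω, (pr9 ω).2)) pr2 (fun ω => (pr3 ω, pr4 ω))) ∧
        -- (3c): R₀₁ ≥ I(U₁, Ỹ₁; X₁, Y | X₂, W, T) − H(Ỹ₁ | W, T)
        (R01 ≥ condIb μ (fun ω => (pr5 ω, (pr9 ω).1)) (fun ω => (pr1 ω, pr10 ω))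
            (fun ω => (pr2 ω, pr3 ω, pr4 ω))
          - condHb μ (fun ω => (pr9 ω).1) (fun ω => (pr3 ω, pr4 ω))) := by
  obtain ⟨N1, hN1⟩ : ∃ N : ℕ, N = Fintype.card X1 * Fintype.card X2 * Fintype.card Wa *
      Fintype.card Xt1 * Fintype.card Xt2 * (Fintype.card Yt1 * Fintype.card Yt2) *
      Fintype.card Ya := ⟨_, rfl⟩
  obtain ⟨N2, hN2⟩ : ∃ N : ℕ, N = N1 * Fintype.card X1 * Fintype.card X2 * Fintype.card Wa *
      Fintype.card Xt1 * Fintype.card Xt2 * (Fintype.card Yt1 * Fintype.card Yt2) *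
      Fintype.card Ya := ⟨_, rfl⟩
  obtain ⟨p, s, hp, ha1, ha2, hc, hM⟩ := main_sch f1 f2 q3 hq3 q4 hq4 hmarg hCI R01 R02 hach
    N1 N2 hN1 hN2
  letI : DecidableEq (X1 × X2 × Wa × Fin 3 × Fin N1 × Fin N2 × Xt1 × Xt2 × (Yt1 × Yt2) × Ya) :=
    Classical.decEq _
  let ν := nuB q3 p (fun t => (s t).k1) (fun t => (s t).k2) (fun t => (s t).kY)
  have hlaw1 := nuB_law1 q3 p (fun t => (s t).k1) (fun t => (s t).k2) (fun t => (s t).kY)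
    (fun t => (s t).hk2) (fun t => (s t).hkY)
  have hlaw2 := nuB_law2 q3 p (fun t => (s t).k1) (fun t => (s t).k2) (fun t => (s t).kY)
    (fun t => (s t).hk1) (fun t => (s t).hkY)
  have hlawJ := nuB_lawJ q3 p (fun t => (s t).k1) (fun t => (s t).k2) (fun t => (s t).kY)
  refine ⟨3, N1, N2, le_refl _, hN1.le, hN2.le, p, fun z => (s z.2).k1 z.1,
    fun z xt => if xt = (s z.2.2).h1 z.1 then 1 else 0, fun z => (s z.2).k2 z.1,
    fun z xt => if xt = (s z.2.2).h2 z.1 then 1 else 0,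
    fun z => (s z.2.2.2.2).kY z.1 z.2.1 z.2.2.1,
    rvDist ν (iotaB f1 f2 (fun t => (s t).h1) (fun t => (s t).h2)), hp,
    fun z => (s z.2).hk1 z.1, ?_, fun z => (s z.2).hk2 z.1, ?_,
    fun z => (s z.2.2.2.2).hkY z.1 z.2.1 z.2.2.1, ?_, ?_, ?_, ?_, ?_⟩
  · intro z
    refine ⟨fun b => ?_, by simp⟩
    beta_reduce
    split_ifs <;> norm_num
  · intro z
    refine ⟨fun b => ?_, by simp⟩
    beta_reduce
    split_ifs <;> norm_num
  · intro x1 x2 w t u1 u2 xt1 xt2 yt y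
    rw [mu_form]
    simp only
    by_cases e1 : xt1 = (s t).h1 u1
    · by_cases e2 : xt2 = (s t).h2 u2
      · by_cases e3 : yt = (f1 xt1, f2 xt2)
        · rw [if_pos ⟨e1, e2, e3⟩, if_pos e1, if_pos e2, if_pos e3]
          simp only [ν, nuB]
          ring
        · rw [if_neg (fun h => e3 h.2.2), if_neg e3]
          ring
      · rw [if_neg (fun h => e2 h.2.1), if_neg e2]
        ring
    · rw [if_neg (fun h => e1 h.1), if_neg e1]
      ring
  · intro t x1 x2 w y
    rw [← hM t x1 x2 w y]
    unfold mQ JJ DD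
    refine Finset.sum_congr rfl fun u1 _ => ?_
    rw [Finset.mul_sum]
    refine Finset.sum_congr rfl fun u2 _ => ?_
    rw [Finset.sum_eq_single ((s t).h1 u1) (by intro b _ hb; simp [hb]) (by simp)]
    rw [Finset.sum_eq_single ((s t).h2 u2) (by intro b _ hb; simp [hb]) (by simp)]
    simp only [if_true]
    ring
  · rw [condHb_push, condIb_push]
    exact single_ineq ν _ _ _ _ p (m1 q3) (fun t => (s t).k1) (fun t x => ((s t).hk1 x).2)
      (fun t u => f1 ((s t).h1 u)) hlaw1 ha1
  · rw [condHb_push, condIb_push]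
    exact single_ineq ν _ _ _ _ p (m2 q3) (fun t => (s t).k2) (fun t x => ((s t).hk2 x).2)
      (fun t u => f2 ((s t).h2 u)) hlaw2 ha2
  · rw [condHb_push, condIb_push]
    exact rate_ineq ν _ _ _ _ _ _ p q3 (fun t => (s t).k1) (fun t => (s t).k2)
      (fun t => (s t).kY) (fun t u => f1 ((s t).h1 u)) hlaw1 hlawJ R01 hc
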